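/- Let q = 2^f ≥ 4 and let a ∈ 𝔽_q be such that the subfield of 𝔽_q generated by a is all of 𝔽_q. Let x = x(a) and y be the 8×8 matrices over 𝔽_q with rows x: [0,0,0,0,0,1,0,0], [0,0,0,0,1,(a+1)²,(a+1)²,a], [0,0,0,0,0,(a+1)²,(a+1)²,a], [0,0,0,0,0,a,a,1], [0,1,1,0,0,0,0,0], [1,0,0,0,0,0,0,0], [1,0,1,a,0,0,0,0], [0,0,a,(a+1)²,0,0,0,0]; y: [1,0,0,0,0,0,0,0], [0,0,0,0,0,0,0,1], [0,0,0,0,0,1,0,0], [0,0,1,0,0,0,0,0], [0,0,0,0,1,0,0,0], [0,0,0,1,0,0,0,0], [0,1,0,0,0,0,0,0], [0,0,0,0,0,0,1,0]. Let Q⁺ be the quadratic form on 𝔽_q⁸ given by Q⁺(v) = v₁v₅ + v₂v₆ + v₃v₇ + v₄v₈, and let O(Q⁺) be the subgroup of GL₈(𝔽_q) of elements preserving Q⁺. Then x has order 2, y has order 3, and the subgroup of GL₈(𝔽_q) generated by x and y equals the derived subgroup of O(Q⁺), i.e., equals Ω₈⁺(q). In particular Ω₈⁺(q) is (2,3)-generated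 for all even q ≥ 4. -/

import Mathlib

open Matrix

/-- A group is `(2,3)`-generated if it is generated by an element of order 2
together with an element of order 3. -/
def IsTwoThreeGenerated (G : Type*) [Group G] : Prop :=
  ∃ x y : G, orderOf x = 2 ∧ orderOf y = 3 ∧ Subgroup.closure {x, y} = ⊤

/-- The plus-type quadratic form `Q⁺(v) = v₁v₅ + v₂v₆ + v₃v₇ + v₄v₈` on `F⁸`. -/
def QPlus (F : Type*) [Field F] (v : Fin 8 → F) : F :=
  v 0 * v 4 + v 1 * v 5 + v 2 * v 6 + v 3 * v 7

/-- The group of linear automorphisms of `F⁸` preserving the form `Q`,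
as a subgroup of `GL₈(F)`. -/
def orthogonalGroupOf (F : Type*) [Field F] (Q : (Fin 8 → F) → F) :
    Subgroup (GL (Fin 8) F) where
  carrier := {g | ∀ v, Q ((g : Matrix (Fin 8) (Fin 8) F).mulVec v) = Q v}
  one_mem' := by
    intro v
    simp
  mul_mem' := by
    intro a b ha hb v
    have h : ((a * b : GL (Fin 8) F) : Matrix (Fin 8) (Fin 8) F).mulVec v
        = (a : Matrix (Fin 8) (Fin 8) F).mulVec
            ((b : Matrix (Fin 8) (Fin 8) F).mulVec v) := by
      simp [Matrix.mulVec_mulVec]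
    rw [h, ha, hb]
  inv_mem' := by
    intro a ha v
    have h1 : (a : Matrix (Fin 8) (Fin 8) F).mulVec
        (((a⁻¹ : GL (Fin 8) F) : Matrix (Fin 8) (Fin 8) F).mulVec v) = v := by
      rw [Matrix.mulVec_mulVec, ← Units.val_mul, mul_inv_cancel]
      simp
    calc Q (((a⁻¹ : GL (Fin 8) F) : Matrix (Fin 8) (Fin 8) F).mulVec v)
        = Q ((a : Matrix (Fin 8) (Fin 8) F).mulVec
            (((a⁻¹ : GL (Fin 8) F) : Matrix (Fin 8) (Fin 8) F).mulVec v)) := (ha _).symm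
      _ = Q v := by rw [h1]


/-- The generator `x = x(a)` of order 2 for `Ω₈⁺(q)` in characteristic 2. -/
def xPlusEven (K : Type*) [Field K] (a : K) : Matrix (Fin 8) (Fin 8) K :=
  !![0, 0, 0, 0, 0, 1, 0, 0;
     0, 0, 0, 0, 1, (a+1)^2, (a+1)^2, a;
     0, 0, 0, 0, 0, (a+1)^2, (a+1)^2, a;
     0, 0, 0, 0, 0, a, a, 1;
     0, 1, 1, 0, 0, 0, 0, 0;
     1, 0, 0, 0, 0, 0, 0, 0;
     1, 0, 1, a, 0, 0, 0, 0;
     0, 0, a, (a+1)^2, 0, 0, 0, 0]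

/-- The generator `y` of order 3 for `Ω₈⁺(q)`. -/
def yPlus (K : Type*) [Field K] : Matrix (Fin 8) (Fin 8) K :=
  !![1, 0, 0, 0, 0, 0, 0, 0;
     0, 0, 0, 0, 0, 0, 0, 1;
     0, 0, 0, 0, 0, 1, 0, 0;
     0, 0, 1, 0, 0, 0, 0, 0;
     0, 0, 0, 0, 1, 0, 0, 0;
     0, 0, 0, 1, 0, 0, 0, 0;
     0, 1, 0, 0, 0, 0, 0, 0;
     0, 0, 0, 0, 0, 0, 1, 0]

namespace OmegaEight

section Form

variable {F : Type*} [Field F]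

/-- The polar form of `QPlus`. -/
def polar (u v : Fin 8 → F) : F :=
  u 0 * v 4 + u 4 * v 0 + u 1 * v 5 + u 5 * v 1 + u 2 * v 6 + u 6 * v 2 + u 3 * v 7 + u 7 * v 3

lemma polar_comm (u v : Fin 8 → F) : polar u v = polar v u := by
  simp only [polar]; ring

lemma polar_add_left (u v w : Fin 8 → F) : polar (u + v) w = polar u w + polar v w := by
  simp only [polar, Pi.add_apply]; ring

lemma polar_add_right (u v w : Fin 8 → F) : polar u (v + w) = polar u v + polar u w := by
  simp only [polar, Pi.add_apply]; ring

lemma polar_smul_left (c : F) (u v : Fin 8 → F) : polar (c • u) v = c * polar u v := by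
  simp only [polar, Pi.smul_apply, smul_eq_mul]; ring

lemma polar_smul_right (c : F) (u v : Fin 8 → F) : polar u (c • v) = c * polar u v := by
  simp only [polar, Pi.smul_apply, smul_eq_mul]; ring

lemma QPlus_add (u v : Fin 8 → F) : QPlus F (u + v) = QPlus F u + QPlus F v + polar u v := by
  simp only [polar, QPlus, Pi.add_apply]; ring

lemma QPlus_smul (c : F) (u : Fin 8 → F) : QPlus F (c • u) = c ^ 2 * QPlus F u := by
  simp only [QPlus, Pi.smul_apply, smul_eq_mul]; ring

lemma polar_self [CharP F 2] (u : Fin 8 → F) : polar u u = 0 := by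
  have h2 : (2 : F) = 0 := CharTwo.two_eq_zero
  simp only [polar]
  linear_combination (u 0 * u 4 + u 1 * u 5 + u 2 * u 6 + u 3 * u 7) * h2

lemma polar_mulVec {g : GL (Fin 8) F} (hg : g ∈ orthogonalGroupOf F (QPlus F))
    (u v : Fin 8 → F) : polar (g.1 *ᵥ u) (g.1 *ᵥ v) = polar u v := by
  have h1 : QPlus F (g.1 *ᵥ (u + v)) = QPlus F (u + v) := hg _
  have h2 : QPlus F (g.1 *ᵥ u) = QPlus F u := hg _
  have h3 : QPlus F (g.1 *ᵥ v) = QPlus F v := hg _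
  rw [mulVec_add, QPlus_add, QPlus_add, h2, h3] at h1
  exact add_left_cancel h1

lemma mulVec_mul_apply (g h : GL (Fin 8) F) (v : Fin 8 → F) :
    (g * h).1 *ᵥ v = g.1 *ᵥ (h.1 *ᵥ v) := by
  rw [mulVec_mulVec, Units.val_mul]

lemma mulVec_inv_cancel (g : GL (Fin 8) F) (v : Fin 8 → F) :
    g.1 *ᵥ ((g⁻¹).1 *ᵥ v) = v := by
  rw [← mulVec_mul_apply, mul_inv_cancel, Units.val_one, one_mulVec]

lemma inv_mulVec_cancel (g : GL (Fin 8) F) (v : Fin 8 → F) :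
    (g⁻¹).1 *ᵥ (g.1 *ᵥ v) = v := by
  rw [← mulVec_mul_apply, inv_mul_cancel, Units.val_one, one_mulVec]

lemma GL_ext_mulVec {g h : GL (Fin 8) F} (H : ∀ v, g.1 *ᵥ v = h.1 *ᵥ v) : g = h :=
  Units.ext (Matrix.mulVec_injective (funext H))

end Form

section Siegel

variable {F : Type*} [Field F]

/-- The image of `w` under the Siegel transformation attached to a singular vector `r` and a
vector `v` orthogonal to `r`. -/
def siegelFun (r v w : Fin 8 → F) : Fin 8 → F :=
  w + polar v w • r + polar r w • v + (QPlus F v * polar r w) • r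

/-- `g` acts as the Siegel transformation attached to `r` and `v`. -/
def IsSiegel (g : GL (Fin 8) F) (r v : Fin 8 → F) : Prop :=
  ∀ w, g.1 *ᵥ w = siegelFun r v w

/-- The subgroup `H` contains the Siegel transformation attached to `r` and `v`. -/
def HasSiegel (H : Subgroup (GL (Fin 8) F)) (r v : Fin 8 → F) : Prop :=
  ∃ g ∈ H, IsSiegel g r v

lemma siegelFun_smul_left (c : F) (r v w : Fin 8 → F) :
    siegelFun (c • r) v w = siegelFun r (c • v) w := by
  ext i
  simp only [siegelFun, polar_smul_left, QPlus_smul, Pi.add_apply, Pi.smul_apply, smul_eq_mul]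
  ring

lemma hasSiegel_smul_left {H : Subgroup (GL (Fin 8) F)} {c : F} {r v : Fin 8 → F} :
    HasSiegel H (c • r) v ↔ HasSiegel H r (c • v) := by
  simp only [HasSiegel, IsSiegel, siegelFun_smul_left]

lemma IsSiegel.conj {g k : GL (Fin 8) F} {r v : Fin 8 → F} (h : IsSiegel g r v)
    (hk : k ∈ orthogonalGroupOf F (QPlus F)) :
    IsSiegel (k * g * k⁻¹) (k.1 *ᵥ r) (k.1 *ᵥ v) := by
  intro w
  obtain ⟨w, rfl⟩ : ∃ w', w = k.1 *ᵥ w' := ⟨_, (mulVec_inv_cancel k w).symm⟩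
  have hQ : QPlus F (k.1 *ᵥ v) = QPlus F v := hk v
  rw [mulVec_mul_apply, inv_mulVec_cancel, mulVec_mul_apply, h w]
  simp only [siegelFun, polar_mulVec hk, hQ, mulVec_add, mulVec_smul]

lemma HasSiegel.conj {H : Subgroup (GL (Fin 8) F)} {k : GL (Fin 8) F} {r v : Fin 8 → F}
    (h : HasSiegel H r v) (hkH : k ∈ H) (hk : k ∈ orthogonalGroupOf F (QPlus F)) :
    HasSiegel H (k.1 *ᵥ r) (k.1 *ᵥ v) := by
  obtain ⟨g, hg, h⟩ := h
  exact ⟨_, H.mul_mem (H.mul_mem hkH hg) (H.inv_mem hkH), h.conj hk⟩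

lemma siegelFun_add {r v v' : Fin 8 → F} (hv : polar r v = 0)
    (hv' : polar r v' = 0) [CharP F 2] (w : Fin 8 → F) :
    siegelFun r v (siegelFun r v' w) = siegelFun r (v + v') w := by
  have hrr := polar_self r
  have hvr : polar v r = 0 := by rw [polar_comm, hv]
  ext i
  simp only [siegelFun, QPlus_add, polar_add_left, polar_add_right, polar_smul_right,
    hrr, hv', hvr, Pi.add_apply, Pi.smul_apply, smul_eq_mul]
  ring

lemma HasSiegel.add [CharP F 2] {H : Subgroup (GL (Fin 8) F)} {r v v' : Fin 8 → F}
    (hv : polar r v = 0) (hv' : polar r v' = 0)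
    (h : HasSiegel H r v) (h' : HasSiegel H r v') : HasSiegel H r (v + v') := by
  obtain ⟨g, hg, h⟩ := h
  obtain ⟨g', hg', h'⟩ := h'
  exact ⟨g * g', H.mul_mem hg hg', fun w => by
    rw [mulVec_mul_apply, h', h, siegelFun_add hv hv']⟩

lemma siegelFun_smul_self [CharP F 2] {r : Fin 8 → F} (hr : QPlus F r = 0) (c : F)
    (w : Fin 8 → F) : siegelFun r (c • r) w = w := by
  have h2 : (2 : F) = 0 := CharTwo.two_eq_zero
  ext i
  simp only [siegelFun, QPlus_smul, polar_smul_left, hr, Pi.add_apply, Pi.smul_apply, smul_eq_mul]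
  linear_combination (c * polar r w * r i) * h2

lemma hasSiegel_smul_self [CharP F 2] (H : Subgroup (GL (Fin 8) F)) {r : Fin 8 → F}
    (hr : QPlus F r = 0) (c : F) : HasSiegel H r (c • r) :=
  ⟨1, H.one_mem, fun w => by
    rw [siegelFun_smul_self hr, Units.val_one, one_mulVec]⟩

lemma exists_isSiegel [CharP F 2] {r v : Fin 8 → F} (hr : QPlus F r = 0) (hv : polar r v = 0) :
    ∃ g : GL (Fin 8) F, IsSiegel g r v := by
  let f : (Fin 8 → F) →ₗ[F] (Fin 8 → F) :=
    { toFun := siegelFun r v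
      map_add' := fun x y => by
        ext i
        simp only [siegelFun, polar_add_right, Pi.add_apply, Pi.smul_apply, smul_eq_mul]
        ring
      map_smul' := fun c x => by
        ext i
        simp only [siegelFun, polar_smul_right, Pi.add_apply, Pi.smul_apply, smul_eq_mul,
          RingHom.id_apply]
        ring }
  have hf : f ∘ₗ f = LinearMap.id := by
    ext1 i
    ext1
    change siegelFun r v (siegelFun r v _) = _
    rw [siegelFun_add hv hv, CharTwo.add_self_eq_zero, ← zero_smul F r,
      siegelFun_smul_self hr]
    rfl
  have hM : LinearMap.toMatrix' f * LinearMap.toMatrix' f = 1 := by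
    rw [← LinearMap.toMatrix'_comp, hf, LinearMap.toMatrix'_id]
  exact ⟨⟨_, _, hM, hM⟩, fun w => LinearMap.toMatrix'_mulVec f w⟩

lemma IsSiegel.mem_orthogonal [CharP F 2] {g : GL (Fin 8) F} {r v : Fin 8 → F}
    (h : IsSiegel g r v) (hr : QPlus F r = 0) (hv : polar r v = 0) :
    g ∈ orthogonalGroupOf F (QPlus F) := by
  intro w
  have h2 : (2 : F) = 0 := CharTwo.two_eq_zero
  have hvr : polar v r = 0 := by rw [polar_comm, hv]
  rw [h w]
  simp only [siegelFun, QPlus_add, QPlus_smul, polar_add_left, polar_smul_left, polar_smul_right,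
    hr, hv, hvr, polar_self, polar_comm w r, polar_comm w v]
  linear_combination (polar r w * polar v w + polar r w ^ 2 * QPlus F v) * h2

/-- A Siegel transformation attached to `t` moves `u` to `w` when `u` and `w` have the same norm
and the same nonzero product with `t`. -/
lemma siegelFun_eq_of_polar_eq [CharP F 2] {t u w : Fin 8 → F} {c : F} (hc : c ≠ 0)
    (hu : polar t u = c) (hQ : QPlus F u = QPlus F w) :
    siegelFun t (c⁻¹ • (u + w)) u = w := by
  have h2 : (2 : F) = 0 := CharTwo.two_eq_zero
  ext i
  simp only [siegelFun, QPlus_add, QPlus_smul, polar_add_left, polar_smul_left, hu, hQ,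
    polar_self, polar_comm w u, Pi.add_apply, Pi.smul_apply, smul_eq_mul]
  field_simp
  linear_combination (polar u w * t i + c * u i + t i * QPlus F w) * h2

end Siegel

section Transitivity

variable {F : Type*} [Field F] [CharP F 2] {H : Subgroup (GL (Fin 8) F)}

lemma exists_polar_ne_zero {r : Fin 8 → F} (hr : r ≠ 0) : ∃ s, polar s r ≠ 0 := by
  by_contra! h
  apply hr
  have key : ∀ i : Fin 8, polar (Pi.single i 1) r = r (i + 4) := by
    intro i
    fin_cases i <;> simp [polar]
  ext i
  have := key (i + 4)
  rw [h, add_assoc, show (4 + 4 : Fin 8) = 0 from rfl, add_zero] at this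
  simpa using this.symm

/-- All Siegel transformations attached to `r` lie in `H`. -/
def HasAllSiegel (H : Subgroup (GL (Fin 8) F)) (r : Fin 8 → F) : Prop :=
  ∀ v, polar r v = 0 → HasSiegel H r v

lemma HasAllSiegel.map {r : Fin 8 → F} (h : HasAllSiegel H r) {k : GL (Fin 8) F} (hkH : k ∈ H)
    (hk : k ∈ orthogonalGroupOf F (QPlus F)) : HasAllSiegel H (k.1 *ᵥ r) := by
  intro v hv
  obtain ⟨v, rfl⟩ : ∃ w, v = k.1 *ᵥ w := ⟨_, (mulVec_inv_cancel k v).symm⟩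
  rw [polar_mulVec hk] at hv
  exact (h v hv).conj hkH hk

lemma HasAllSiegel.smul {r : Fin 8 → F} (h : HasAllSiegel H r) (c : F) :
    HasAllSiegel H (c • r) := by
  intro v hv
  rw [hasSiegel_smul_left]
  rw [polar_smul_left] at hv
  exact h _ (by rw [polar_smul_right, hv])

/-- If all Siegel transformations attached to `t` and to `u` lie in `H`, and `t` is not orthogonal
to `u` nor to the singular vector `w`, then the same holds for `w`. -/
lemma HasAllSiegel.transport (hH : H ≤ orthogonalGroupOf F (QPlus F)) {t u w : Fin 8 → F}
    (ht : HasAllSiegel H t) (hu : HasAllSiegel H u)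
    (hQu : QPlus F u = 0) (hQw : QPlus F w = 0)
    (htu : polar t u ≠ 0) (htw : polar t w ≠ 0) : HasAllSiegel H w := by
  set c := polar t w / polar t u with hc
  have hcu : polar t (c • u) = polar t w := by
    rw [polar_smul_right, hc, div_mul_cancel₀ _ htu]
  have hQ : QPlus F (c • u) = QPlus F w := by rw [QPlus_smul, hQu, hQw, mul_zero]
  obtain ⟨g, hg, hS⟩ := ht ((polar t w)⁻¹ • (c • u + w)) (by
    rw [polar_smul_right, polar_add_right, hcu, CharTwo.add_self_eq_zero, mul_zero])
  have := (hu.smul c).map hg (hH hg)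
  rwa [hS, siegelFun_eq_of_polar_eq htw hcu hQ] at this

lemma hasAllSiegel_of_hyperbolic_pair (hH : H ≤ orthogonalGroupOf F (QPlus F))
    {p p' : Fin 8 → F}
    (hp : HasAllSiegel H p) (hp' : HasAllSiegel H p') (hQp : QPlus F p = 0)
    (hQp' : QPlus F p' = 0) (hpp : polar p p' ≠ 0) {r : Fin 8 → F} (hr : r ≠ 0)
    (hQr : QPlus F r = 0) : HasAllSiegel H r := by
  have hpp' : polar p' p ≠ 0 := by rwa [polar_comm]
  by_cases h1 : polar p r = 0
  swap
  · exact hp.transport hH hp' hQp' hQr hpp h1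
  by_cases h2 : polar p' r = 0
  swap
  · exact hp'.transport hH hp hQp hQr hpp' h2
  obtain ⟨s, hs⟩ := exists_polar_ne_zero hr
  set c := polar p p' with hc
  have hc' : polar p' p = c := polar_comm _ _
  set s' := s + (polar p' s / c) • p + (polar p s / c) • p' with hs'
  have hps : polar p s' = 0 := by
    rw [hs', polar_add_right, polar_add_right, polar_smul_right, polar_smul_right, polar_self,
      ← hc, div_mul_cancel₀ _ hpp, mul_zero, add_zero, CharTwo.add_self_eq_zero]
  have hp's : polar p' s' = 0 := by
    rw [hs', polar_add_right, polar_add_right, polar_smul_right, polar_smul_right, polar_self,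
      hc', div_mul_cancel₀ _ hpp, mul_zero, add_zero, CharTwo.add_self_eq_zero]
  have hsr : polar s' r = polar s r := by
    rw [hs', polar_add_left, polar_add_left, polar_smul_left, polar_smul_left, h1, h2]
    ring
  set t := p' + s' + (QPlus F s' / c) • p with ht
  have hQt : QPlus F t = 0 := by
    rw [ht, QPlus_add, QPlus_add, QPlus_smul, polar_add_left, polar_smul_right, polar_smul_right,
      hQp, hQp', hc', hp's, polar_comm s' p, hps, div_mul_cancel₀ _ hpp]
    linear_combination QPlus F s' * (CharTwo.two_eq_zero : (2 : F) = 0)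
  have hpt : polar p t = c := by
    rw [ht, polar_add_right, polar_add_right, polar_smul_right, polar_self, hps, ← hc]
    ring
  have htr : polar t r = polar s r := by
    rw [ht, polar_add_left, polar_add_left, polar_smul_left, h1, h2, hsr]
    ring
  have hgood : HasAllSiegel H t := hp.transport hH hp' hQp' hQt hpp (by rwa [hpt])
  exact hgood.transport hH hp hQp hQr (by rwa [polar_comm, hpt]) (by rwa [htr])

end Transitivity

section Generation

variable (F : Type*) [Field F]

/-- The subgroup generated by all Siegel transformations. -/
def siegelGroup : Subgroup (GL (Fin 8) F) :=
  Subgroup.closure {g | ∃ r v, QPlus F r = 0 ∧ polar r v = 0 ∧ IsSiegel g r v}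

variable {F} [CharP F 2]

lemma siegelGroup_le_of_hyperbolic_pair {H : Subgroup (GL (Fin 8) F)}
    (hH : H ≤ orthogonalGroupOf F (QPlus F)) {p p' : Fin 8 → F}
    (hp : HasAllSiegel H p) (hp' : HasAllSiegel H p') (hQp : QPlus F p = 0)
    (hQp' : QPlus F p' = 0) (hpp : polar p p' ≠ 0) : siegelGroup F ≤ H := by
  rw [siegelGroup, Subgroup.closure_le]
  rintro g ⟨r, v, hr, hv, hg⟩
  by_cases h0 : r = 0
  · have : g = 1 := GL_ext_mulVec fun w => by
      rw [hg w, h0, Units.val_one, one_mulVec]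
      ext i
      simp [siegelFun, polar]
    rw [this]
    exact H.one_mem
  · obtain ⟨k, hk, hS⟩ := hasAllSiegel_of_hyperbolic_pair hH hp hp' hQp hQp' hpp h0 hr v hv
    have : g = k := GL_ext_mulVec fun w => by rw [hg w, hS w]
    rwa [this]

lemma siegelGroup_le_orthogonal : siegelGroup F ≤ orthogonalGroupOf F (QPlus F) := by
  rw [siegelGroup, Subgroup.closure_le]
  rintro g ⟨r, v, hr, hv, hg⟩
  exact hg.mem_orthogonal hr hv

lemma conj_mem_siegelGroup {g k : GL (Fin 8) F} (hg : g ∈ siegelGroup F)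
    (hk : k ∈ orthogonalGroupOf F (QPlus F)) : k * g * k⁻¹ ∈ siegelGroup F := by
  have : siegelGroup F ≤ (siegelGroup F).comap (MulAut.conj k).toMonoidHom := by
    conv_lhs => rw [siegelGroup]
    rw [Subgroup.closure_le]
    rintro g ⟨r, v, hr, hv, hg⟩
    refine Subgroup.subset_closure ⟨k.1 *ᵥ r, k.1 *ᵥ v, ?_, ?_, ?_⟩
    · rw [hk r, hr]
    · rw [polar_mulVec hk, hv]
    · simpa using hg.conj hk
  simpa using this hg

lemma exists_mem_siegelGroup {r v : Fin 8 → F} (hr : QPlus F r = 0) (hv : polar r v = 0) :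
    ∃ g ∈ siegelGroup F, IsSiegel g r v := by
  obtain ⟨g, hg⟩ := exists_isSiegel hr hv
  exact ⟨g, Subgroup.subset_closure ⟨r, v, hr, hv, hg⟩, hg⟩

/-- The standard basis vector. -/
abbrev e (i : Fin 8) : Fin 8 → F := Pi.single i 1

lemma polar_e_left (i : Fin 8) (v : Fin 8 → F) : polar (e i) v = v (i + 4) := by
  fin_cases i <;> simp [polar]

lemma polar_e_right (i : Fin 8) (v : Fin 8 → F) : polar v (e i) = v (i + 4) := by
  rw [polar_comm, polar_e_left]

omit [CharP F 2] in
lemma QPlus_e (i : Fin 8) : QPlus F (e i) = 0 := by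
  fin_cases i <;> simp [QPlus]

/-- The vectors supported on the hyperbolic planes with index at least `k`. -/
def tailSpace (F : Type*) [Field F] (k : ℕ) : Submodule F (Fin 8 → F) where
  carrier := {v | ∀ i : Fin 8, i.val % 4 < k → v i = 0}
  zero_mem' := fun _ _ => rfl
  add_mem' := fun hu hv i hi => by simp [hu i hi, hv i hi]
  smul_mem' := fun c v hv i hi => by simp [hv i hi]

/-- The elements fixing the hyperbolic planes with index below `k` pointwise. -/
def headFixer (F : Type*) [Field F] (k : ℕ) : Subgroup (GL (Fin 8) F) where
  carrier := {g | ∀ i : Fin 8, i.val % 4 < k → g.1 *ᵥ (e i) = e i}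
  one_mem' := fun i _ => by rw [Units.val_one, one_mulVec]
  mul_mem' := fun {g h} hg hh i hi => by rw [mulVec_mul_apply, hh i hi, hg i hi]
  inv_mem' := fun {g} hg i hi => by
    conv_lhs => rw [← hg i hi]
    exact inv_mulVec_cancel g _

lemma e_mem_tailSpace {k : ℕ} {i : Fin 8} (hi : k ≤ i.val % 4) : e i ∈ tailSpace F k := by
  intro j hj
  rw [e, Pi.single_apply, if_neg]
  rintro rfl
  omega

lemma val_add_four_mod (i : Fin 8) : (i + 4).val % 4 = i.val % 4 := by
  revert i; decide

lemma polar_e_of_tail {k : ℕ} {v : Fin 8 → F} (hv : v ∈ tailSpace F k) {i : Fin 8}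
    (hi : i.val % 4 < k) : polar v (e i) = 0 := by
  rw [polar_e_right]
  exact hv _ (by rwa [val_add_four_mod])

lemma exists_mem_headFixer {k : ℕ} {r v : Fin 8 → F} (hr : QPlus F r = 0) (hv : polar r v = 0)
    (hrk : r ∈ tailSpace F k) (hvk : v ∈ tailSpace F k) :
    ∃ g ∈ siegelGroup F ⊓ headFixer F k, IsSiegel g r v := by
  obtain ⟨g, hg, hS⟩ := exists_mem_siegelGroup hr hv
  refine ⟨g, ⟨hg, fun i hi => ?_⟩, hS⟩
  rw [hS, siegelFun, polar_e_of_tail hrk hi, polar_e_of_tail hvk hi]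
  simp

lemma mulVec_mem_tailSpace {k : ℕ} {g : GL (Fin 8) F}
    (hg : g ∈ orthogonalGroupOf F (QPlus F)) (hgk : g ∈ headFixer F k) {v : Fin 8 → F}
    (hv : v ∈ tailSpace F k) : g.1 *ᵥ v ∈ tailSpace F k := by
  intro i hi
  have h4 : (i + 4).val % 4 < k := by rwa [val_add_four_mod]
  have h := polar_mulVec hg v (e (i + 4))
  rw [hgk _ h4, polar_e_right, polar_e_right, add_assoc, show (4 + 4 : Fin 8) = 0 from rfl,
    add_zero] at h
  rw [h, hv i hi]

/-- Orbits of `siegelGroup F ⊓ headFixer F k` on vectors. -/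
def SameOrbit (k : ℕ) (u w : Fin 8 → F) : Prop :=
  ∃ g ∈ siegelGroup F ⊓ headFixer F k, g.1 *ᵥ u = w

lemma SameOrbit.trans {k : ℕ} {u v w : Fin 8 → F} (h : SameOrbit k u v) (h' : SameOrbit k v w) :
    SameOrbit k u w := by
  obtain ⟨g, hg, rfl⟩ := h
  obtain ⟨g', hg', rfl⟩ := h'
  exact ⟨g' * g, Subgroup.mul_mem _ hg' hg, mulVec_mul_apply _ _ _⟩

lemma sameOrbit_siegelFun {k : ℕ} {r v : Fin 8 → F} (hr : QPlus F r = 0) (hv : polar r v = 0)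
    (hrk : r ∈ tailSpace F k) (hvk : v ∈ tailSpace F k) (u : Fin 8 → F) :
    SameOrbit k u (siegelFun r v u) := by
  obtain ⟨g, hg, hS⟩ := exists_mem_headFixer hr hv hrk hvk
  exact ⟨g, hg, hS u⟩

lemma siegelFun_mem_tailSpace {k : ℕ} {r v u : Fin 8 → F}
    (hrk : r ∈ tailSpace F k) (hvk : v ∈ tailSpace F k) (hu : u ∈ tailSpace F k) :
    siegelFun r v u ∈ tailSpace F k :=
  Submodule.add_mem _ (Submodule.add_mem _ (Submodule.add_mem _ hu (Submodule.smul_mem _ _ hrk))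
    (Submodule.smul_mem _ _ hvk)) (Submodule.smul_mem _ _ hrk)

lemma QPlus_siegelFun {r v : Fin 8 → F} (hr : QPlus F r = 0) (hv : polar r v = 0)
    (u : Fin 8 → F) : QPlus F (siegelFun r v u) = QPlus F u := by
  obtain ⟨g, hg, hS⟩ := exists_mem_siegelGroup hr hv
  rw [← hS u]
  exact siegelGroup_le_orthogonal hg u

/-- Singular vectors of the tail space with a nonzero coordinate outside the plane of `e k` are
conjugate to `e k`. -/
lemma sameOrbit_e_of_ne_zero {k i : Fin 8} (hk : k.val < 4) (hki : k.val < i.val % 4)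
    {u : Fin 8 → F} (hu : u ∈ tailSpace F k) (hQ : QPlus F u = 0) (hi : u i ≠ 0) :
    SameOrbit k u (e k) := by
  have hik : k ≠ i := by
    rintro rfl; omega
  have hik4 : k ≠ i + 4 := by
    intro h
    have := val_add_four_mod i
    rw [← h] at this
    omega
  have htk : e k ∈ tailSpace F (k : ℕ) := e_mem_tailSpace (by omega)
  have htk4 : e (k + 4) ∈ tailSpace F (k : ℕ) :=
    e_mem_tailSpace (by rw [val_add_four_mod]; omega)
  have hti : e (i + 4) ∈ tailSpace F (k : ℕ) :=
    e_mem_tailSpace (by rw [val_add_four_mod]; omega)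
  set c := (1 + u k) / u i with hc
  have hpol : polar (e (i + 4)) (c • e k) = (0 : F) := by
    rw [polar_smul_right, polar_e_left, add_assoc, show (4 + 4 : Fin 8) = 0 from rfl, add_zero, e,
      Pi.single_apply, if_neg (Ne.symm hik), mul_zero]
  have hsm := Submodule.smul_mem _ c htk
  refine (sameOrbit_siegelFun (QPlus_e _) hpol hti hsm u).trans ?_
  set w := siegelFun (e (i + 4)) (c • e k) u with hw
  have hwt : w ∈ tailSpace F (k : ℕ) := siegelFun_mem_tailSpace hti hsm hu
  have hQw : QPlus F w = 0 := by rw [hw, QPlus_siegelFun (QPlus_e _) hpol, hQ]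
  have hwk : w k = 1 := by
    rw [hw, siegelFun, polar_e_left, add_assoc i, show (4 + 4 : Fin 8) = 0 from rfl, add_zero]
    simp only [Pi.add_apply, Pi.smul_apply, smul_eq_mul, e, Pi.single_apply, if_neg hik4, hc,
      ↓reduceIte]
    field_simp
    linear_combination u k * (CharTwo.two_eq_zero : (2 : F) = 0)
  have hpw : polar (e (k + 4)) w = 1 := by
    rw [polar_e_left, add_assoc, show (4 + 4 : Fin 8) = 0 from rfl, add_zero, hwk]
  have hpk : polar (e (k + 4)) (e k) = (1 : F) := by
    rw [polar_e_left, add_assoc, show (4 + 4 : Fin 8) = 0 from rfl, add_zero]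
    simp
  have hmove := siegelFun_eq_of_polar_eq (t := e (k + 4)) (u := w) (w := e k) one_ne_zero hpw
    (by rw [hQw, QPlus_e])
  rw [← hmove]
  refine sameOrbit_siegelFun (QPlus_e _) ?_ htk4 ?_ w
  · rw [polar_smul_right, polar_add_right, hpw, hpk, CharTwo.add_self_eq_zero, mul_zero]
  · exact Submodule.smul_mem _ _ (Submodule.add_mem _ hwt htk)

lemma sameOrbit_e {k : Fin 8} (hk : k.val < 3) {u : Fin 8 → F} (hu : u ∈ tailSpace F k)
    (hQ : QPlus F u = 0) (h0 : u ≠ 0) : SameOrbit k u (e k) := by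
  by_cases hex : ∃ i : Fin 8, k.val < i.val % 4 ∧ u i ≠ 0
  · obtain ⟨i, hi, hui⟩ := hex
    exact sameOrbit_e_of_ne_zero (by omega) hi hu hQ hui
  push Not at hex
  obtain ⟨i, hi⟩ : ∃ i, u i ≠ 0 := Function.ne_iff.mp h0
  have hik : i.val % 4 = k.val := by
    rcases lt_trichotomy (i.val % 4) k.val with h | h | h
    · exact absurd (hu i h) hi
    · exact h
    · exact absurd (hex i h) hi
  have h4 : (4 + 4 : Fin 8) = 0 := rfl
  have h3k : (3 : Fin 8) ≠ i + 4 := by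
    intro h
    have := val_add_four_mod i
    rw [← h] at this
    simp at this
    omega
  have h7 : (3 + 4 : Fin 8) ≠ i + 4 := by
    intro h
    have := val_add_four_mod i
    rw [← h] at this
    simp at this
    omega
  have ht3 : e 3 ∈ tailSpace F (k : ℕ) := e_mem_tailSpace (by simp; omega)
  have hti : e (i + 4) ∈ tailSpace F (k : ℕ) :=
    e_mem_tailSpace (by rw [val_add_four_mod]; omega)
  have hpol : polar (e 3) (e (i + 4)) = (0 : F) := by
    rw [polar_e_left, e, Pi.single_apply, if_neg h7]
  refine (sameOrbit_siegelFun (QPlus_e 3) hpol ht3 hti u).trans ?_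
  refine sameOrbit_e_of_ne_zero (i := 3) (by omega) (by simp; omega)
    (siegelFun_mem_tailSpace ht3 hti hu) ?_ ?_
  · rw [QPlus_siegelFun (QPlus_e _) hpol, hQ]
  · rw [siegelFun, polar_e_left, polar_e_left, QPlus_e, add_assoc i, h4, add_zero,
      hex (3 + 4) (by simp; omega)]
    simp [hex 3 (by simp; omega), hi]

lemma mod_four_lt_or_eq : ∀ k i : Fin 8, k.val < 3 → i.val % 4 < k.val + 1 →
    i.val % 4 < k.val ∨ i = k ∨ i = k + 4 := by
  decide

/-- Every orthogonal transformation fixing the first `k` planes can be multiplied by a product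
of Siegel transformations so as to fix the first `k + 1` planes. -/
lemma exists_mul_mem_headFixer {k : Fin 8} (hk : k.val < 3) {g : GL (Fin 8) F}
    (hg : g ∈ orthogonalGroupOf F (QPlus F)) (hgk : g ∈ headFixer F k) :
    ∃ n ∈ siegelGroup F, n * g ∈ headFixer F (k + 1 : ℕ) := by
  have htk : e k ∈ tailSpace F (k : ℕ) := e_mem_tailSpace (by omega)
  have htk4 : e (k + 4) ∈ tailSpace F (k : ℕ) :=
    e_mem_tailSpace (by rw [val_add_four_mod]; omega)
  have hne : g.1 *ᵥ (e k) ≠ 0 := by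
    intro h
    have h' := inv_mulVec_cancel g (e k)
    rw [h, mulVec_zero] at h'
    have := congrFun h' k
    simp at this
  obtain ⟨n, ⟨hn, hnk⟩, hnu⟩ := sameOrbit_e hk (mulVec_mem_tailSpace hg hgk htk)
    (by rw [hg, QPlus_e]) hne
  have hngO := Subgroup.mul_mem _ (siegelGroup_le_orthogonal hn) hg
  have hngk := Subgroup.mul_mem _ hnk hgk
  have hngek : (n * g).1 *ᵥ (e k) = e k := by rw [mulVec_mul_apply, hnu]
  set w := (n * g).1 *ᵥ (e (k + 4)) with hw
  have hwt : w ∈ tailSpace F (k : ℕ) := mulVec_mem_tailSpace hngO hngk htk4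
  have h1 : polar (e k) (e (k + 4)) = (1 : F) := by
    rw [polar_e_left]; simp
  have hpw : polar (e k) w = 1 := by
    rw [← hngek, hw, polar_mulVec hngO, h1]
  have hQw : QPlus F w = QPlus F (e (k + 4)) := hngO _
  have hv : polar (e k) ((1 : F)⁻¹ • (w + e (k + 4))) = 0 := by
    rw [polar_smul_right, polar_add_right, hpw, h1, CharTwo.add_self_eq_zero, mul_zero]
  obtain ⟨m, ⟨hm, hmk⟩, hS⟩ := exists_mem_headFixer (QPlus_e k) hv htk
    (Submodule.smul_mem _ _ (Submodule.add_mem _ hwt htk4))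
  refine ⟨m * n, Subgroup.mul_mem _ hm hn, fun i hi => ?_⟩
  rw [mul_assoc, mulVec_mul_apply]
  rcases mod_four_lt_or_eq k i hk hi with h | rfl | rfl
  · rw [hngk i h, hmk i h]
  · rw [hngek, hS, siegelFun, polar_self, polar_comm _ (e i), hv]
    simp
  · rw [← hw, hS, siegelFun_eq_of_polar_eq one_ne_zero hpw hQw]

end Generation

section Commutator

variable {F : Type*} [Field F]

/-- The element of `GL₈(F)` permuting the coordinates by `π`. -/
def permGL (π : Equiv.Perm (Fin 8)) : GL (Fin 8) F where
  val := π.permMatrix F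
  inv := (π⁻¹).permMatrix F
  val_inv := by rw [← permMatrix_mul, inv_mul_cancel, permMatrix_one]
  inv_val := by rw [← permMatrix_mul, mul_inv_cancel, permMatrix_one]

lemma permGL_mulVec (π : Equiv.Perm (Fin 8)) (v : Fin 8 → F) :
    (permGL π : GL (Fin 8) F).1 *ᵥ v = v ∘ π :=
  permMatrix_mulVec π

variable (F) in
/-- The orthogonal transformation exchanging the coordinates `3` and `7`. -/
def planeSwap : GL (Fin 8) F := permGL (Equiv.swap 3 7)

lemma planeSwap_mem : planeSwap F ∈ orthogonalGroupOf F (QPlus F) := by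
  intro v
  rw [planeSwap, permGL_mulVec]
  simp only [QPlus, Function.comp_apply]
  have h : ∀ i : Fin 8, i ≠ 3 → i ≠ 7 → (Equiv.swap 3 7) i = i :=
    fun i => Equiv.swap_apply_of_ne_of_ne
  rw [h 0 (by decide) (by decide), h 1 (by decide) (by decide), h 2 (by decide) (by decide),
    h 4 (by decide) (by decide), h 5 (by decide) (by decide), h 6 (by decide) (by decide),
    Equiv.swap_apply_left, Equiv.swap_apply_right]
  ring

lemma mulVec_eq_sum_e (g : GL (Fin 8) F) (v : Fin 8 → F) :
    g.1 *ᵥ v = ∑ i, v i • g.1 *ᵥ (e i) := by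
  conv_lhs => rw [← Finset.univ_sum_single v]
  rw [← mulVecLin_apply, map_sum]
  refine Finset.sum_congr rfl fun i _ => ?_
  rw [mulVecLin_apply, ← mulVec_smul, e, ← Pi.single_smul, smul_eq_mul, mul_one]

variable [CharP F 2]

/-- A diagonal transformation of the last hyperbolic plane is a product of two Siegel
transformations. -/
lemma siegelFun_siegelFun_diag {μ : F} (hμ : μ ≠ 0) (v : Fin 8 → F) :
    siegelFun ![0, 0, 1, 1, 0, 0, μ, μ] ![0, 0, 0, μ⁻¹, 0, 0, 0, 1]
      (siegelFun ![0, 0, 1, μ, 0, 0, μ, 1] ![0, 0, 0, 1, 0, 0, 0, μ⁻¹] v) =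
      ![v 0, v 1, v 2, (μ ^ 2)⁻¹ * v 3, v 4, v 5, v 6, μ ^ 2 * v 7] := by
  have h2 : (2 : F) = 0 := CharTwo.two_eq_zero
  ext i
  fin_cases i <;>
    simp only [siegelFun, polar, QPlus, Pi.add_apply, Pi.smul_apply, smul_eq_mul, cons_val,
      Fin.mk_one, Fin.zero_eta, Fin.reduceFinMk, Fin.isValue, zero_mul, mul_zero, add_zero,
      zero_add, mul_one, one_mul] <;> try field_simp <;> ring_nf <;> reduce_mod_char!

lemma mem_siegelGroup_of_diag [Finite F] {g : GL (Fin 8) F} {c : F} (hc : c ≠ 0)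
    (hg : ∀ v, g.1 *ᵥ v = ![v 0, v 1, v 2, c⁻¹ * v 3, v 4, v 5, v 6, c * v 7]) :
    g ∈ siegelGroup F := by
  obtain ⟨μ, rfl⟩ : ∃ μ : F, c = μ ^ 2 := by
    obtain ⟨μ, hμ⟩ := (frobeniusEquiv F 2).surjective c
    exact ⟨μ, hμ.symm⟩
  have hμ : μ ≠ 0 := by rintro rfl; simp at hc
  have h2 : (2 : F) = 0 := CharTwo.two_eq_zero
  obtain ⟨k, hk, hkS⟩ := exists_mem_siegelGroup (r := ![0, 0, 1, 1, 0, 0, μ, μ])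
    (v := ![0, 0, 0, μ⁻¹, 0, 0, 0, 1])
    (by simp [QPlus, CharTwo.add_self_eq_zero])
    (by simp [polar, hμ, CharTwo.add_self_eq_zero])
  obtain ⟨l, hl, hlS⟩ := exists_mem_siegelGroup (r := ![0, 0, 1, μ, 0, 0, μ, 1])
    (v := ![0, 0, 0, 1, 0, 0, 0, μ⁻¹])
    (by simp [QPlus, CharTwo.add_self_eq_zero])
    (by simp [polar, hμ, CharTwo.add_self_eq_zero])
  have : g = k * l := GL_ext_mulVec fun v => by
    rw [hg, mulVec_mul_apply, hlS, hkS, siegelFun_siegelFun_diag hμ]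
  rw [this]
  exact Subgroup.mul_mem _ hk hl

lemma mem_siegelGroup_of_apply_three [Finite F] {g : GL (Fin 8) F}
    (hg : g ∈ orthogonalGroupOf F (QPlus F)) (hgk : g ∈ headFixer F 3)
    (h0 : (g.1 *ᵥ (e 3)) 7 = 0) : g ∈ siegelGroup F := by
  have h3 : g.1 *ᵥ (e 3) ∈ tailSpace F 3 :=
    mulVec_mem_tailSpace hg hgk (e_mem_tailSpace (by decide))
  have h7 : g.1 *ᵥ (e 7) ∈ tailSpace F 3 :=
    mulVec_mem_tailSpace hg hgk (e_mem_tailSpace (by decide))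
  have hB := polar_mulVec hg (e 3) (e 7)
  have hQ := hg (e 7)
  have a0 := h3 0 (by decide)
  have a1 := h3 1 (by decide)
  have a2 := h3 2 (by decide)
  have a4 := h3 4 (by decide)
  have a5 := h3 5 (by decide)
  have a6 := h3 6 (by decide)
  have b0 := h7 0 (by decide)
  have b1 := h7 1 (by decide)
  have b2 := h7 2 (by decide)
  have b4 := h7 4 (by decide)
  have b5 := h7 5 (by decide)
  have b6 := h7 6 (by decide)
  rw [polar_e_right, show (7 + 4 : Fin 8) = 3 from rfl, e, Pi.single_eq_same, polar] at hB
  rw [QPlus_e, QPlus] at hQ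
  simp only [a0, a1, a2, a4, a5, a6, b0, b1, b2, b4, b5, b6, h0, zero_mul, mul_zero, add_zero,
    zero_add] at hB hQ
  set c := (g.1 *ᵥ (e 7)) 7 with hc
  have hc0 : c ≠ 0 := by
    intro h
    rw [h, mul_zero] at hB
    exact zero_ne_one hB
  have ha3 : (g.1 *ᵥ (e 3)) 3 = c⁻¹ := eq_inv_of_mul_eq_one_left hB
  have hb3 : (g.1 *ᵥ (e 7)) 3 = 0 := (mul_eq_zero.mp hQ).resolve_right hc0
  refine mem_siegelGroup_of_diag hc0 fun v => ?_
  rw [mulVec_eq_sum_e, Fin.sum_univ_eight, hgk 0 (by decide), hgk 1 (by decide), hgk 2 (by decide),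
    hgk 4 (by decide), hgk 5 (by decide), hgk 6 (by decide)]
  clear hB hQ h3 h7
  clear_value c
  generalize g.1 *ᵥ (e 3) = u at *
  generalize g.1 *ᵥ (e 7) = w at *
  ext i
  fin_cases i <;>
    simp [a0, a1, a2, a4, a5, a6, b0, b1, b2, b4, b5, b6, h0, ha3, hb3, ← hc, mul_comm]

lemma mem_siegelGroup_or_planeSwap_mul_mem [Finite F] {g : GL (Fin 8) F}
    (hg : g ∈ orthogonalGroupOf F (QPlus F)) :
    g ∈ siegelGroup F ∨ planeSwap F * g ∈ siegelGroup F := by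
  have h0 : g ∈ headFixer F (0 : Fin 8) := fun i hi => absurd hi (by simp)
  obtain ⟨l, hl, hlg⟩ := exists_mul_mem_headFixer (by decide) hg h0
  have hlO := Subgroup.mul_mem _ (siegelGroup_le_orthogonal hl) hg
  obtain ⟨m, hm, hmg⟩ := exists_mul_mem_headFixer (k := 1) (by decide) hlO hlg
  have hmO := Subgroup.mul_mem _ (siegelGroup_le_orthogonal hm) hlO
  obtain ⟨n, hn, hng⟩ := exists_mul_mem_headFixer (k := 2) (by decide) hmO hmg
  have hnO := Subgroup.mul_mem _ (siegelGroup_le_orthogonal hn) hmO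
  have hprod : n * m * l ∈ siegelGroup F := mul_mem (mul_mem hn hm) hl
  have hassoc : n * (m * (l * g)) = n * m * l * g := by group
  rw [hassoc] at hng hnO
  set k := n * m * l with hk
  have h3 : (k * g).1 *ᵥ (e 3) ∈ tailSpace F 3 :=
    mulVec_mem_tailSpace hnO hng (e_mem_tailSpace (by decide))
  have hQ := hnO (e 3)
  rw [QPlus_e, QPlus, h3 0 (by decide), h3 1 (by decide), h3 2 (by decide)] at hQ
  simp only [zero_mul, zero_add] at hQ
  rcases mul_eq_zero.mp hQ with h | h
  · right
    have hfix : planeSwap F ∈ headFixer F 3 := by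
      intro i hi
      rw [planeSwap, permGL_mulVec]
      ext j
      revert i j
      have : ∀ i j : Fin 8, i.val % 4 < 3 → (Equiv.swap 3 7 j = i ↔ j = i) := by decide
      intro i hi j
      simp only [Function.comp_apply, e, Pi.single_apply, this i j hi]
    have := mem_siegelGroup_of_apply_three (mul_mem planeSwap_mem hnO) (mul_mem hfix hng) (by
      rw [mulVec_mul_apply, planeSwap, permGL_mulVec, Function.comp_apply,
        Equiv.swap_apply_right, h])
    have h' := mul_mem (conj_mem_siegelGroup (inv_mem hprod) planeSwap_mem) this
    convert h' using 1
    group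
  · left
    have := mem_siegelGroup_of_apply_three hnO hng h
    exact (Subgroup.mul_mem_cancel_left _ hprod).mp this

open Subgroup in
/-- The derived subgroup of the orthogonal group consists of products of Siegel transformations. -/
lemma map_commutator_le_siegelGroup [Finite F] :
    (commutator (orthogonalGroupOf F (QPlus F))).map (orthogonalGroupOf F (QPlus F)).subtype ≤
      siegelGroup F := by
  rw [map_le_iff_le_comap, commutator_def, commutator_le]
  rintro ⟨g, hg⟩ - ⟨h, hh⟩ -
  change g * h * g⁻¹ * h⁻¹ ∈ siegelGroup F
  set s := planeSwap F with hs
  have hsO : s ∈ orthogonalGroupOf F (QPlus F) := planeSwap_mem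
  by_cases h1 : g ∈ siegelGroup F
  · have := mul_mem h1 (conj_mem_siegelGroup (inv_mem h1) hh)
    convert this using 1
    group
  by_cases h2 : h ∈ siegelGroup F
  · exact mul_mem (conj_mem_siegelGroup h2 hg) (inv_mem h2)
  have hsg := (mem_siegelGroup_or_planeSwap_mul_mem hg).resolve_left h1
  have hsh := (mem_siegelGroup_or_planeSwap_mul_mem hh).resolve_left h2
  rw [← hs] at hsg hsh
  have hs' := inv_mem hsO
  have key := mul_mem (mul_mem (conj_mem_siegelGroup hsg hs')
    (conj_mem_siegelGroup (mul_mem hsh (inv_mem hsg)) (mul_mem hs' hs')))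
    (conj_mem_siegelGroup (inv_mem hsh) hs')
  convert key using 1
  group

end Commutator

section Generators

variable {F : Type*} [Field F]

/-- The invertible matrix with a given right inverse. -/
def glOfRightInverse (M N : Matrix (Fin 8) (Fin 8) F) (h : ∀ v, M *ᵥ (N *ᵥ v) = v) :
    GL (Fin 8) F :=
  have hMN : M * N = 1 := Matrix.mulVec_injective
    (funext fun v => by rw [← mulVec_mulVec, h, one_mulVec])
  ⟨M, N, hMN, mul_eq_one_comm.mp hMN⟩

lemma xPlusEven_mulVec (a : F) (v : Fin 8 → F) :
    xPlusEven F a *ᵥ v = ![v 5, v 4 + (a + 1) ^ 2 * v 5 + (a + 1) ^ 2 * v 6 + a * v 7,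
      (a + 1) ^ 2 * v 5 + (a + 1) ^ 2 * v 6 + a * v 7, a * v 5 + a * v 6 + v 7,
      v 1 + v 2, v 0, v 0 + v 2 + a * v 3, a * v 2 + (a + 1) ^ 2 * v 3] := by
  ext i
  fin_cases i <;> simp [xPlusEven, mulVec, dotProduct, Fin.sum_univ_eight]

/-- The permutation of coordinates given by `yPlus`. -/
def yPerm : Equiv.Perm (Fin 8) where
  toFun := ![0, 7, 5, 2, 4, 3, 1, 6]
  invFun := ![0, 6, 3, 5, 4, 2, 7, 1]
  left_inv := by unfold Function.LeftInverse; decide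
  right_inv := by unfold Function.RightInverse Function.LeftInverse; decide

variable (F) in
/-- The matrix `yPlus` as an element of `GL₈(F)`. -/
def yGL : GL (Fin 8) F := permGL yPerm

lemma yGL_mulVec (v : Fin 8 → F) :
    (yGL F).1 *ᵥ v = ![v 0, v 7, v 5, v 2, v 4, v 3, v 1, v 6] := by
  rw [yGL, permGL_mulVec]
  ext i
  fin_cases i <;> rfl

lemma yGL_val : (yGL F).1 = yPlus F := by
  refine Matrix.mulVec_injective (funext fun v => ?_)
  rw [yGL_mulVec]
  ext i
  fin_cases i <;> simp [yPlus, mulVec, dotProduct, Fin.sum_univ_eight]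

lemma permGL_mul (π ρ : Equiv.Perm (Fin 8)) :
    (permGL π * permGL ρ : GL (Fin 8) F) = permGL (ρ * π) := 
  GL_ext_mulVec fun v => by
    rw [mulVec_mul_apply, permGL_mulVec, permGL_mulVec, permGL_mulVec]
    rfl

lemma permGL_one : (permGL 1 : GL (Fin 8) F) = 1 :=
  GL_ext_mulVec fun v => by
    rw [permGL_mulVec, Units.val_one, one_mulVec]
    rfl

lemma permGL_inv (π : Equiv.Perm (Fin 8)) : (permGL π : GL (Fin 8) F)⁻¹ = permGL π⁻¹ := by
  rw [inv_eq_iff_mul_eq_one, permGL_mul, inv_mul_cancel, permGL_one]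

lemma permGL_mem {π : Equiv.Perm (Fin 8)}
    (h : ∀ v : Fin 8 → F, QPlus F (v ∘ π) = QPlus F v) :
    permGL π ∈ orthogonalGroupOf F (QPlus F) := fun v => by
  rw [permGL_mulVec, h]

lemma orderOf_yGL : orderOf (yGL F) = 3 := by
  refine orderOf_eq_prime ?_ fun h => ?_
  · rw [pow_three, yGL, permGL_mul, permGL_mul, show yPerm * yPerm * yPerm = 1 by decide,
      permGL_one]
  · have := congrArg (fun g : GL (Fin 8) F => (g.1 *ᵥ (e 7)) 1) h
    simp only [yGL_mulVec, Units.val_one, one_mulVec] at this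
    simp at this

lemma yGL_mem : yGL F ∈ orthogonalGroupOf F (QPlus F) := by
  intro v
  rw [yGL_mulVec]
  simp [QPlus]
  ring

/-- The image in `GL₈(F)` of the derived subgroup of the orthogonal group. -/
abbrev derivedOrthogonal (F : Type*) [Field F] : Subgroup (GL (Fin 8) F) :=
  (commutator (orthogonalGroupOf F (QPlus F))).map (orthogonalGroupOf F (QPlus F)).subtype

lemma commutator_mem_derivedOrthogonal {g h : GL (Fin 8) F}
    (hg : g ∈ orthogonalGroupOf F (QPlus F)) (hh : h ∈ orthogonalGroupOf F (QPlus F)) :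
    g * h * g⁻¹ * h⁻¹ ∈ derivedOrthogonal F := by
  have key := Subgroup.commutator_mem_commutator
    (Subgroup.mem_top (⟨g, hg⟩ : orthogonalGroupOf F (QPlus F)))
    (Subgroup.mem_top (⟨h, hh⟩ : orthogonalGroupOf F (QPlus F)))
  rw [← commutator_def] at key
  have := Subgroup.mem_map_of_mem (orthogonalGroupOf F (QPlus F)).subtype key
  rwa [commutatorElement_def, map_mul, map_mul, map_mul, map_inv, map_inv] at this

lemma yGL_mem_derivedOrthogonal : yGL F ∈ derivedOrthogonal F := by
  set k : Equiv.Perm (Fin 8) := Equiv.swap 2 3 * Equiv.swap 6 7 with hk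
  have hkO : permGL k ∈ orthogonalGroupOf F (QPlus F) := permGL_mem fun v => by
    simp only [QPlus, Function.comp_apply, show k 0 = 0 by decide, show k 1 = 1 by decide,
      show k 2 = 3 by decide, show k 3 = 2 by decide, show k 4 = 4 by decide,
      show k 5 = 5 by decide, show k 6 = 7 by decide, show k 7 = 6 by decide]
    ring
  have h := commutator_mem_derivedOrthogonal hkO yGL_mem
  rw [yGL, permGL_inv, permGL_inv, permGL_mul, permGL_mul, permGL_mul,
    show yPerm⁻¹ * (k⁻¹ * (yPerm * k)) = yPerm by decide] at h
  exact h

variable [CharP F 2]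

/-- The matrix `xPlusEven a` as an element of `GL₈(F)`. -/
def xGL (a : F) : GL (Fin 8) F :=
  glOfRightInverse (xPlusEven F a) (xPlusEven F a) fun v => by
    have h2 : (2 : F) = 0 := CharTwo.two_eq_zero
    rw [xPlusEven_mulVec, xPlusEven_mulVec]
    ext i
    fin_cases i <;> simp <;> ring_nf <;> reduce_mod_char!

lemma xGL_mulVec (a : F) (v : Fin 8 → F) :
    (xGL a).1 *ᵥ v = ![v 5, v 4 + (a + 1) ^ 2 * v 5 + (a + 1) ^ 2 * v 6 + a * v 7,
      (a + 1) ^ 2 * v 5 + (a + 1) ^ 2 * v 6 + a * v 7, a * v 5 + a * v 6 + v 7,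
      v 1 + v 2, v 0, v 0 + v 2 + a * v 3, a * v 2 + (a + 1) ^ 2 * v 3] :=
  xPlusEven_mulVec a v

lemma xGL_inv (a : F) : (xGL a)⁻¹ = xGL a := Units.ext rfl

lemma orderOf_xGL (a : F) : orderOf (xGL a) = 2 := by
  refine orderOf_eq_prime ?_ fun h => ?_
  · rw [pow_two, mul_eq_one_iff_inv_eq, xGL_inv]
  · have := congrArg (fun g : GL (Fin 8) F => (g.1 *ᵥ (e 5)) 0) h
    simp only [xGL_mulVec, Units.val_one, one_mulVec] at this
    simp at this

lemma xGL_mem (a : F) : xGL a ∈ orthogonalGroupOf F (QPlus F) := by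
  intro v
  rw [xGL_mulVec]
  simp only [QPlus, cons_val]
  ring_nf
  reduce_mod_char!

/-- A block diagonal matrix conjugating a coordinate permutation to `xPlusEven a`. -/
def diagonalizer (a : F) : GL (Fin 8) F :=
  glOfRightInverse
  !![1, 1, 0, 0, 0, 0, 0, 0;
     1, 0, a + 1, 1, 0, 0, 0, 0;
     a, a, a, 1, 0, 0, 0, 0;
     1, 1, 1, 0, 0, 0, 0, 0;
     0, 0, 0, 0, a + 1, a, 1, 0;
     0, 0, 0, 0, 1, 1, 0, 0;
     0, 0, 0, 0, 1, 1, 0, 1;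
     0, 0, 0, 0, 1, 1, 1, a]
  !![a + 1, 1, 1, 1, 0, 0, 0, 0;
     a, 1, 1, 1, 0, 0, 0, 0;
     1, 0, 0, 1, 0, 0, 0, 0;
     0, 0, 1, a, 0, 0, 0, 0;
     0, 0, 0, 0, 1, 1, a, 1;
     0, 0, 0, 0, 1, 0, a, 1;
     0, 0, 0, 0, 0, a + 1, a, 1;
     0, 0, 0, 0, 0, 1, 1, 0] fun v => by
    ext i
    fin_cases i <;> simp [mulVec, dotProduct, Fin.sum_univ_eight] <;> ring_nf <;>
      reduce_mod_char!

lemma diagonalizer_mulVec (a : F) (v : Fin 8 → F) :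
    (diagonalizer a).1 *ᵥ v = ![v 0 + v 1, v 0 + (a + 1) * v 2 + v 3,
      a * v 0 + a * v 1 + a * v 2 + v 3, v 0 + v 1 + v 2,
      (a + 1) * v 4 + a * v 5 + v 6, v 4 + v 5, v 4 + v 5 + v 7,
      v 4 + v 5 + v 6 + a * v 7] := by
  ext i
  fin_cases i <;>
    simp [diagonalizer, glOfRightInverse, mulVec, dotProduct, Fin.sum_univ_eight]

lemma diagonalizer_mem (a : F) : diagonalizer a ∈ orthogonalGroupOf F (QPlus F) := by
  intro v
  rw [diagonalizer_mulVec]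
  simp only [QPlus, cons_val]
  ring_nf
  reduce_mod_char!

lemma xGL_mem_derivedOrthogonal (a : F) : xGL a ∈ derivedOrthogonal F := by
  set s : Equiv.Perm (Fin 8) := Equiv.swap 0 4 * Equiv.swap 2 6 with hs
  set t : Equiv.Perm (Fin 8) :=
    Equiv.swap 0 1 * Equiv.swap 4 5 * (Equiv.swap 2 3 * Equiv.swap 6 7) with ht
  have hsO : permGL s ∈ orthogonalGroupOf F (QPlus F) := permGL_mem fun v => by
    simp only [QPlus, Function.comp_apply, show s 0 = 4 by decide, show s 1 = 1 by decide,
      show s 2 = 6 by decide, show s 3 = 3 by decide, show s 4 = 0 by decide,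
      show s 5 = 5 by decide, show s 6 = 2 by decide, show s 7 = 7 by decide]
    ring
  have htO : permGL t ∈ orthogonalGroupOf F (QPlus F) := permGL_mem fun v => by
    simp only [QPlus, Function.comp_apply, show t 0 = 1 by decide, show t 1 = 0 by decide,
      show t 2 = 3 by decide, show t 3 = 2 by decide, show t 4 = 5 by decide,
      show t 5 = 4 by decide, show t 6 = 7 by decide, show t 7 = 6 by decide]
    ring
  set g := diagonalizer a with hg
  have hgO : g ∈ orthogonalGroupOf F (QPlus F) := diagonalizer_mem a
  have key : xGL a * g = g * (permGL s * permGL t * (permGL s)⁻¹ * (permGL t)⁻¹) := by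
    rw [permGL_inv, permGL_inv, permGL_mul, permGL_mul, permGL_mul]
    refine GL_ext_mulVec fun v => ?_
    rw [mulVec_mul_apply, mulVec_mul_apply, permGL_mulVec, hg, diagonalizer_mulVec,
      diagonalizer_mulVec, xGL_mulVec]
    set j := t⁻¹ * (s⁻¹ * (t * s)) with hj
    simp only [Function.comp_apply, show j 0 = 4 by decide, show j 1 = 5 by decide,
      show j 2 = 6 by decide, show j 3 = 7 by decide, show j 4 = 0 by decide,
      show j 5 = 1 by decide, show j 6 = 2 by decide, show j 7 = 3 by decide]
    ext i
    fin_cases i <;> simp <;> ring_nf <;> reduce_mod_char!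
  have h := commutator_mem_derivedOrthogonal
    (mul_mem (mul_mem hgO hsO) (inv_mem hgO)) (mul_mem (mul_mem hgO htO) (inv_mem hgO))
  convert h using 1
  rw [eq_mul_inv_of_mul_eq key]
  group

end Generators

section Reflection

/-- Carry-less multiplication with explicit fuel. -/
def clmulAux : ℕ → ℕ → ℕ → ℕ
  | 0, _, _ => 0
  | k + 1, m, n => (n % 2 * m) ^^^ clmulAux k (2 * m) (n / 2)

/-- Carry-less multiplication: the product of polynomials over `𝔽₂` encoded as bit strings. -/
def clmul (m n : ℕ) : ℕ := clmulAux (n.log2 + 1) m n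

/-- Subtract a multiple of the polynomial `m` from `n`, clearing the bits `d, …, d + k - 1`. -/
def clmodAux (m d : ℕ) : ℕ → ℕ → ℕ
  | 0, n => n
  | k + 1, n => clmodAux m d k (n ^^^ (n / 2 ^ (d + k) % 2 * (2 ^ k * m)))

/-- The remainder of the polynomial `n` modulo the polynomial `m`, where `m = 0` is allowed. -/
def clmod (m n : ℕ) : ℕ := clmodAux m m.log2 (n.log2 + 1 - m.log2) n

/-- Congruence of polynomials. -/
def eqMod (m x y : ℕ) : Bool := clmod m (x ^^^ y) == 0

/-- Rows of eight polynomials. -/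
structure PolyRow where
  x0 : ℕ
  x1 : ℕ
  x2 : ℕ
  x3 : ℕ
  x4 : ℕ
  x5 : ℕ
  x6 : ℕ
  x7 : ℕ

/-- Matrices with eight rows of polynomials. -/
structure PolyMat where
  r0 : PolyRow
  r1 : PolyRow
  r2 : PolyRow
  r3 : PolyRow
  r4 : PolyRow
  r5 : PolyRow
  r6 : PolyRow
  r7 : PolyRow

namespace PolyRow

/-- Addition of rows. -/
def add (u v : PolyRow) : PolyRow :=
  ⟨u.x0 ^^^ v.x0, u.x1 ^^^ v.x1, u.x2 ^^^ v.x2, u.x3 ^^^ v.x3,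
    u.x4 ^^^ v.x4, u.x5 ^^^ v.x5, u.x6 ^^^ v.x6, u.x7 ^^^ v.x7⟩

/-- Scalar multiplication of rows. -/
def smul (c : ℕ) (u : PolyRow) : PolyRow :=
  ⟨clmul c u.x0, clmul c u.x1, clmul c u.x2, clmul c u.x3,
    clmul c u.x4, clmul c u.x5, clmul c u.x6, clmul c u.x7⟩

/-- Congruence of rows. -/
def eqv (m : ℕ) (u v : PolyRow) : Bool :=
  eqMod m u.x0 v.x0 && eqMod m u.x1 v.x1 && eqMod m u.x2 v.x2 && eqMod m u.x3 v.x3 &&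
    eqMod m u.x4 v.x4 && eqMod m u.x5 v.x5 && eqMod m u.x6 v.x6 && eqMod m u.x7 v.x7

/-- The product of a row with a matrix. -/
def mulMat (u : PolyRow) (B : PolyMat) : PolyRow :=
  add (add (add (smul u.x0 B.r0) (smul u.x1 B.r1)) (add (smul u.x2 B.r2) (smul u.x3 B.r3)))
    (add (add (smul u.x4 B.r4) (smul u.x5 B.r5)) (add (smul u.x6 B.r6) (smul u.x7 B.r7)))

/-- The scalar product of two rows. -/
def dot (u v : PolyRow) : ℕ :=
  clmul u.x0 v.x0 ^^^ clmul u.x1 v.x1 ^^^ clmul u.x2 v.x2 ^^^ clmul u.x3 v.x3 ^^^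
    clmul u.x4 v.x4 ^^^ clmul u.x5 v.x5 ^^^ clmul u.x6 v.x6 ^^^ clmul u.x7 v.x7

end PolyRow

namespace PolyMat

/-- Addition of matrices. -/
def add (A B : PolyMat) : PolyMat :=
  ⟨A.r0.add B.r0, A.r1.add B.r1, A.r2.add B.r2, A.r3.add B.r3,
    A.r4.add B.r4, A.r5.add B.r5, A.r6.add B.r6, A.r7.add B.r7⟩

/-- Scalar multiplication of matrices. -/
def smul (c : ℕ) (A : PolyMat) : PolyMat :=
  ⟨A.r0.smul c, A.r1.smul c, A.r2.smul c, A.r3.smul c,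
    A.r4.smul c, A.r5.smul c, A.r6.smul c, A.r7.smul c⟩

/-- Congruence of matrices. -/
def eqv (m : ℕ) (A B : PolyMat) : Bool :=
  A.r0.eqv m B.r0 && A.r1.eqv m B.r1 && A.r2.eqv m B.r2 && A.r3.eqv m B.r3 &&
    A.r4.eqv m B.r4 && A.r5.eqv m B.r5 && A.r6.eqv m B.r6 && A.r7.eqv m B.r7

/-- Multiplication of matrices. -/
def mul (A B : PolyMat) : PolyMat :=
  ⟨A.r0.mulMat B, A.r1.mulMat B, A.r2.mulMat B, A.r3.mulMat B,
    A.r4.mulMat B, A.r5.mulMat B, A.r6.mulMat B, A.r7.mulMat B⟩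

/-- The product of a matrix with a column vector. -/
def mulVec (A : PolyMat) (u : PolyRow) : PolyRow :=
  ⟨A.r0.dot u, A.r1.dot u, A.r2.dot u, A.r3.dot u,
    A.r4.dot u, A.r5.dot u, A.r6.dot u, A.r7.dot u⟩

/-- The scalar matrix. -/
def scalar (c : ℕ) : PolyMat :=
  ⟨⟨c, 0, 0, 0, 0, 0, 0, 0⟩, ⟨0, c, 0, 0, 0, 0, 0, 0⟩, ⟨0, 0, c, 0, 0, 0, 0, 0⟩,
    ⟨0, 0, 0, c, 0, 0, 0, 0⟩, ⟨0, 0, 0, 0, c, 0, 0, 0⟩, ⟨0, 0, 0, 0, 0, c, 0, 0⟩,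
    ⟨0, 0, 0, 0, 0, 0, c, 0⟩, ⟨0, 0, 0, 0, 0, 0, 0, c⟩⟩

end PolyMat

variable {F : Type*} [Field F]

/-- The value at `a` of the polynomial over `𝔽₂` encoded by a bit string. -/
def ev (a : F) (n : ℕ) : F :=
  if n = 0 then 0 else (n % 2 : ℕ) + a * ev a (n / 2)
decreasing_by omega

lemma ev_zero (a : F) : ev a 0 = 0 := by rw [ev, if_pos rfl]

lemma ev_eq (a : F) (n : ℕ) : ev a n = (n % 2 : ℕ) + a * ev a (n / 2) := by
  by_cases h : n = 0
  · subst h; simp [ev_zero]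
  · rw [ev, if_neg h]

lemma ev_one (a : F) : ev a 1 = 1 := by
  rw [ev_eq]; simp [ev_zero]

lemma ev_two_mul (a : F) (n : ℕ) : ev a (2 * n) = a * ev a n := by
  rw [ev_eq]; simp

lemma ev_two_pow_mul (a : F) (k n : ℕ) : ev a (2 ^ k * n) = a ^ k * ev a n := by
  induction k with
  | zero => simp
  | succ k ih => rw [pow_succ', mul_assoc, ev_two_mul, ih, pow_succ', mul_assoc]

lemma ev_mod_two_mul (a : F) (n m : ℕ) : ev a (n % 2 * m) = (n % 2 : ℕ) * ev a m := by
  rcases Nat.mod_two_eq_zero_or_one n with h | h <;> simp [h, ev_zero]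

variable [CharP F 2]

lemma ev_xor (a : F) (m n : ℕ) : ev a (m ^^^ n) = ev a m + ev a n := by
  induction m using Nat.strong_induction_on generalizing n with
  | _ m ih =>
    by_cases hm : m = 0
    · subst hm; simp [ev_zero]
    have h2 : ((m ^^^ n) % 2 : ℕ) = ((m % 2 : ℕ) + (n % 2 : ℕ) : F) := by
      rw [Nat.xor_mod_two_eq]
      rw [show ((m + n) % 2) = (m % 2 + n % 2) % 2 by omega]
      have : (2 : F) = 0 := CharTwo.two_eq_zero
      rcases Nat.mod_two_eq_zero_or_one m with h | h <;>
        rcases Nat.mod_two_eq_zero_or_one n with h' | h' <;> simp [h, h', CharTwo.add_self_eq_zero]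
    rw [ev_eq a (m ^^^ n), ev_eq a m, ev_eq a n, Nat.xor_div_two, ih _ (by omega), h2]
    ring

lemma ev_clmulAux (a : F) (k m n : ℕ) (h : n < 2 ^ k) :
    ev a (clmulAux k m n) = ev a m * ev a n := by
  induction k generalizing m n with
  | zero =>
    obtain rfl : n = 0 := by simpa using h
    simp [clmulAux, ev_zero]
  | succ k ih =>
    rw [clmulAux, ev_xor, ih _ _ (by rw [pow_succ] at h; omega), ev_two_mul, ev_mod_two_mul,
      ev_eq a n]
    ring

lemma ev_clmul (a : F) (m n : ℕ) : ev a (clmul m n) = ev a m * ev a n :=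
  ev_clmulAux a _ m n Nat.lt_log2_self

lemma ev_clmodAux {a : F} {m : ℕ} (hm : ev a m = 0) (d k n : ℕ) :
    ev a (clmodAux m d k n) = ev a n := by
  induction k generalizing n with
  | zero => rfl
  | succ k ih =>
    rw [clmodAux, ih, ev_xor, ev_mod_two_mul, ev_two_pow_mul, hm]
    ring

lemma ev_eq_of_eqMod {a : F} {m : ℕ} (hm : ev a m = 0) {x y : ℕ} (h : eqMod m x y) :
    ev a x = ev a y := by
  have := ev_clmodAux hm m.log2 ((x ^^^ y).log2 + 1 - m.log2) (x ^^^ y)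
  rw [← clmod, show clmod m (x ^^^ y) = 0 by simpa [eqMod] using h, ev_zero, ev_xor] at this
  exact CharTwo.add_eq_zero.mp this.symm

/-- The vector of values of a row. -/
def PolyRow.eval (u : PolyRow) (a : F) : Fin 8 → F :=
  ![ev a u.x0, ev a u.x1, ev a u.x2, ev a u.x3, ev a u.x4, ev a u.x5, ev a u.x6, ev a u.x7]

/-- The matrix of values. -/
def PolyMat.eval (A : PolyMat) (a : F) : Matrix (Fin 8) (Fin 8) F :=
  of ![A.r0.eval a, A.r1.eval a, A.r2.eval a, A.r3.eval a,
    A.r4.eval a, A.r5.eval a, A.r6.eval a, A.r7.eval a]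

lemma PolyRow.eval_add (u v : PolyRow) (a : F) : (u.add v).eval a = u.eval a + v.eval a := by
  simp [PolyRow.eval, PolyRow.add, ev_xor]

lemma PolyRow.eval_smul (c : ℕ) (u : PolyRow) (a : F) : (u.smul c).eval a = ev a c • u.eval a := by
  simp [PolyRow.eval, PolyRow.smul, ev_clmul]

lemma PolyRow.eval_eq_of_eqv {a : F} {m : ℕ} (hm : ev a m = 0) {u v : PolyRow} (h : u.eqv m v) :
    u.eval a = v.eval a := by
  simp only [PolyRow.eqv, Bool.and_eq_true] at h
  obtain ⟨⟨⟨⟨⟨⟨⟨h0, h1⟩, h2⟩, h3⟩, h4⟩, h5⟩, h6⟩, h7⟩ := h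
  simp only [PolyRow.eval, ev_eq_of_eqMod hm h0, ev_eq_of_eqMod hm h1, ev_eq_of_eqMod hm h2,
    ev_eq_of_eqMod hm h3, ev_eq_of_eqMod hm h4, ev_eq_of_eqMod hm h5, ev_eq_of_eqMod hm h6,
    ev_eq_of_eqMod hm h7]

lemma PolyRow.eval_mulMat (u : PolyRow) (B : PolyMat) (a : F) :
    (u.mulMat B).eval a = u.eval a ᵥ* B.eval a := by
  rw [vecMul_eq_sum, Fin.sum_univ_eight]
  change _ = ev a u.x0 • B.r0.eval a + ev a u.x1 • B.r1.eval a + ev a u.x2 • B.r2.eval a +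
    ev a u.x3 • B.r3.eval a + ev a u.x4 • B.r4.eval a + ev a u.x5 • B.r5.eval a +
    ev a u.x6 • B.r6.eval a + ev a u.x7 • B.r7.eval a
  simp only [PolyRow.mulMat, PolyRow.eval_add, PolyRow.eval_smul, add_assoc]

lemma PolyRow.ev_dot (u v : PolyRow) (a : F) : ev a (u.dot v) = u.eval a ⬝ᵥ v.eval a := by
  simp [PolyRow.dot, ev_xor, ev_clmul, dotProduct, Fin.sum_univ_eight, PolyRow.eval]

lemma PolyMat.eval_add (A B : PolyMat) (a : F) : (A.add B).eval a = A.eval a + B.eval a := by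
  simp [PolyMat.eval, PolyMat.add, PolyRow.eval_add]

lemma PolyMat.eval_smul (c : ℕ) (A : PolyMat) (a : F) :
    (A.smul c).eval a = ev a c • A.eval a := by
  simp [PolyMat.eval, PolyMat.smul, PolyRow.eval_smul]

lemma PolyMat.eval_eq_of_eqv {a : F} {m : ℕ} (hm : ev a m = 0) {A B : PolyMat} (h : A.eqv m B) :
    A.eval a = B.eval a := by
  simp only [PolyMat.eqv, Bool.and_eq_true] at h
  obtain ⟨⟨⟨⟨⟨⟨⟨h0, h1⟩, h2⟩, h3⟩, h4⟩, h5⟩, h6⟩, h7⟩ := h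
  simp only [PolyMat.eval, PolyRow.eval_eq_of_eqv hm h0, PolyRow.eval_eq_of_eqv hm h1,
    PolyRow.eval_eq_of_eqv hm h2, PolyRow.eval_eq_of_eqv hm h3, PolyRow.eval_eq_of_eqv hm h4,
    PolyRow.eval_eq_of_eqv hm h5, PolyRow.eval_eq_of_eqv hm h6, PolyRow.eval_eq_of_eqv hm h7]

lemma PolyMat.eval_mul (A B : PolyMat) (a : F) : (A.mul B).eval a = A.eval a * B.eval a := by
  funext i
  rw [mul_apply_eq_vecMul]
  fin_cases i <;> exact PolyRow.eval_mulMat _ B a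

lemma PolyMat.eval_mulVec (A : PolyMat) (u : PolyRow) (a : F) :
    (A.mulVec u).eval a = A.eval a *ᵥ u.eval a := by
  ext i
  fin_cases i <;> exact PolyRow.ev_dot _ u a

lemma PolyMat.eval_scalar (c : ℕ) (a : F) : (scalar c).eval a = ev a c • 1 := by
  ext i j
  fin_cases i <;> fin_cases j <;> simp [PolyMat.eval, PolyMat.scalar, PolyRow.eval, ev_zero]

end Reflection

section Certificates

/-- Matrices of rational functions with a common denominator. -/
structure RatMat where
  den : ℕ
  num : PolyMat

/-- A certificate for `A * B = C`, where `e` is the factor cancelled on both sides. -/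
def RatMat.mulCheck (m : ℕ) (A B C : RatMat) (e : ℕ) : Bool :=
  eqMod m (clmul A.den B.den) (clmul e C.den) && (C.num.smul e).eqv m (A.num.mul B.num)

/-- A certificate that `R` is obtained from `N` by the Horner scheme at `D`. -/
def hornerCheck (m : ℕ) (D N : PolyMat) : List (ℕ × PolyMat) → PolyMat → Bool
  | [], R => N.eqv m R
  | (c, N') :: l, R => N'.eqv m ((PolyMat.scalar c).add (D.mul N)) && hornerCheck m D N' l R

variable {F : Type*} [Field F]

/-- The value at `a` of a matrix of rational functions. -/
def RatMat.val (A : RatMat) (a : F) : Matrix (Fin 8) (Fin 8) F :=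
  (ev a A.den)⁻¹ • A.num.eval a

variable [CharP F 2]

lemma RatMat.val_mul {a : F} {m : ℕ} (hm : ev a m = 0) {A B C : RatMat} {e : ℕ}
    (hA : ev a A.den ≠ 0) (hB : ev a B.den ≠ 0) (h : A.mulCheck m B C e) :
    A.val a * B.val a = C.val a := by
  simp only [RatMat.mulCheck, Bool.and_eq_true] at h
  have h1 := ev_eq_of_eqMod hm h.1
  have h2 := PolyMat.eval_eq_of_eqv hm h.2
  rw [ev_clmul, ev_clmul] at h1
  rw [PolyMat.eval_smul, PolyMat.eval_mul] at h2
  have he : ev a e ≠ 0 := by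
    intro h0
    rw [h0, zero_mul] at h1
    exact mul_ne_zero hA hB h1
  rw [RatMat.val, RatMat.val, RatMat.val, smul_mul_smul_comm, ← h2, smul_smul, ← mul_inv, h1,
    mul_inv, mul_right_comm, inv_mul_cancel₀ he, one_mul]

lemma eval_mem_adjoin_of_hornerCheck {a : F} {m : ℕ} (hm : ev a m = 0) {D N R : PolyMat}
    {l : List (ℕ × PolyMat)} (h : hornerCheck m D N l R) {S : Subalgebra F (Matrix (Fin 8) (Fin 8) F)}
    (hD : D.eval a ∈ S) (hN : N.eval a ∈ S) : R.eval a ∈ S := by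
  induction l generalizing N with
  | nil => rwa [← PolyMat.eval_eq_of_eqv hm h]
  | cons c l ih =>
    simp only [hornerCheck, Bool.and_eq_true] at h
    refine ih h.2 ?_
    rw [PolyMat.eval_eq_of_eqv hm h.1, PolyMat.eval_add, PolyMat.eval_mul, PolyMat.eval_scalar]
    exact S.add_mem (S.smul_mem S.one_mem _) (S.mul_mem hD hN)

lemma eval_mem_adjoin {a : F} {m : ℕ} (hm : ev a m = 0) {D R : PolyMat} {c : ℕ}
    {l : List (ℕ × PolyMat)} (h : hornerCheck m D (.scalar c) l R)
    {S : Subalgebra F (Matrix (Fin 8) (Fin 8) F)} (hD : D.eval a ∈ S) : R.eval a ∈ S :=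
  eval_mem_adjoin_of_hornerCheck hm h hD
    (by rw [PolyMat.eval_scalar]; exact S.smul_mem S.one_mem _)

lemma ev_ne_zero_of_factors {a : F} {l : List ℕ} (hl : ∀ m ∈ l, ev a m ≠ 0) {c : ℕ}
    (hc : l.foldr clmul 1 = c) : ev a c ≠ 0 := by
  subst hc
  induction l with
  | nil => simp [ev_one]
  | cons m l ih =>
    rw [List.foldr_cons, ev_clmul]
    exact mul_ne_zero (hl m (by simp)) (ih fun n hn => hl n (by simp [hn]))

end Certificates

section SquareRoot

variable {F : Type*} [Field F] [CharP F 2] [Finite F]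

open Polynomial in
/-- If `R² = d` and `R` is a polynomial in `d`, then `R` is a power of `d`. -/
lemma exists_pow_eq_of_mul_self {d R : Matrix (Fin 8) (Fin 8) F} (hR : R * R = d)
    (hA : R ∈ Algebra.adjoin F {d}) : ∃ k : ℕ, R = d ^ k := by
  have hsurj : Function.Surjective (fun x : Algebra.adjoin F {d} => x ^ 2) := by
    rintro ⟨x, hx⟩
    rw [Algebra.adjoin_singleton_eq_range_aeval] at hx
    obtain ⟨f, hf⟩ := hx
    set g : F[X] := f.map (frobeniusEquiv F 2).symm.toRingHom with hg
    have hgf : g ^ 2 = expand F 2 f := by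
      rw [← map_frobenius_expand, hg, ← map_expand, Polynomial.map_map]
      convert Polynomial.map_id
      ext c
      exact frobenius_apply_frobeniusEquiv_symm F 2 c
    refine ⟨⟨aeval R g, ?_⟩, Subtype.ext ?_⟩
    · have hle : Algebra.adjoin F {R} ≤ Algebra.adjoin F {d} :=
        Algebra.adjoin_le (by simpa using hA)
      exact hle (aeval_mem_adjoin_singleton F R)
    · change (aeval R g) ^ 2 = x
      rw [← map_pow, hgf, expand_aeval, pow_two, hR]
      exact hf
  have hinj := Finite.injective_iff_surjective.mpr hsurj
  obtain ⟨n, hn, hper⟩ := hinj.mem_periodicPts ⟨R, hA⟩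
  have hiter : ∀ n : ℕ, ∀ x : Algebra.adjoin F {d},
      (fun x : Algebra.adjoin F {d} => x ^ 2)^[n] x = x ^ 2 ^ n := by
    intro n x
    rw [pow_iterate]
  have h : R ^ 2 ^ n = R := by
    have := hper.eq
    rw [hiter] at this
    exact congrArg Subtype.val this
  obtain ⟨k, rfl⟩ := Nat.exists_eq_succ_of_ne_zero hn.ne'
  refine ⟨2 ^ k, ?_⟩
  rw [← hR, ← pow_two, ← pow_mul, ← pow_succ']
  exact h.symm

lemma exists_mem_of_mul_self {H : Subgroup (GL (Fin 8) F)} {d : GL (Fin 8) F} (hd : d ∈ H)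
    {R : Matrix (Fin 8) (Fin 8) F} (hR : R * R = d.1) (hA : R ∈ Algebra.adjoin F {d.1}) :
    ∃ r ∈ H, r.1 = R := by
  obtain ⟨k, hk⟩ := exists_pow_eq_of_mul_self hR hA
  exact ⟨d ^ k, pow_mem hd k, by rw [hk, Units.val_pow_eq_pow_val]⟩

end SquareRoot

section Plane

variable {F : Type*} [Field F]

/-- `z` fixes `p` and acts modulo `p` on the plane spanned by `b₁`, `b₂` with matrix entries
`α`, `β`, `γ`, `δ`. -/
structure ActsOnPlane (p b₁ b₂ : Fin 8 → F) (z : GL (Fin 8) F) (α β γ δ : F) : Prop where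
  fix : z.1 *ᵥ p = p
  map₁ : ∃ κ : F, z.1 *ᵥ b₁ = α • b₁ + β • b₂ + κ • p
  map₂ : ∃ κ : F, z.1 *ᵥ b₂ = γ • b₁ + δ • b₂ + κ • p

variable {p b₁ b₂ : Fin 8 → F} {z w : GL (Fin 8) F} {α β γ δ α' β' γ' δ' : F}

lemma ActsOnPlane.apply (hz : ActsOnPlane p b₁ b₂ z α β γ δ) (x y κ : F) :
    ∃ κ' : F, z.1 *ᵥ (x • b₁ + y • b₂ + κ • p) =
      (x * α + y * γ) • b₁ + (x * β + y * δ) • b₂ + κ' • p := by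
  obtain ⟨κ₁, h₁⟩ := hz.map₁
  obtain ⟨κ₂, h₂⟩ := hz.map₂
  refine ⟨x * κ₁ + y * κ₂ + κ, ?_⟩
  rw [mulVec_add, mulVec_add, mulVec_smul, mulVec_smul, mulVec_smul, hz.fix, h₁, h₂]
  module

variable [CharP F 2]

lemma ActsOnPlane.inv (hz : ActsOnPlane p b₁ b₂ z α β γ δ) (hdet : α * δ + β * γ = 1) :
    ActsOnPlane p b₁ b₂ z⁻¹ δ β γ α := by
  have h2 : (2 : F) = 0 := CharTwo.two_eq_zero
  have hfix : (z⁻¹).1 *ᵥ p = p := by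
    conv_lhs => rw [← hz.fix]
    exact inv_mulVec_cancel z p
  refine ⟨hfix, ?_, ?_⟩
  · obtain ⟨κ, hκ⟩ := hz.apply δ β 0
    refine ⟨-κ, ?_⟩
    have := congrArg (fun v => (z⁻¹).1 *ᵥ v) hκ
    rw [show δ * α + β * γ = 1 by linear_combination hdet,
      show δ * β + β * δ = 0 by linear_combination δ * β * h2] at this
    simp only [inv_mulVec_cancel, mulVec_add, mulVec_smul, hfix] at this
    rw [zero_smul, zero_smul, one_smul, add_zero, add_zero] at this
    rw [this]
    module
  · obtain ⟨κ, hκ⟩ := hz.apply γ α 0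
    refine ⟨-κ, ?_⟩
    have := congrArg (fun v => (z⁻¹).1 *ᵥ v) hκ
    rw [show γ * α + α * γ = 0 by linear_combination γ * α * h2,
      show γ * β + α * δ = 1 by linear_combination hdet] at this
    simp only [inv_mulVec_cancel, mulVec_add, mulVec_smul, hfix] at this
    rw [zero_smul, zero_smul, one_smul, add_zero, zero_add] at this
    rw [this]
    module

variable {H : Subgroup (GL (Fin 8) F)}

lemma hasSiegel_plane_add (h₁ : polar p b₁ = 0) (h₂ : polar p b₂ = 0) {x y x' y' : F}
    (h : HasSiegel H p (x • b₁ + y • b₂)) (h' : HasSiegel H p (x' • b₁ + y' • b₂)) :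
    HasSiegel H p ((x + x') • b₁ + (y + y') • b₂) := by
  have hx : ∀ x y : F, polar p (x • b₁ + y • b₂) = 0 := fun x y => by
    rw [polar_add_right, polar_smul_right, polar_smul_right, h₁, h₂]; ring
  have := HasSiegel.add (hx x y) (hx x' y') h h'
  convert this using 1
  module

lemma hasSiegel_plane_of_eq (hp : QPlus F p = 0) (h₁ : polar p b₁ = 0) (h₂ : polar p b₂ = 0)
    {x y κ : F} (h : HasSiegel H p (x • b₁ + y • b₂ + κ • p)) :
    HasSiegel H p (x • b₁ + y • b₂) := by
  have hx : polar p (x • b₁ + y • b₂ + κ • p) = 0 := by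
    rw [polar_add_right, polar_add_right, polar_smul_right, polar_smul_right, polar_smul_right,
      h₁, h₂, polar_self]
    ring
  have := HasSiegel.add hx (by rw [polar_smul_right, polar_self, mul_zero]) h
    (hasSiegel_smul_self H hp κ)
  have hκ : κ • p + κ • p = 0 := by
    rw [← add_smul, CharTwo.add_self_eq_zero, zero_smul]
  rwa [add_assoc, hκ, add_zero] at this

lemma ActsOnPlane.hasSiegel (hz : ActsOnPlane p b₁ b₂ z α β γ δ) (hzH : z ∈ H)
    (hzO : z ∈ orthogonalGroupOf F (QPlus F))
    (hp : QPlus F p = 0) (h₁ : polar p b₁ = 0) (h₂ : polar p b₂ = 0)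
    {x y : F} (h : HasSiegel H p (x • b₁ + y • b₂)) :
    HasSiegel H p ((x * α + y * γ) • b₁ + (x * β + y * δ) • b₂) := by
  obtain ⟨κ, hκ⟩ := hz.apply x y 0
  rw [zero_smul, add_zero] at hκ
  have := h.conj hzH hzO
  rw [hz.fix, hκ] at this
  exact hasSiegel_plane_of_eq hp h₁ h₂ this

/-- The subfield of scalars stabilizing the set of vectors of a plane whose Siegel
transformations lie in `H`. -/
def planeField [Finite F] (H : Subgroup (GL (Fin 8) F)) (p b₁ b₂ : Fin 8 → F)
    (hp : QPlus F p = 0) (h₁ : polar p b₁ = 0) (h₂ : polar p b₂ = 0) : Subfield F where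
  carrier := {t | ∀ x y : F, HasSiegel H p (x • b₁ + y • b₂) →
    HasSiegel H p ((t * x) • b₁ + (t * y) • b₂)}
  mul_mem' := fun {s t} hs ht x y h => by
    rw [mul_assoc, mul_assoc]
    exact hs _ _ (ht _ _ h)
  one_mem' := fun x y h => by rwa [one_mul, one_mul]
  add_mem' := fun {s t} hs ht x y h => by
    rw [add_mul, add_mul]
    exact hasSiegel_plane_add h₁ h₂ (hs x y h) (ht x y h)
  zero_mem' := fun x y _ => by
    have := hasSiegel_smul_self H hp 0
    rw [zero_smul] at this
    rwa [zero_mul, zero_mul, zero_smul, zero_smul, add_zero]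
  neg_mem' := fun {t} ht => by rwa [CharTwo.neg_eq]
  inv_mem' := fun t ht x y h => by
    by_cases h0 : t = 0
    · subst h0
      rw [_root_.inv_zero]
      have := hasSiegel_smul_self H hp 0
      rw [zero_smul] at this
      rwa [zero_mul, zero_mul, zero_smul, zero_smul, add_zero]
    · have hpow : ∀ n : ℕ, HasSiegel H p ((t ^ n * x) • b₁ + (t ^ n * y) • b₂) := by
        intro n
        induction n with
        | zero => rwa [pow_zero, one_mul, one_mul]
        | succ n ih =>
          rw [pow_succ', mul_assoc, mul_assoc]
          exact ht _ _ ih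
      have hfin : IsOfFinOrder (Units.mk0 t h0) := isOfFinOrder_of_finite _
      obtain ⟨n, hn⟩ := (hfin.mem_powers_iff_mem_zpowers).mpr
        (inv_mem (Subgroup.mem_zpowers (Units.mk0 t h0)))
      have hn' : t ^ n = t⁻¹ := by simpa using congrArg Units.val hn
      rw [← hn']
      exact hpow n

/-- Traces of elements of determinant one acting on the plane lie in `planeField`. -/
lemma ActsOnPlane.trace_mem [Finite F] (hz : ActsOnPlane p b₁ b₂ z α β γ δ)
    (hdet : α * δ + β * γ = 1) (hzH : z ∈ H) (hzO : z ∈ orthogonalGroupOf F (QPlus F))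
    (hp : QPlus F p = 0) (h₁ : polar p b₁ = 0) (h₂ : polar p b₂ = 0) :
    α + δ ∈ planeField H p b₁ b₂ hp h₁ h₂ := by
  intro x y h
  have h2 : (2 : F) = 0 := CharTwo.two_eq_zero
  have k := hasSiegel_plane_add h₁ h₂ (hz.hasSiegel hzH hzO hp h₁ h₂ h)
    ((hz.inv hdet).hasSiegel (inv_mem hzH) (inv_mem hzO) hp h₁ h₂ h)
  convert k using 3
  · linear_combination (-y * γ) * h2
  · linear_combination (-x * β) * h2

/-- If the traces generate the field, all Siegel transformations attached to the plane lie
in `H`. -/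
lemma hasSiegel_plane [Finite F] (hp : QPlus F p = 0) (h₁ : polar p b₁ = 0) (h₂ : polar p b₂ = 0)
    (htop : planeField H p b₁ b₂ hp h₁ h₂ = ⊤) {x y x' y' : F} (hne : x * y' + x' * y ≠ 0)
    (h : HasSiegel H p (x • b₁ + y • b₂)) (h' : HasSiegel H p (x' • b₁ + y' • b₂)) (s t : F) :
    HasSiegel H p (s • b₁ + t • b₂) := by
  have h2 : (2 : F) = 0 := CharTwo.two_eq_zero
  have hall : ∀ c x y : F, HasSiegel H p (x • b₁ + y • b₂) →
      HasSiegel H p ((c * x) • b₁ + (c * y) • b₂) := fun c => by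
    have : c ∈ planeField H p b₁ b₂ hp h₁ h₂ := htop ▸ Subfield.mem_top c
    exact this
  have k := hasSiegel_plane_add h₁ h₂
    (hall ((s * y' + t * x') / (x * y' + x' * y)) _ _ h)
    (hall ((s * y + t * x) / (x * y' + x' * y)) _ _ h')
  convert k using 3
  · rw [div_mul_eq_mul_div, div_mul_eq_mul_div, ← add_div, eq_div_iff hne]
    linear_combination (-x * t * x') * h2
  · rw [div_mul_eq_mul_div, div_mul_eq_mul_div, ← add_div, eq_div_iff hne]
    linear_combination (-y * s * y') * h2

end Plane

section Membership

variable {F : Type*} [Field F]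

/-- The value at `a` of the matrix `A` of rational functions is defined and lies in `H`. -/
def RatMat.MemAt (A : RatMat) (a : F) (H : Subgroup (GL (Fin 8) F)) : Prop :=
  ev a A.den ≠ 0 ∧ ∃ g ∈ H, g.1 = A.val a

variable [CharP F 2] {H : Subgroup (GL (Fin 8) F)} {a : F} {m : ℕ} {A B C : RatMat} {e : ℕ}

lemma RatMat.MemAt.mul (hA : A.MemAt a H) (hB : B.MemAt a H) (hm : ev a m = 0)
    (h : A.mulCheck m B C e) : C.MemAt a H := by
  obtain ⟨hA0, g, hg, hgA⟩ := hA
  obtain ⟨hB0, k, hk, hkB⟩ := hB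
  refine ⟨fun h0 => ?_, g * k, mul_mem hg hk, ?_⟩
  · simp only [RatMat.mulCheck, Bool.and_eq_true] at h
    have := ev_eq_of_eqMod hm h.1
    rw [ev_clmul, ev_clmul, h0, mul_zero] at this
    exact mul_ne_zero hA0 hB0 this
  · rw [Units.val_mul, hgA, hkB, RatMat.val_mul hm hA0 hB0 h]

lemma RatMat.MemAt.of_mul_left (hA : A.MemAt a H) (hC : C.MemAt a H) (hB : ev a B.den ≠ 0)
    (hm : ev a m = 0) (h : A.mulCheck m B C e) : B.MemAt a H := by
  obtain ⟨hA0, g, hg, hgA⟩ := hA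
  obtain ⟨-, k, hk, hkC⟩ := hC
  refine ⟨hB, g⁻¹ * k, mul_mem (inv_mem hg) hk, ?_⟩
  rw [Units.val_mul, hkC, ← RatMat.val_mul hm hA0 hB h, ← hgA, ← Matrix.mul_assoc,
    ← Units.val_mul, inv_mul_cancel, Units.val_one, Matrix.one_mul]

lemma RatMat.MemAt.of_mul_right (hB : B.MemAt a H) (hC : C.MemAt a H) (hA : ev a A.den ≠ 0)
    (hm : ev a m = 0) (h : A.mulCheck m B C e) : A.MemAt a H := by
  obtain ⟨hB0, g, hg, hgB⟩ := hB
  obtain ⟨-, k, hk, hkC⟩ := hC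
  refine ⟨hA, k * g⁻¹, mul_mem hk (inv_mem hg), ?_⟩
  rw [Units.val_mul, hkC, ← RatMat.val_mul hm hA hB0 h, ← hgB, Matrix.mul_assoc,
    ← Units.val_mul, mul_inv_cancel, Units.val_one, Matrix.mul_one]

/-- Square roots which are polynomials in their squares. -/
lemma RatMat.MemAt.of_mul_self [Finite F] {D R : RatMat} (hD : D.MemAt a H)
    (hR : ev a R.den ≠ 0) (hm : ev a m = 0) (h : R.mulCheck m R D e) {k c : ℕ}
    {l : List (ℕ × PolyMat)} (hk : ev a k ≠ 0)
    (hl : hornerCheck m D.num (.scalar c) l (R.num.smul k)) : R.MemAt a H := by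
  obtain ⟨hD0, g, hg, hgD⟩ := hD
  refine ⟨hR, exists_mem_of_mul_self hg (by rw [RatMat.val_mul hm hR hR h, hgD]) ?_⟩
  have key : ∀ {c : F} (_ : c ≠ 0) {M : Matrix (Fin 8) (Fin 8) F}
      {S : Subalgebra F (Matrix (Fin 8) (Fin 8) F)}, c • M ∈ S → M ∈ S := by
    intro c hc M S hM
    have := S.smul_mem hM c⁻¹
    rwa [smul_smul, inv_mul_cancel₀ hc, one_smul] at this
  have hnum : D.num.eval a ∈ Algebra.adjoin F {g.1} := by
    refine key (inv_ne_zero hD0) ?_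
    rw [hgD]
    exact Algebra.subset_adjoin rfl
  have := eval_mem_adjoin hm hl hnum
  rw [PolyMat.eval_smul] at this
  exact Subalgebra.smul_mem _ (key hk this) _

end Membership

section SiegelCertificate

/-- The row of coefficients of the linear form `polar v`. -/
def PolyRow.swap (v : PolyRow) : PolyRow := ⟨v.x4, v.x5, v.x6, v.x7, v.x0, v.x1, v.x2, v.x3⟩

/-- The value of the quadratic form. -/
def PolyRow.quad (v : PolyRow) : ℕ :=
  clmul v.x0 v.x4 ^^^ clmul v.x1 v.x5 ^^^ clmul v.x2 v.x6 ^^^ clmul v.x3 v.x7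

/-- The matrix of rank one with column `u` and row `v`. -/
def PolyMat.outer (u v : PolyRow) : PolyMat :=
  ⟨v.smul u.x0, v.smul u.x1, v.smul u.x2, v.smul u.x3,
    v.smul u.x4, v.smul u.x5, v.smul u.x6, v.smul u.x7⟩

/-- The matrix of the Siegel transformation attached to `p` and `c⁻¹ • v`. -/
def RatMat.siegel (p v : PolyRow) (c : ℕ) : RatMat :=
  ⟨clmul c c, (PolyMat.scalar (clmul c c)).add (((PolyMat.outer p v.swap).add
    (PolyMat.outer v p.swap)).smul c |>.add ((PolyMat.outer p p.swap).smul v.quad))⟩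

variable {F : Type*} [Field F] [CharP F 2]

lemma PolyMat.eval_outer_mulVec (u v : PolyRow) (a : F) (w : Fin 8 → F) :
    (PolyMat.outer u v).eval a *ᵥ w = (v.eval a ⬝ᵥ w) • u.eval a := by
  ext i
  fin_cases i <;>
    simp [PolyMat.outer, PolyMat.eval, PolyRow.eval_smul, smul_dotProduct] <;>
    simp [PolyRow.eval, mul_comm]

lemma PolyRow.eval_swap_dotProduct (v : PolyRow) (a : F) (w : Fin 8 → F) :
    v.swap.eval a ⬝ᵥ w = polar (v.eval a) w := by
  simp [PolyRow.swap, PolyRow.eval, polar, dotProduct, Fin.sum_univ_eight]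
  ring

lemma PolyRow.QPlus_eval (v : PolyRow) (a : F) : QPlus F (v.eval a) = ev a v.quad := by
  simp [PolyRow.quad, PolyRow.eval, QPlus, ev_xor, ev_clmul]

lemma RatMat.siegel_val_mulVec {a : F} (p v : PolyRow) {c : ℕ} (hc : ev a c ≠ 0)
    (w : Fin 8 → F) : (RatMat.siegel p v c).val a *ᵥ w =
      siegelFun (p.eval a) ((ev a c)⁻¹ • v.eval a) w := by
  rw [RatMat.val, RatMat.siegel, siegelFun, QPlus_smul, polar_smul_left, PolyRow.QPlus_eval]
  simp only [PolyMat.eval_add, PolyMat.eval_smul, PolyMat.eval_scalar, ev_clmul, smul_mulVec,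
    add_mulVec, PolyMat.eval_outer_mulVec, PolyRow.eval_swap_dotProduct, one_mulVec]
  match_scalars <;> field_simp

lemma RatMat.memAt_siegel_iff {H : Subgroup (GL (Fin 8) F)} {a : F} {p v : PolyRow} {c : ℕ}
    (hc : ev a c ≠ 0) : (RatMat.siegel p v c).MemAt a H ↔
      HasSiegel H (p.eval a) ((ev a c)⁻¹ • v.eval a) := by
  constructor
  · rintro ⟨-, g, hg, hgE⟩
    exact ⟨g, hg, fun w => by rw [hgE, RatMat.siegel_val_mulVec p v hc]⟩
  · rintro ⟨g, hg, hS⟩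
    refine ⟨?_, g, hg, Matrix.mulVec_injective (funext fun w => ?_)⟩
    · rw [RatMat.siegel, ev_clmul]
      exact mul_ne_zero hc hc
    · rw [hS w, RatMat.siegel_val_mulVec p v hc]

/-- The coefficients of the action of a matrix on a plane. -/
structure PlaneAction where
  α : ℕ
  β : ℕ
  κ₁ : ℕ
  γ : ℕ
  δ : ℕ
  κ₂ : ℕ

/-- A certificate for `ActsOnPlane`. -/
def RatMat.planeCheck (m : ℕ) (A : RatMat) (p b₁ b₂ : PolyRow) (P : PlaneAction) : Bool :=
  (A.num.mulVec p).eqv m (p.smul A.den) &&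
  (A.num.mulVec b₁).eqv m (((b₁.smul P.α).add (b₂.smul P.β)).add (p.smul P.κ₁)) &&
  (A.num.mulVec b₂).eqv m (((b₁.smul P.γ).add (b₂.smul P.δ)).add (p.smul P.κ₂))

lemma actsOnPlane_of_planeCheck {a : F} {m : ℕ} (hm : ev a m = 0) {A : RatMat}
    (hA : ev a A.den ≠ 0) {p b₁ b₂ : PolyRow} {P : PlaneAction} (h : A.planeCheck m p b₁ b₂ P)
    {z : GL (Fin 8) F} (hz : z.1 = A.val a) :
    ActsOnPlane (p.eval a) (b₁.eval a) (b₂.eval a) z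
      (ev a P.α / ev a A.den) (ev a P.β / ev a A.den)
      (ev a P.γ / ev a A.den) (ev a P.δ / ev a A.den) := by
  simp only [RatMat.planeCheck, Bool.and_eq_true] at h
  obtain ⟨⟨h₀, h₁⟩, h₂⟩ := h
  replace h₀ := PolyRow.eval_eq_of_eqv hm h₀
  replace h₁ := PolyRow.eval_eq_of_eqv hm h₁
  replace h₂ := PolyRow.eval_eq_of_eqv hm h₂
  simp only [PolyMat.eval_mulVec, PolyRow.eval_smul, PolyRow.eval_add] at h₀ h₁ h₂
  refine ⟨?_, ⟨ev a P.κ₁ / ev a A.den, ?_⟩, ⟨ev a P.κ₂ / ev a A.den, ?_⟩⟩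
  · rw [hz, RatMat.val, smul_mulVec, h₀, smul_smul, inv_mul_cancel₀ hA, one_smul]
  · rw [hz, RatMat.val, smul_mulVec, h₁]
    module
  · rw [hz, RatMat.val, smul_mulVec, h₂]
    module

end SiegelCertificate

section PlaneCertificate

/-- A singular vector. -/
def pRow : PolyRow := ⟨0, 3, 3, 1, 0, 0, 1, 3⟩

/-- A vector orthogonal to `pRow`. -/
def bRow₁ : PolyRow := ⟨1, 0, 0, 0, 0, 1, 1, 0⟩

/-- A second vector orthogonal to `pRow`. -/
def bRow₂ : PolyRow := ⟨0, 1, 0, 0, 1, 0, 0, 0⟩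

variable {F : Type*} [Field F] [CharP F 2]

lemma PolyRow.polar_eval (u v : PolyRow) (a : F) :
    polar (u.eval a) (v.eval a) = ev a (u.swap.dot v) := by
  rw [PolyRow.ev_dot, PolyRow.eval_swap_dotProduct]

lemma QPlus_pRow (a : F) : QPlus F (pRow.eval a) = 0 := by
  rw [PolyRow.QPlus_eval, show pRow.quad = 0 by decide, ev_zero]

lemma polar_pRow_bRow₁ (a : F) : polar (pRow.eval a) (bRow₁.eval a) = 0 := by
  rw [PolyRow.polar_eval, show pRow.swap.dot bRow₁ = 0 by decide, ev_zero]

lemma polar_pRow_bRow₂ (a : F) : polar (pRow.eval a) (bRow₂.eval a) = 0 := by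
  rw [PolyRow.polar_eval, show pRow.swap.dot bRow₂ = 0 by decide, ev_zero]

variable [Finite F]

/-- The scalars stabilizing the plane spanned by `bRow₁` and `bRow₂`. -/
abbrev traceField (H : Subgroup (GL (Fin 8) F)) (a : F) : Subfield F :=
  planeField H (pRow.eval a) (bRow₁.eval a) (bRow₂.eval a) (QPlus_pRow a) (polar_pRow_bRow₁ a)
    (polar_pRow_bRow₂ a)

/-- A certificate that the action on the plane has determinant one and trace `t / c`. -/
def PlaneAction.traceCheck (m den : ℕ) (P : PlaneAction) (t c : ℕ) : Bool :=
  eqMod m (clmul P.α P.δ ^^^ clmul P.β P.γ) (clmul den den) &&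
    eqMod m (clmul (P.α ^^^ P.δ) c) (clmul t den)

variable {H : Subgroup (GL (Fin 8) F)} {a : F} {m : ℕ} {A : RatMat} {P : PlaneAction}

lemma RatMat.MemAt.trace_mem (hA : A.MemAt a H) (hH : H ≤ orthogonalGroupOf F (QPlus F))
    (hm : ev a m = 0) (h : A.planeCheck m pRow bRow₁ bRow₂ P) {t c : ℕ}
    (ht : P.traceCheck m A.den t c) (hc : ev a c ≠ 0) : ev a t / ev a c ∈ traceField H a := by
  obtain ⟨hA0, z, hz, hzA⟩ := hA
  simp only [PlaneAction.traceCheck, Bool.and_eq_true] at ht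
  obtain ⟨hd, ht⟩ := ht
  replace hd := ev_eq_of_eqMod hm hd
  replace ht := ev_eq_of_eqMod hm ht
  simp only [ev_xor, ev_clmul] at hd ht
  have := (actsOnPlane_of_planeCheck hm hA0 h hzA).trace_mem (by
    field_simp
    linear_combination hd) hz (hH hz) (QPlus_pRow a) (polar_pRow_bRow₁ a) (polar_pRow_bRow₂ a)
  convert this using 1
  field_simp
  linear_combination -ht

/-- If `H` contains the Siegel transformation of a vector of the plane and an element moving this
vector to another line of the plane, then it contains all Siegel transformations of the plane. -/
lemma RatMat.MemAt.hasSiegel_plane {x y c n : ℕ}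
    (hE : (RatMat.siegel pRow ((bRow₁.smul x).add (bRow₂.smul y)) c).MemAt a H)
    (hA : A.MemAt a H) (hH : H ≤ orthogonalGroupOf F (QPlus F))
    (hm : ev a m = 0) (h : A.planeCheck m pRow bRow₁ bRow₂ P)
    (hn : eqMod m (clmul x (clmul x P.β ^^^ clmul y P.δ) ^^^
      clmul (clmul x P.α ^^^ clmul y P.γ) y) n) (hn0 : ev a n ≠ 0)
    (haF : Subfield.closure {a} = ⊤) (haK : a ∈ traceField H a) (s t : F) :
    HasSiegel H (pRow.eval a) (s • bRow₁.eval a + t • bRow₂.eval a) := by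
  have htop : traceField H a = ⊤ := by
    rw [eq_top_iff, ← haF, Subfield.closure_le]
    simpa using haK
  obtain ⟨hA0, z, hz, hzA⟩ := hA
  have hc : ev a c ≠ 0 := by
    have := hE.1
    rw [RatMat.siegel, ev_clmul] at this
    exact left_ne_zero_of_mul this
  have hv := (RatMat.memAt_siegel_iff hc).mp hE
  rw [PolyRow.eval_add, PolyRow.eval_smul, PolyRow.eval_smul, smul_add, smul_smul, smul_smul] at hv
  have hv' := (actsOnPlane_of_planeCheck hm hA0 h hzA).hasSiegel hz (hH hz) (QPlus_pRow a)
    (polar_pRow_bRow₁ a) (polar_pRow_bRow₂ a) hv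
  refine OmegaEight.hasSiegel_plane _ _ _ htop ?_ hv hv' s t
  replace hn := ev_eq_of_eqMod hm hn
  simp only [ev_xor, ev_clmul] at hn
  have : ev a n / (ev a c ^ 2 * ev a A.den) ≠ 0 := by positivity
  convert this using 1
  rw [← hn]
  field_simp

end PlaneCertificate

section PlaneData

/-- The matrix `x`. -/
def matX : RatMat :=
  ⟨1,
    ⟨⟨0, 0, 0, 0, 0, 1, 0, 0⟩, ⟨0, 0, 0, 0, 1, 5, 5, 2⟩, ⟨0, 0, 0, 0, 0, 5, 5, 2⟩,
    ⟨0, 0, 0, 0, 0, 2, 2, 1⟩, ⟨0, 1, 1, 0, 0, 0, 0, 0⟩, ⟨1, 0, 0, 0, 0, 0, 0, 0⟩,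
    ⟨1, 0, 1, 2, 0, 0, 0, 0⟩, ⟨0, 0, 2, 5, 0, 0, 0, 0⟩⟩⟩

/-- The matrix `y`. -/
def matY : RatMat :=
  ⟨1,
    ⟨⟨1, 0, 0, 0, 0, 0, 0, 0⟩, ⟨0, 0, 0, 0, 0, 0, 0, 1⟩, ⟨0, 0, 0, 0, 0, 1, 0, 0⟩,
    ⟨0, 0, 1, 0, 0, 0, 0, 0⟩, ⟨0, 0, 0, 0, 1, 0, 0, 0⟩, ⟨0, 0, 0, 1, 0, 0, 0, 0⟩,
    ⟨0, 1, 0, 0, 0, 0, 0, 0⟩, ⟨0, 0, 0, 0, 0, 0, 1, 0⟩⟩⟩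

/-- The matrix `y⁻¹`. -/
def matYInv : RatMat :=
  ⟨1,
    ⟨⟨1, 0, 0, 0, 0, 0, 0, 0⟩, ⟨0, 0, 0, 0, 0, 0, 1, 0⟩, ⟨0, 0, 0, 1, 0, 0, 0, 0⟩,
    ⟨0, 0, 0, 0, 0, 1, 0, 0⟩, ⟨0, 0, 0, 0, 1, 0, 0, 0⟩, ⟨0, 0, 1, 0, 0, 0, 0, 0⟩,
    ⟨0, 0, 0, 0, 0, 0, 0, 1⟩, ⟨0, 1, 0, 0, 0, 0, 0, 0⟩⟩⟩

/-- The matrix `x y`. -/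
def matXY : RatMat :=
  ⟨1,
    ⟨⟨0, 0, 0, 1, 0, 0, 0, 0⟩, ⟨0, 5, 0, 5, 1, 0, 2, 0⟩, ⟨0, 5, 0, 5, 0, 0, 2, 0⟩,
    ⟨0, 2, 0, 2, 0, 0, 1, 0⟩, ⟨0, 0, 0, 0, 0, 1, 0, 1⟩, ⟨1, 0, 0, 0, 0, 0, 0, 0⟩,
    ⟨1, 0, 2, 0, 0, 1, 0, 0⟩, ⟨0, 0, 5, 0, 0, 2, 0, 0⟩⟩⟩

/-- The matrix `x y⁻¹`. -/
def matXYInv : RatMat :=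
  ⟨1,
    ⟨⟨0, 0, 1, 0, 0, 0, 0, 0⟩, ⟨0, 2, 5, 0, 1, 0, 0, 5⟩, ⟨0, 2, 5, 0, 0, 0, 0, 5⟩,
    ⟨0, 1, 2, 0, 0, 0, 0, 2⟩, ⟨0, 0, 0, 1, 0, 0, 1, 0⟩, ⟨1, 0, 0, 0, 0, 0, 0, 0⟩,
    ⟨1, 0, 0, 1, 0, 2, 0, 0⟩, ⟨0, 0, 0, 2, 0, 5, 0, 0⟩⟩⟩

/-- The matrix `(x y)²`. -/
def matXYSq : RatMat :=
  ⟨1,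
    ⟨⟨0, 2, 0, 2, 0, 0, 1, 0⟩, ⟨2, 27, 4, 27, 5, 3, 15, 1⟩, ⟨2, 27, 4, 27, 5, 2, 15, 0⟩,
    ⟨1, 14, 2, 14, 2, 1, 6, 0⟩, ⟨1, 0, 5, 0, 0, 2, 0, 0⟩, ⟨0, 0, 0, 1, 0, 0, 0, 0⟩,
    ⟨1, 10, 0, 11, 0, 0, 4, 0⟩, ⟨2, 17, 0, 17, 0, 0, 10, 0⟩⟩⟩

/-- The matrix `(x y⁻¹)²`. -/
def matXYInvSq : RatMat :=
  ⟨1,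
    ⟨⟨0, 2, 5, 0, 0, 0, 0, 5⟩, ⟨0, 14, 27, 11, 2, 17, 1, 27⟩, ⟨0, 14, 27, 10, 2, 17, 0, 27⟩,
    ⟨0, 6, 15, 4, 1, 10, 0, 15⟩, ⟨1, 1, 2, 1, 0, 2, 0, 2⟩, ⟨0, 0, 1, 0, 0, 0, 0, 0⟩,
    ⟨2, 1, 3, 0, 0, 0, 0, 2⟩, ⟨5, 2, 4, 0, 0, 0, 0, 4⟩⟩⟩

/-- The matrix `y x y`. -/
def matYXY : RatMat :=
  ⟨1,
    ⟨⟨0, 0, 0, 1, 0, 0, 0, 0⟩, ⟨0, 0, 5, 0, 0, 2, 0, 0⟩, ⟨1, 0, 0, 0, 0, 0, 0, 0⟩,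
    ⟨0, 5, 0, 5, 0, 0, 2, 0⟩, ⟨0, 0, 0, 0, 0, 1, 0, 1⟩, ⟨0, 2, 0, 2, 0, 0, 1, 0⟩,
    ⟨0, 5, 0, 5, 1, 0, 2, 0⟩, ⟨1, 0, 2, 0, 0, 1, 0, 0⟩⟩⟩

/-- The matrix `x y⁻¹ x y`. -/
def commY : RatMat :=
  ⟨1,
    ⟨⟨0, 5, 0, 5, 0, 0, 2, 0⟩, ⟨0, 27, 17, 27, 2, 11, 14, 1⟩, ⟨0, 27, 17, 27, 2, 10, 14, 0⟩,
    ⟨0, 15, 10, 15, 1, 4, 6, 0⟩, ⟨1, 2, 2, 2, 0, 1, 1, 0⟩, ⟨0, 0, 0, 1, 0, 0, 0, 0⟩,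
    ⟨2, 2, 0, 3, 0, 0, 1, 0⟩, ⟨5, 4, 0, 4, 0, 0, 2, 0⟩⟩⟩

/-- The matrix `x h⁻¹ x h` with `h = y x y`. -/
def commYXY : RatMat :=
  ⟨1,
    ⟨⟨4, 20, 28, 20, 27, 12, 15, 2⟩, ⟨20, 4, 72, 20, 87, 43, 19, 14⟩,
    ⟨20, 0, 74, 17, 85, 42, 17, 14⟩, ⟨9, 4, 41, 14, 37, 18, 9, 6⟩, ⟨3, 3, 14, 1, 13, 6, 2, 1⟩,
    ⟨2, 27, 4, 27, 5, 2, 15, 0⟩, ⟨0, 16, 8, 16, 10, 5, 8, 1⟩, ⟨4, 20, 24, 20, 30, 14, 15, 2⟩⟩⟩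

/-- The square root of `commY`. -/
def rootY : RatMat :=
  ⟨34,
    ⟨⟨75, 167, 143, 189, 14, 9, 72, 89⟩, ⟨68, 441, 284, 396, 24, 156, 228, 57⟩,
    ⟨94, 498, 363, 453, 2, 169, 211, 47⟩, ⟨49, 237, 184, 251, 21, 83, 112, 14⟩,
    ⟨2, 65, 125, 91, 22, 63, 49, 26⟩, ⟨26, 14, 38, 69, 89, 57, 47, 14⟩,
    ⟨1, 244, 137, 131, 106, 95, 76, 38⟩, ⟨32, 429, 308, 484, 104, 212, 196, 69⟩⟩⟩

/-- The Horner scheme expressing `rootY` as a polynomial in `commY`. -/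
def hornerY : List (ℕ × PolyMat) :=
  [(13,
    ⟨⟨13, 15, 0, 15, 0, 0, 6, 0⟩, ⟨0, 32, 51, 45, 6, 29, 18, 3⟩, ⟨0, 45, 62, 45, 6, 30, 18, 0⟩,
    ⟨0, 17, 30, 28, 3, 12, 10, 0⟩, ⟨3, 6, 6, 6, 13, 3, 3, 0⟩, ⟨0, 0, 0, 3, 0, 13, 0, 0⟩,
    ⟨6, 6, 0, 5, 0, 0, 14, 0⟩, ⟨15, 12, 0, 12, 0, 0, 6, 13⟩⟩),
    (8,
    ⟨⟨4, 249, 153, 255, 17, 85, 100, 15⟩, ⟨45, 26, 29, 29, 11, 44, 14, 32⟩,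
    ⟨34, 30, 21, 18, 11, 33, 8, 45⟩, ⟨23, 63, 33, 49, 2, 4, 27, 17⟩,
    ⟨11, 49, 38, 49, 14, 19, 28, 6⟩, ⟨0, 17, 30, 28, 3, 4, 10, 0⟩,
    ⟨28, 107, 68, 101, 9, 46, 48, 6⟩, ⟨53, 251, 180, 253, 20, 68, 98, 4⟩⟩),
    (56,
    ⟨⟨210, 103, 68, 86, 63, 212, 33, 249⟩, ⟨183, 209, 179, 203, 19, 83, 123, 26⟩,
    ⟨130, 3, 33, 42, 4, 19, 19, 30⟩, ⟨97, 16, 16, 55, 13, 53, 7, 63⟩,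
    ⟨40, 245, 145, 250, 39, 109, 100, 49⟩, ⟨23, 63, 33, 49, 2, 60, 27, 17⟩,
    ⟨119, 492, 303, 498, 59, 208, 241, 107⟩, ⟨196, 863, 645, 889, 99, 509, 448, 195⟩⟩),
    (790,
    ⟨⟨118, 29, 113, 232, 16, 94, 110, 103⟩, ⟨151, 122, 426, 836, 15, 58, 468, 209⟩,
    ⟨68, 12, 24, 12, 110, 507, 15, 3⟩, ⟨192, 48, 460, 788, 55, 193, 4, 16⟩,
    ⟨26, 48, 78, 57, 804, 210, 21, 245⟩, ⟨97, 16, 16, 55, 13, 803, 7, 63⟩,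
    ⟨30, 176, 241, 145, 116, 385, 858, 492⟩, ⟨44, 295, 390, 282, 205, 956, 183, 73⟩⟩),
    (314,
    ⟨⟨13, 2, 28, 50, 48, 21, 36, 29⟩, ⟨50, 15, 102, 219, 228, 69, 175, 122⟩,
    ⟨127, 2, 202, 502, 36, 218, 31, 12⟩, ⟨111, 14, 218, 497, 236, 79, 3, 48⟩,
    ⟨47, 49, 108, 246, 511, 252, 141, 48⟩, ⟨192, 48, 460, 788, 55, 507, 4, 16⟩,
    ⟨156, 46, 275, 757, 19, 10, 280, 176⟩, ⟨206, 33, 463, 810, 88, 456, 34, 29⟩⟩),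
    (7,
    ⟨⟨22, 89, 106, 104, 14, 54, 44, 2⟩, ⟨40, 57, 95, 212, 9, 29, 63, 15⟩,
    ⟨38, 47, 91, 234, 102, 46, 25, 2⟩, ⟨26, 14, 38, 69, 89, 46, 47, 14⟩,
    ⟨21, 26, 47, 107, 75, 68, 94, 49⟩, ⟨111, 14, 218, 497, 236, 72, 3, 48⟩,
    ⟨83, 38, 137, 308, 143, 123, 12, 46⟩, ⟨117, 82, 186, 440, 246, 125, 52, 38⟩⟩),
    (23,
    ⟨⟨75, 167, 143, 189, 14, 9, 72, 89⟩, ⟨68, 441, 284, 396, 24, 156, 228, 57⟩,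
    ⟨94, 498, 363, 453, 2, 169, 211, 47⟩, ⟨49, 237, 184, 251, 21, 83, 112, 14⟩,
    ⟨2, 65, 125, 91, 22, 63, 49, 26⟩, ⟨26, 14, 38, 69, 89, 57, 47, 14⟩,
    ⟨1, 244, 137, 131, 106, 95, 76, 38⟩, ⟨32, 429, 308, 484, 104, 212, 196, 69⟩⟩)]

/-- The matrix `y r⁻¹` with `r` given by `rootY`. -/
def zY : RatMat :=
  ⟨34,
    ⟨⟨22, 89, 106, 104, 14, 24, 2, 21⟩, ⟨91, 69, 131, 484, 189, 396, 453, 251⟩,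
    ⟨65, 14, 244, 429, 167, 441, 498, 237⟩, ⟨49, 47, 76, 196, 72, 228, 211, 112⟩,
    ⟨2, 26, 1, 32, 75, 68, 94, 49⟩, ⟨26, 14, 38, 69, 89, 57, 47, 14⟩,
    ⟨63, 57, 95, 212, 9, 156, 169, 83⟩, ⟨125, 38, 137, 308, 143, 284, 363, 184⟩⟩⟩

/-- The square root of `commYXY`. -/
def rootYXY : RatMat :=
  ⟨153,
    ⟨⟨308, 141, 1023, 1925, 851, 411, 417, 92⟩, ⟨482, 132, 1497, 523, 1212, 515, 429, 247⟩,
    ⟨438, 432, 1209, 594, 1445, 652, 320, 207⟩, ⟨241, 353, 847, 363, 945, 502, 116, 81⟩,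
    ⟨98, 58, 242, 18, 219, 107, 106, 14⟩, ⟨281, 851, 404, 1599, 216, 149, 78, 113⟩,
    ⟨388, 586, 511, 1037, 116, 171, 6, 76⟩, ⟨258, 622, 231, 1263, 297, 77, 175, 123⟩⟩⟩

/-- The Horner scheme expressing `rootYXY` as a polynomial in `commYXY`. -/
def hornerYXY : List (ℕ × PolyMat) :=
  [(896,
    ⟨⟨952, 216, 168, 216, 130, 72, 90, 28⟩, ⟨216, 952, 1008, 216, 842, 418, 242, 84⟩,
    ⟨216, 0, 108, 238, 854, 428, 238, 84⟩, ⟨126, 56, 446, 980, 502, 252, 126, 36⟩,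
    ⟨18, 18, 84, 14, 966, 36, 28, 14⟩, ⟨28, 130, 56, 130, 54, 924, 90, 0⟩,
    ⟨0, 224, 112, 224, 108, 54, 1008, 14⟩, ⟨56, 216, 144, 216, 180, 84, 90, 924⟩⟩),
    (953,
    ⟨⟨3303, 14062, 11940, 14130, 9678, 4270, 6120, 2016⟩,
    ⟨1810, 7137, 5516, 7884, 4476, 2402, 2590, 896⟩,
    ⟨1148, 5894, 7707, 4522, 7092, 3078, 3598, 716⟩,
    ⟨390, 1958, 1076, 1829, 1726, 662, 700, 224⟩, ⟨372, 1862, 1306, 1170, 1381, 686, 632, 98⟩,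
    ⟨2760, 9678, 13062, 11054, 15214, 8149, 6832, 1300⟩,
    ⟨3136, 15846, 9792, 12942, 11254, 5600, 4665, 1568⟩,
    ⟨3164, 14256, 11872, 13752, 9252, 4498, 5256, 1343⟩⟩),
    (1016,
    ⟨⟨3008, 13740, 12674, 960, 15365, 7802, 5215, 1384⟩,
    ⟨1216, 6358, 6772, 370, 6971, 3801, 2955, 744⟩,
    ⟨1870, 4886, 4828, 1457, 5037, 2778, 3473, 896⟩,
    ⟨531, 2972, 3153, 3950, 3165, 1988, 1855, 492⟩,
    ⟨537, 2597, 3224, 3457, 4093, 1836, 2032, 373⟩,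
    ⟨2198, 15365, 14098, 6771, 13669, 8028, 4257, 1138⟩,
    ⟨3164, 8842, 10946, 6186, 11552, 4431, 7080, 1743⟩,
    ⟨2300, 14454, 16016, 1518, 13560, 6622, 4767, 1634⟩⟩),
    (3530,
    ⟨⟨9, 16017, 12242, 11385, 8051, 5689, 7690, 1054⟩,
    ⟨533, 3252, 2404, 3624, 4560, 1977, 1213, 272⟩, ⟨458, 3261, 3701, 881, 6032, 551, 609, 234⟩,
    ⟨873, 3839, 2526, 3746, 3457, 1451, 1024, 318⟩,
    ⟨834, 2099, 2851, 1931, 596, 1113, 1812, 437⟩,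
    ⟨1600, 8051, 5089, 5285, 12903, 504, 940, 1004⟩,
    ⟨872, 2373, 2714, 3139, 13843, 434, 1944, 162⟩,
    ⟨2986, 10354, 13438, 13790, 2820, 6261, 4412, 2961⟩⟩),
    (3652,
    ⟨⟨3442, 13226, 13319, 3476, 7433, 4271, 5868, 3539⟩,
    ⟨1086, 3907, 864, 7123, 5256, 1667, 588, 1527⟩,
    ⟨1831, 561, 2667, 4750, 7556, 1280, 718, 1127⟩, ⟨431, 718, 200, 1042, 1052, 313, 107, 301⟩,
    ⟨769, 1603, 809, 2950, 3604, 565, 407, 884⟩,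
    ⟨2316, 7433, 2229, 12132, 16102, 623, 3195, 3761⟩,
    ⟨2734, 4163, 2973, 12689, 12287, 2463, 244, 2479⟩,
    ⟨1748, 5959, 3518, 12477, 11395, 3838, 884, 134⟩⟩),
    (446,
    ⟨⟨47, 1998, 1248, 1155, 6963, 2126, 1589, 2905⟩,
    ⟨77, 1727, 1295, 1663, 3089, 1827, 8, 1134⟩, ⟨954, 1680, 2002, 831, 3173, 1993, 990, 1506⟩,
    ⟨164, 735, 890, 837, 648, 137, 481, 315⟩, ⟨828, 3707, 2236, 3302, 3540, 1702, 1450, 593⟩,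
    ⟨116, 6963, 4678, 4194, 3027, 1092, 2448, 3799⟩,
    ⟨186, 2996, 3573, 3485, 8173, 4023, 875, 2651⟩,
    ⟨16, 10839, 13227, 13805, 9899, 4721, 4656, 2237⟩⟩),
    (254,
    ⟨⟨3628, 1995, 5125, 10931, 4641, 2073, 2415, 884⟩,
    ⟨2750, 1980, 14279, 7785, 15060, 7697, 2347, 1405⟩,
    ⟨2482, 2448, 15079, 7470, 13651, 6596, 3264, 1045⟩,
    ⟨1375, 3375, 4757, 3401, 6047, 2674, 748, 831⟩, ⟨574, 374, 1358, 238, 1241, 585, 582, 90⟩,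
    ⟨3975, 4641, 2124, 9029, 1224, 1859, 922, 735⟩,
    ⟨2236, 7590, 2565, 15435, 748, 1545, 34, 900⟩,
    ⟨3870, 7290, 1421, 14837, 3735, 907, 1589, 697⟩⟩)]

/-- The matrix `y x y r⁻¹` with `r` given by `rootYXY`. -/
def zYXY : RatMat :=
  ⟨153,
    ⟨⟨14, 113, 76, 123, 92, 247, 207, 81⟩, ⟨438, 2000, 1162, 1743, 1599, 1553, 1824, 870⟩,
    ⟨219, 216, 116, 297, 851, 1212, 1445, 945⟩, ⟨21, 92, 133, 288, 293, 662, 573, 421⟩,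
    ⟨40, 1388, 1607, 1665, 1800, 655, 994, 10⟩, ⟨56, 92, 49, 139, 113, 49, 63, 1⟩,
    ⟨119, 325, 257, 34, 17, 884, 907, 340⟩, ⟨53, 791, 562, 537, 156, 1890, 1685, 568⟩⟩⟩

/-- The square of `zY`. -/
def zYSq : RatMat :=
  ⟨1028,
    ⟨⟨1710, 7423, 8002, 434, 4092, 5874, 6084, 3695⟩,
    ⟨868, 129, 8184, 11087, 8277, 1023, 2391, 1397⟩,
    ⟨1782, 6696, 654, 9009, 11317, 7161, 5115, 3300⟩,
    ⟨62, 1949, 2314, 5616, 5526, 1056, 434, 341⟩,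
    ⟨682, 3168, 1518, 6797, 6825, 3533, 2143, 1984⟩,
    ⟨310, 4092, 1254, 6235, 7423, 2179, 3629, 1736⟩,
    ⟨528, 2277, 4092, 3603, 2541, 3075, 3111, 1289⟩,
    ⟨990, 7076, 186, 11253, 11705, 5653, 6975, 3932⟩⟩⟩

/-- The square root of `zYSq`. -/
def rootZ : RatMat :=
  ⟨650,
    ⟨⟨358, 2023, 1364, 1228, 924, 564, 942, 109⟩, ⟨382, 723, 1526, 3571, 3659, 231, 227, 351⟩,
    ⟨60, 1130, 682, 3893, 3319, 1277, 1091, 664⟩, ⟨194, 503, 996, 1510, 1660, 258, 446, 93⟩,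
    ⟨186, 700, 402, 1435, 1721, 703, 1021, 268⟩, ⟨410, 924, 232, 1669, 2023, 129, 487, 426⟩,
    ⟨92, 915, 924, 593, 99, 437, 363, 159⟩, ⟨816, 1634, 400, 3069, 3839, 825, 139, 938⟩⟩⟩

/-- The Horner scheme expressing `rootZ` as a polynomial in `zYSq`. -/
def hornerZ : List (ℕ × PolyMat) :=
  [(6731,
    ⟨⟨7397, 7423, 8002, 434, 4092, 5874, 6084, 3695⟩,
    ⟨868, 6858, 8184, 11087, 8277, 1023, 2391, 1397⟩,
    ⟨1782, 6696, 6341, 9009, 11317, 7161, 5115, 3300⟩,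
    ⟨62, 1949, 2314, 4027, 5526, 1056, 434, 341⟩,
    ⟨682, 3168, 1518, 6797, 226, 3533, 2143, 1984⟩,
    ⟨310, 4092, 1254, 6235, 7423, 4808, 3629, 1736⟩,
    ⟨528, 2277, 4092, 3603, 2541, 3075, 5740, 1289⟩,
    ⟨990, 7076, 186, 11253, 11705, 5653, 6975, 5399⟩⟩),
    (3949688,
    ⟨⟨2619900, 12839158, 8388616, 12570616, 7306200, 5715400, 6859308, 969650⟩,
    ⟨2373900, 5040958, 9524316, 30510206, 29054670, 1826550, 1801950, 2166854⟩,
    ⟨418200, 11418500, 4194308, 27226050, 33105494, 12084754, 11162270, 4706800⟩,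
    ⟨1988500, 3232854, 6535400, 9688316, 16539416, 2644500, 3817100, 608850⟩,
    ⟨1217700, 4354200, 4120500, 10461166, 14864570, 4327558, 6311954, 2747000⟩,
    ⟨4169700, 7306200, 1722000, 14987554, 12839158, 1322250, 3396854, 3677700⟩,
    ⟨615000, 7267262, 7306200, 5815850, 1014750, 3868354, 2503054, 1514950⟩,
    ⟨8364000, 16740308, 4100000, 18874386, 27816454, 8320954, 1391950, 6818308⟩⟩)]

/-- The involution in the group generated by `zY`. -/
def uZ : RatMat :=
  ⟨42,
    ⟨⟨54, 0, 30, 34, 0, 62, 34, 30⟩, ⟨85, 20, 153, 291, 62, 387, 470, 244⟩,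
    ⟨85, 34, 156, 374, 34, 470, 387, 199⟩, ⟨51, 30, 80, 190, 30, 244, 199, 127⟩,
    ⟨0, 28, 47, 85, 54, 85, 85, 51⟩, ⟨28, 0, 30, 34, 0, 20, 34, 30⟩,
    ⟨47, 30, 127, 229, 30, 153, 156, 80⟩, ⟨85, 34, 229, 387, 34, 291, 374, 190⟩⟩⟩

/-- The product of `zYXY` and `uZ`. -/
def zYXYMulU : RatMat :=
  ⟨1950,
    ⟨⟨140, 538, 1645, 3569, 924, 2657, 3049, 1663⟩,
    ⟨1303, 12250, 14067, 11275, 9408, 13763, 14334, 6116⟩,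
    ⟨3077, 3130, 9671, 27295, 6488, 17313, 17720, 13566⟩,
    ⟨1835, 1230, 7717, 8373, 2064, 15593, 15798, 4960⟩,
    ⟨1188, 15768, 2410, 19198, 9184, 30654, 32428, 10044⟩,
    ⟨392, 924, 1163, 2129, 538, 3781, 3657, 1311⟩,
    ⟨1455, 2788, 6107, 11839, 1980, 14331, 13604, 5820⟩,
    ⟨2321, 6880, 13766, 26960, 3970, 17786, 18167, 12837⟩⟩⟩

/-- The product of `uZ` and `zYXY`. -/
def uMulZYXY : RatMat :=
  ⟨5850,
    ⟨⟨932, 3654, 186, 5404, 2772, 1004, 1876, 196⟩,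
    ⟨2268, 16759, 27544, 27489, 28721, 13728, 10410, 652⟩,
    ⟨14242, 43735, 62963, 37540, 49401, 24231, 23761, 3117⟩,
    ⟨6982, 25669, 24217, 25052, 16991, 15071, 13013, 1645⟩,
    ⟨8060, 45256, 55793, 56531, 60320, 28179, 20845, 4691⟩,
    ⟨1208, 2772, 3080, 3452, 3654, 7312, 7988, 2276⟩,
    ⟨5850, 20115, 28890, 31905, 27675, 16234, 15840, 3264⟩,
    ⟨11470, 51921, 34292, 39369, 41215, 20134, 22460, 7212⟩⟩⟩

/-- The quotient of `zY` by `zYXY`. -/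
def zQuot : RatMat :=
  ⟨4626,
    ⟨⟨25848, 3348, 4694, 2479, 682, 8728, 8091, 4782⟩,
    ⟨109213, 15539, 37230, 100485, 13129, 64449, 104674, 45074⟩,
    ⟨116655, 15623, 42465, 124025, 16275, 42834, 120950, 40689⟩,
    ⟨44020, 4317, 27030, 45292, 4433, 30070, 46843, 30024⟩,
    ⟨7175, 3290, 4488, 5191, 436, 21789, 14383, 1674⟩,
    ⟨15747, 682, 14445, 26400, 3348, 5612, 28948, 14123⟩,
    ⟨50621, 8091, 30750, 43461, 4521, 19801, 47590, 26218⟩,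
    ⟨78833, 11059, 52700, 86100, 10663, 59169, 93275, 57592⟩⟩⟩

/-- The action of `zY` on the plane. -/
def zYAction : PlaneAction := ⟨12, 24, 6, 87, 81, 103⟩

/-- The action of `zYXY` on the plane. -/
def zYXYAction : PlaneAction := ⟨54, 325, 190, 45, 612, 377⟩

/-- The action of `zQuot` on the plane. -/
def zQuotAction : PlaneAction := ⟨22907, 28981, 26745, 4030, 3438, 396⟩

/-- The matrix `(x y)⁴`. -/
def matXYPowThree : RatMat :=
  ⟨1,
    ⟨⟨0, 3, 2, 2, 0, 3, 3, 2⟩, ⟨0, 3, 1, 1, 1, 2, 1, 0⟩, ⟨2, 0, 1, 3, 1, 2, 2, 0⟩,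
    ⟨0, 1, 2, 1, 3, 0, 0, 0⟩, ⟨3, 2, 1, 0, 3, 3, 3, 0⟩, ⟨1, 0, 2, 0, 2, 1, 1, 0⟩,
    ⟨0, 0, 1, 3, 2, 0, 2, 3⟩, ⟨1, 1, 3, 2, 0, 1, 0, 3⟩⟩⟩

/-- The matrix `(x y⁻¹)⁴`. -/
def matXYInvPowThree : RatMat :=
  ⟨1,
    ⟨⟨3, 3, 1, 2, 0, 0, 2, 1⟩, ⟨0, 1, 1, 3, 2, 2, 0, 3⟩, ⟨2, 1, 3, 0, 3, 1, 0, 0⟩,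
    ⟨3, 0, 1, 2, 3, 0, 1, 2⟩, ⟨3, 0, 0, 0, 0, 1, 1, 2⟩, ⟨0, 0, 0, 3, 2, 3, 0, 0⟩,
    ⟨3, 0, 2, 0, 3, 1, 1, 2⟩, ⟨1, 2, 1, 1, 2, 3, 2, 1⟩⟩⟩

/-- The matrix `h = y⁻¹ (x y)^4`. -/
def wordThree : RatMat :=
  ⟨1,
    ⟨⟨0, 3, 2, 2, 0, 3, 3, 2⟩, ⟨0, 0, 1, 3, 2, 0, 2, 3⟩, ⟨0, 1, 2, 1, 3, 0, 0, 0⟩,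
    ⟨1, 0, 2, 0, 2, 1, 1, 0⟩, ⟨3, 2, 1, 0, 3, 3, 3, 0⟩, ⟨2, 0, 1, 3, 1, 2, 2, 0⟩,
    ⟨1, 1, 3, 2, 0, 1, 0, 3⟩, ⟨0, 3, 1, 1, 1, 2, 1, 0⟩⟩⟩

/-- The matrix `x h⁻¹`. -/
def leftThree : RatMat :=
  ⟨1,
    ⟨⟨2, 0, 1, 3, 3, 0, 1, 0⟩, ⟨2, 1, 1, 1, 1, 3, 3, 2⟩, ⟨1, 3, 0, 1, 1, 3, 3, 3⟩,
    ⟨1, 1, 1, 2, 0, 1, 0, 3⟩, ⟨0, 0, 1, 3, 0, 2, 0, 0⟩, ⟨3, 1, 0, 1, 0, 2, 3, 2⟩,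
    ⟨0, 3, 1, 0, 0, 1, 3, 3⟩, ⟨1, 3, 1, 2, 2, 2, 0, 2⟩⟩⟩

/-- The matrix `x h`. -/
def rightThree : RatMat :=
  ⟨1,
    ⟨⟨2, 0, 1, 3, 1, 2, 2, 0⟩, ⟨2, 1, 0, 0, 3, 1, 2, 1⟩, ⟨1, 3, 1, 0, 0, 2, 1, 1⟩,
    ⟨1, 1, 2, 3, 3, 3, 2, 1⟩, ⟨0, 1, 3, 2, 1, 0, 2, 3⟩, ⟨0, 3, 2, 2, 0, 3, 3, 2⟩,
    ⟨2, 2, 3, 3, 0, 1, 1, 2⟩, ⟨2, 2, 0, 2, 2, 2, 2, 0⟩⟩⟩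

/-- The matrix `x h⁻¹ x h`. -/
def commThree : RatMat :=
  ⟨1,
    ⟨⟨3, 1, 3, 1, 3, 2, 3, 2⟩, ⟨3, 2, 1, 0, 0, 1, 2, 2⟩, ⟨2, 1, 3, 0, 0, 2, 3, 1⟩,
    ⟨2, 2, 1, 1, 2, 2, 0, 0⟩, ⟨2, 1, 3, 1, 2, 1, 1, 1⟩, ⟨0, 3, 0, 3, 0, 2, 0, 2⟩,
    ⟨0, 3, 1, 1, 3, 0, 1, 1⟩, ⟨3, 2, 1, 1, 3, 0, 0, 2⟩⟩⟩

/-- The square root of `commThree`. -/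
def rootThree : RatMat :=
  ⟨1,
    ⟨⟨3, 0, 1, 3, 2, 1, 0, 2⟩, ⟨2, 0, 0, 0, 0, 3, 2, 2⟩, ⟨0, 3, 0, 3, 2, 2, 2, 2⟩,
    ⟨2, 1, 1, 1, 2, 2, 1, 0⟩, ⟨1, 1, 0, 1, 3, 3, 2, 0⟩, ⟨2, 2, 3, 0, 3, 3, 0, 1⟩,
    ⟨2, 1, 3, 0, 1, 3, 2, 1⟩, ⟨0, 3, 0, 3, 2, 0, 3, 0⟩⟩⟩

/-- The Horner scheme expressing `rootThree` as a polynomial in `commThree`. -/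
def hornerThree : List (ℕ × PolyMat) :=
  [(1,
    ⟨⟨3, 3, 2, 3, 2, 1, 2, 1⟩, ⟨2, 0, 3, 0, 0, 3, 1, 1⟩, ⟨1, 3, 3, 0, 0, 1, 2, 3⟩,
    ⟨1, 1, 3, 2, 1, 1, 0, 0⟩, ⟨1, 3, 2, 3, 0, 3, 3, 3⟩, ⟨0, 2, 0, 2, 0, 0, 0, 1⟩,
    ⟨0, 2, 3, 3, 2, 0, 2, 3⟩, ⟨2, 1, 3, 3, 2, 0, 0, 0⟩⟩),
    (1,
    ⟨⟨3, 3, 1, 2, 2, 0, 2, 2⟩, ⟨3, 3, 3, 0, 1, 3, 2, 2⟩, ⟨2, 0, 2, 3, 0, 2, 2, 1⟩,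
    ⟨0, 1, 1, 0, 2, 2, 2, 0⟩, ⟨1, 2, 2, 0, 3, 2, 0, 2⟩, ⟨1, 2, 1, 3, 0, 0, 3, 1⟩,
    ⟨0, 3, 3, 0, 1, 0, 0, 1⟩, ⟨1, 0, 0, 3, 3, 0, 3, 1⟩⟩),
    (0,
    ⟨⟨3, 0, 1, 3, 2, 1, 0, 2⟩, ⟨2, 0, 0, 0, 0, 3, 2, 2⟩, ⟨0, 3, 0, 3, 2, 2, 2, 2⟩,
    ⟨2, 1, 1, 1, 2, 2, 1, 0⟩, ⟨1, 1, 0, 1, 3, 3, 2, 0⟩, ⟨2, 2, 3, 0, 3, 3, 0, 1⟩,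
    ⟨2, 1, 3, 0, 1, 3, 2, 1⟩, ⟨0, 3, 0, 3, 2, 0, 3, 0⟩⟩)]

/-- The matrix `h r⁻¹` with `r` given by `rootThree`. -/
def zThree : RatMat :=
  ⟨1,
    ⟨⟨0, 3, 2, 2, 2, 2, 2, 1⟩, ⟨3, 1, 3, 1, 0, 0, 1, 3⟩, ⟨3, 3, 0, 1, 1, 3, 3, 1⟩,
    ⟨3, 1, 3, 0, 2, 0, 2, 3⟩, ⟨1, 1, 0, 0, 2, 2, 2, 2⟩, ⟨0, 2, 2, 1, 3, 1, 1, 0⟩,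
    ⟨3, 0, 0, 1, 2, 1, 3, 1⟩, ⟨3, 1, 2, 2, 3, 0, 0, 1⟩⟩⟩

/-- The power of `zThree` with exponent 2. -/
def zThreePow2 : RatMat :=
  ⟨1,
    ⟨⟨2, 0, 2, 3, 3, 2, 1, 1⟩, ⟨3, 3, 0, 3, 0, 2, 3, 2⟩, ⟨1, 1, 3, 0, 1, 3, 3, 2⟩,
    ⟨0, 0, 3, 0, 0, 2, 0, 1⟩, ⟨1, 1, 1, 0, 2, 1, 3, 1⟩, ⟨3, 3, 0, 0, 0, 0, 2, 0⟩,
    ⟨0, 2, 2, 1, 1, 0, 3, 1⟩, ⟨3, 2, 1, 0, 2, 1, 3, 3⟩⟩⟩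

/-- The power of `zThree` with exponent 4. -/
def zThreePow4 : RatMat :=
  ⟨1,
    ⟨⟨0, 0, 0, 0, 1, 1, 2, 3⟩, ⟨3, 1, 0, 3, 2, 3, 1, 3⟩, ⟨0, 1, 2, 3, 2, 1, 1, 1⟩,
    ⟨1, 0, 3, 0, 1, 3, 2, 2⟩, ⟨2, 0, 3, 3, 0, 0, 3, 3⟩, ⟨3, 1, 2, 2, 0, 0, 0, 0⟩,
    ⟨1, 1, 3, 2, 1, 0, 2, 0⟩, ⟨2, 1, 2, 0, 2, 0, 2, 1⟩⟩⟩

/-- An involution. -/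
def uThree : RatMat :=
  ⟨1,
    ⟨⟨2, 0, 3, 2, 0, 1, 2, 3⟩, ⟨2, 0, 0, 3, 1, 0, 2, 3⟩, ⟨2, 2, 1, 1, 2, 2, 0, 0⟩,
    ⟨3, 3, 0, 3, 3, 3, 0, 0⟩, ⟨0, 3, 0, 2, 2, 2, 2, 3⟩, ⟨3, 0, 3, 2, 0, 0, 2, 3⟩,
    ⟨0, 3, 0, 2, 3, 0, 1, 0⟩, ⟨2, 2, 2, 0, 2, 3, 1, 3⟩⟩⟩

/-- The product of `zY` and `uThree`. -/
def zYMulUThree : RatMat :=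
  ⟨1,
    ⟨⟨2, 1, 1, 2, 2, 3, 3, 2⟩, ⟨3, 3, 0, 3, 0, 3, 0, 3⟩, ⟨0, 1, 0, 1, 0, 1, 2, 1⟩,
    ⟨0, 0, 1, 0, 2, 1, 0, 3⟩, ⟨0, 0, 1, 0, 2, 3, 0, 1⟩, ⟨0, 2, 2, 2, 1, 1, 3, 2⟩,
    ⟨1, 1, 3, 1, 0, 2, 0, 2⟩, ⟨3, 3, 1, 0, 2, 3, 3, 2⟩⟩⟩

/-- The product of `uThree` and `zY`. -/
def uMulZYThree : RatMat :=
  ⟨1,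
    ⟨⟨2, 1, 0, 1, 2, 0, 0, 3⟩, ⟨1, 2, 3, 2, 1, 0, 1, 1⟩, ⟨2, 0, 3, 0, 1, 2, 3, 3⟩,
    ⟨3, 2, 0, 2, 0, 0, 2, 0⟩, ⟨0, 0, 1, 0, 2, 3, 0, 1⟩, ⟨0, 2, 3, 1, 1, 2, 0, 3⟩,
    ⟨2, 3, 3, 0, 2, 0, 1, 0⟩, ⟨1, 2, 2, 1, 3, 0, 2, 0⟩⟩⟩

/-- The action of `zThree` on the plane. -/
def zThreeAction : PlaneAction := ⟨0, 1, 1, 1, 3, 3⟩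

/-- The matrix `h = y⁻¹ (x y)^2`. -/
def wordFive : RatMat :=
  ⟨1,
    ⟨⟨0, 2, 0, 2, 0, 0, 1, 0⟩, ⟨1, 10, 0, 11, 0, 0, 4, 0⟩, ⟨1, 14, 2, 14, 2, 1, 6, 0⟩,
    ⟨0, 0, 0, 1, 0, 0, 0, 0⟩, ⟨1, 0, 5, 0, 0, 2, 0, 0⟩, ⟨2, 4, 4, 4, 5, 2, 15, 0⟩,
    ⟨2, 14, 0, 14, 0, 0, 10, 0⟩, ⟨2, 4, 4, 4, 5, 3, 15, 1⟩⟩⟩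

/-- The matrix `x h⁻¹`. -/
def leftFive : RatMat :=
  ⟨1,
    ⟨⟨0, 4, 14, 4, 2, 10, 14, 0⟩, ⟨15, 10, 9, 10, 14, 11, 0, 2⟩, ⟨14, 8, 11, 8, 14, 10, 1, 2⟩,
    ⟨10, 4, 13, 4, 6, 0, 9, 1⟩, ⟨2, 13, 10, 12, 1, 4, 7, 0⟩, ⟨0, 5, 0, 5, 0, 0, 2, 0⟩,
    ⟨0, 10, 10, 8, 1, 4, 4, 0⟩, ⟨0, 1, 11, 4, 2, 8, 12, 0⟩⟩⟩

/-- The matrix `x h`. -/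
def rightFive : RatMat :=
  ⟨1,
    ⟨⟨2, 4, 4, 4, 5, 2, 15, 0⟩, ⟨5, 11, 6, 11, 4, 14, 15, 2⟩, ⟨4, 11, 3, 11, 4, 12, 15, 2⟩,
    ⟨2, 15, 12, 15, 15, 7, 5, 1⟩, ⟨0, 4, 2, 5, 2, 1, 2, 0⟩, ⟨0, 2, 0, 2, 0, 0, 1, 0⟩,
    ⟨1, 12, 2, 14, 2, 1, 7, 0⟩, ⟨2, 3, 4, 6, 4, 2, 12, 0⟩⟩⟩

/-- The matrix `x h⁻¹ x h`. -/
def commFive : RatMat :=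
  ⟨1,
    ⟨⟨11, 7, 3, 6, 12, 3, 11, 15⟩, ⟨8, 12, 11, 8, 15, 3, 10, 12⟩, ⟨13, 7, 0, 1, 9, 10, 9, 14⟩,
    ⟨9, 14, 13, 0, 1, 2, 4, 9⟩, ⟨10, 8, 7, 7, 3, 7, 3, 2⟩, ⟨6, 12, 7, 8, 2, 14, 13, 15⟩,
    ⟨1, 6, 10, 15, 14, 8, 12, 8⟩, ⟨12, 4, 9, 1, 8, 11, 7, 15⟩⟩⟩

/-- The square root of `commFive`. -/
def rootFive : RatMat :=
  ⟨1,
    ⟨⟨9, 2, 2, 2, 9, 1, 12, 3⟩, ⟨12, 13, 3, 2, 8, 1, 9, 5⟩, ⟨8, 4, 0, 8, 4, 15, 5, 12⟩,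
    ⟨1, 2, 3, 13, 4, 10, 15, 12⟩, ⟨2, 13, 13, 5, 11, 8, 7, 0⟩, ⟨12, 9, 5, 3, 12, 0, 11, 12⟩,
    ⟨13, 3, 2, 14, 0, 1, 13, 4⟩, ⟨11, 8, 6, 0, 11, 9, 7, 1⟩⟩⟩

/-- The Horner scheme expressing `rootFive` as a polynomial in `commFive`. -/
def hornerFive : List (ℕ × PolyMat) :=
  [(5,
    ⟨⟨8, 3, 12, 7, 14, 12, 13, 2⟩, ⟨1, 11, 13, 1, 2, 12, 9, 14⟩, ⟨10, 3, 5, 4, 5, 9, 5, 6⟩,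
    ⟨5, 6, 10, 5, 4, 8, 15, 5⟩, ⟨9, 1, 3, 3, 9, 3, 12, 8⟩, ⟨7, 14, 3, 1, 8, 3, 10, 2⟩,
    ⟨4, 7, 9, 2, 6, 1, 11, 1⟩, ⟨14, 15, 5, 4, 1, 13, 3, 7⟩⟩),
    (9,
    ⟨⟨7, 5, 10, 6, 4, 11, 11, 11⟩, ⟨10, 6, 7, 6, 14, 2, 6, 5⟩, ⟨14, 1, 14, 5, 6, 4, 8, 8⟩,
    ⟨0, 7, 0, 0, 14, 4, 13, 2⟩, ⟨8, 0, 1, 11, 4, 10, 11, 10⟩, ⟨8, 4, 1, 4, 6, 1, 5, 15⟩,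
    ⟨3, 6, 9, 6, 2, 11, 15, 1⟩, ⟨4, 15, 8, 1, 7, 3, 9, 5⟩⟩),
    (2,
    ⟨⟨12, 5, 14, 9, 8, 12, 4, 4⟩, ⟨15, 7, 1, 9, 5, 15, 13, 14⟩, ⟨15, 11, 10, 3, 14, 7, 7, 6⟩,
    ⟨4, 0, 4, 5, 2, 6, 0, 14⟩, ⟨2, 8, 4, 1, 8, 1, 3, 9⟩, ⟨11, 8, 2, 9, 8, 11, 3, 3⟩,
    ⟨14, 4, 3, 15, 13, 4, 2, 8⟩, ⟨2, 3, 3, 8, 9, 6, 12, 4⟩⟩),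
    (6,
    ⟨⟨14, 9, 4, 13, 12, 6, 7, 4⟩, ⟨5, 12, 3, 3, 12, 9, 2, 14⟩, ⟨9, 2, 6, 11, 14, 14, 10, 1⟩,
    ⟨1, 8, 10, 11, 8, 5, 1, 8⟩, ⟨15, 1, 13, 3, 3, 11, 5, 1⟩, ⟨2, 12, 13, 10, 12, 7, 4, 5⟩,
    ⟨11, 3, 9, 13, 2, 15, 11, 3⟩, ⟨2, 5, 2, 5, 6, 7, 8, 4⟩⟩),
    (1,
    ⟨⟨0, 11, 10, 8, 4, 14, 11, 8⟩, ⟨13, 10, 2, 1, 10, 10, 11, 13⟩, ⟨12, 10, 0, 2, 4, 13, 10, 1⟩,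
    ⟨7, 10, 7, 7, 5, 8, 6, 3⟩, ⟨6, 5, 1, 6, 1, 15, 9, 14⟩, ⟨14, 4, 10, 6, 7, 0, 1, 8⟩,
    ⟨8, 0, 6, 9, 9, 11, 0, 2⟩, ⟨0, 0, 8, 12, 11, 1, 4, 13⟩⟩),
    (12,
    ⟨⟨9, 2, 2, 2, 9, 1, 12, 3⟩, ⟨12, 13, 3, 2, 8, 1, 9, 5⟩, ⟨8, 4, 0, 8, 4, 15, 5, 12⟩,
    ⟨1, 2, 3, 13, 4, 10, 15, 12⟩, ⟨2, 13, 13, 5, 11, 8, 7, 0⟩, ⟨12, 9, 5, 3, 12, 0, 11, 12⟩,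
    ⟨13, 3, 2, 14, 0, 1, 13, 4⟩, ⟨11, 8, 6, 0, 11, 9, 7, 1⟩⟩)]

/-- The matrix `h r⁻¹` with `r` given by `rootFive`. -/
def zFive : RatMat :=
  ⟨1,
    ⟨⟨2, 2, 8, 9, 6, 11, 6, 15⟩, ⟨12, 15, 15, 0, 9, 8, 9, 6⟩, ⟨15, 0, 7, 3, 14, 3, 8, 10⟩,
    ⟨0, 12, 4, 1, 3, 5, 12, 12⟩, ⟨10, 7, 1, 0, 15, 1, 2, 13⟩, ⟨13, 6, 1, 1, 2, 12, 14, 2⟩,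
    ⟨11, 14, 3, 7, 5, 8, 5, 12⟩, ⟨5, 12, 12, 9, 2, 3, 2, 13⟩⟩⟩

/-- The power of `zFive` with exponent 2. -/
def zFivePow2 : RatMat :=
  ⟨1,
    ⟨⟨15, 0, 12, 14, 3, 3, 1, 9⟩, ⟨10, 11, 11, 0, 1, 8, 7, 9⟩, ⟨12, 3, 12, 3, 14, 10, 2, 4⟩,
    ⟨3, 5, 1, 2, 11, 3, 9, 2⟩, ⟨7, 15, 15, 13, 8, 13, 11, 2⟩, ⟨2, 3, 15, 14, 0, 14, 1, 9⟩,
    ⟨1, 4, 7, 15, 9, 14, 11, 0⟩, ⟨12, 5, 9, 5, 8, 12, 4, 7⟩⟩⟩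

/-- The power of `zFive` with exponent 4. -/
def zFivePow4 : RatMat :=
  ⟨1,
    ⟨⟨9, 0, 1, 9, 1, 3, 5, 5⟩, ⟨1, 2, 9, 12, 8, 13, 5, 13⟩, ⟨3, 3, 8, 6, 0, 11, 11, 4⟩,
    ⟨0, 15, 11, 5, 14, 11, 10, 11⟩, ⟨8, 8, 11, 15, 1, 9, 11, 10⟩, ⟨6, 1, 14, 4, 0, 1, 8, 11⟩,
    ⟨4, 2, 8, 3, 2, 10, 0, 1⟩, ⟨5, 8, 1, 3, 11, 8, 14, 6⟩⟩⟩

/-- The power of `zFive` with exponent 8. -/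
def zFivePow8 : RatMat :=
  ⟨1,
    ⟨⟨7, 0, 5, 10, 6, 1, 4, 10⟩, ⟨14, 8, 11, 13, 5, 15, 15, 9⟩, ⟨2, 1, 1, 3, 5, 10, 4, 9⟩,
    ⟨10, 7, 14, 5, 14, 2, 12, 4⟩, ⟨14, 0, 11, 9, 9, 0, 12, 8⟩, ⟨5, 6, 9, 11, 0, 2, 5, 0⟩,
    ⟨8, 0, 14, 8, 15, 1, 15, 12⟩, ⟨11, 2, 4, 10, 6, 10, 13, 15⟩⟩⟩

/-- The power of `zFive` with exponent 16. -/
def zFivePow16 : RatMat :=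
  ⟨1,
    ⟨⟨11, 0, 12, 0, 4, 15, 12, 8⟩, ⟨15, 5, 13, 4, 2, 10, 15, 5⟩, ⟨7, 15, 15, 12, 7, 9, 13, 11⟩,
    ⟨14, 8, 3, 6, 5, 2, 13, 13⟩, ⟨1, 5, 4, 12, 10, 14, 6, 7⟩, ⟨3, 4, 7, 14, 0, 9, 2, 7⟩,
    ⟨6, 9, 1, 9, 0, 1, 14, 10⟩, ⟨5, 0, 1, 12, 8, 11, 13, 10⟩⟩⟩

/-- An involution. -/
def uFive : RatMat :=
  ⟨1,
    ⟨⟨14, 0, 3, 5, 0, 10, 5, 3⟩, ⟨11, 11, 0, 13, 10, 13, 6, 6⟩, ⟨11, 5, 2, 6, 5, 6, 13, 10⟩,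
    ⟨12, 3, 8, 7, 3, 6, 10, 15⟩, ⟨0, 15, 3, 11, 14, 11, 11, 12⟩, ⟨15, 0, 3, 5, 0, 11, 5, 3⟩,
    ⟨3, 3, 15, 15, 3, 0, 2, 8⟩, ⟨11, 5, 15, 13, 5, 13, 6, 7⟩⟩⟩

/-- The product of `zY` and `uFive`. -/
def zYMulUFive : RatMat :=
  ⟨1,
    ⟨⟨5, 10, 4, 12, 12, 10, 11, 6⟩, ⟨14, 13, 4, 4, 13, 15, 15, 4⟩, ⟨9, 8, 11, 11, 12, 4, 11, 2⟩,
    ⟨8, 7, 3, 3, 14, 8, 2, 4⟩, ⟨15, 1, 9, 9, 5, 5, 2, 4⟩, ⟨1, 12, 11, 8, 10, 10, 15, 15⟩,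
    ⟨5, 3, 0, 10, 12, 15, 12, 11⟩, ⟨2, 15, 13, 11, 11, 15, 11, 3⟩⟩⟩

/-- The product of `uFive` and `zY`. -/
def uMulZYFive : RatMat :=
  ⟨1,
    ⟨⟨5, 10, 12, 11, 12, 13, 12, 14⟩, ⟨5, 10, 15, 15, 10, 15, 4, 8⟩,
    ⟨2, 15, 12, 11, 11, 15, 11, 2⟩, ⟨4, 15, 11, 3, 6, 4, 2, 4⟩, ⟨15, 1, 5, 2, 5, 14, 9, 8⟩,
    ⟨1, 12, 3, 15, 10, 13, 8, 7⟩, ⟨9, 11, 0, 13, 4, 4, 11, 3⟩, ⟨9, 8, 10, 11, 12, 4, 11, 3⟩⟩⟩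

/-- The action of `zFive` on the plane. -/
def zFiveAction : PlaneAction := ⟨15, 9, 9, 4, 8, 15⟩

end PlaneData

section Plane

variable {F : Type*} [Field F] [CharP F 2] {H : Subgroup (GL (Fin 8) F)} {a : F}

lemma ev_two (a : F) : ev a 2 = a := by
  rw [show 2 = 2 * 1 by rfl, ev_two_mul, ev_one, mul_one]

lemma memAt_matX (hx : xGL a ∈ H) : matX.MemAt a H := by
  refine ⟨by rw [matX, ev_one]; exact one_ne_zero, xGL a, hx, ?_⟩
  have h5 : ev a 5 = (a + 1) ^ 2 := by
    rw [show 5 = clmul 3 3 by decide, ev_clmul, ev_eq a 3]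
    simp [ev_one]
    ring
  rw [RatMat.val, matX, ev_one, inv_one, one_smul]
  change xPlusEven F a = _
  simp only [xPlusEven, PolyMat.eval, PolyRow.eval, ev_zero, ev_one, h5, ev_two]

lemma memAt_matY (hy : yGL F ∈ H) : matY.MemAt a H := by
  refine ⟨by rw [matY, ev_one]; exact one_ne_zero, yGL F, hy, ?_⟩
  rw [RatMat.val, matY, ev_one, inv_one, one_smul, yGL_val]
  simp only [yPlus, PolyMat.eval, PolyRow.eval, ev_zero, ev_one]

lemma memAt_matYInv (hy : yGL F ∈ H) : matYInv.MemAt a H :=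
  (memAt_matY hy).mul (memAt_matY hy) (ev_zero a) (e := 1) (by decide +kernel)

lemma memAt_matXY (hx : xGL a ∈ H) (hy : yGL F ∈ H) : matXY.MemAt a H :=
  (memAt_matX hx).mul (memAt_matY hy) (ev_zero a) (e := 1) (by decide +kernel)

lemma memAt_matXYInv (hx : xGL a ∈ H) (hy : yGL F ∈ H) : matXYInv.MemAt a H :=
  (memAt_matX hx).mul (memAt_matYInv hy) (ev_zero a) (e := 1) (by decide +kernel)

lemma memAt_matXYSq (hx : xGL a ∈ H) (hy : yGL F ∈ H) : matXYSq.MemAt a H :=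
  (memAt_matXY hx hy).mul (memAt_matXY hx hy) (ev_zero a) (e := 1) (by decide +kernel)

lemma memAt_matXYInvSq (hx : xGL a ∈ H) (hy : yGL F ∈ H) : matXYInvSq.MemAt a H :=
  (memAt_matXYInv hx hy).mul (memAt_matXYInv hx hy) (ev_zero a) (e := 1) (by decide +kernel)

variable [Finite F]

lemma memAt_zY (hx : xGL a ∈ H) (hy : yGL F ∈ H) (h0 : ev a 2 ≠ 0) (h1 : ev a 3 ≠ 0) :
    zY.MemAt a H := by
  have hden : ev a 34 ≠ 0 :=
    ev_ne_zero_of_factors (l := [2, 3, 3, 3, 3]) (by simp [h0, h1]) (by decide)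
  have hD : commY.MemAt a H :=
    (memAt_matXYInv hx hy).mul (memAt_matXY hx hy) (ev_zero a) (e := 1) (by decide +kernel)
  have hR : rootY.MemAt a H :=
    hD.of_mul_self hden (ev_zero a) (e := 1028) (k := 1) (c := 3) (l := hornerY)
      (by decide +kernel) (by simp [ev_one]) (by decide +kernel)
  exact hR.of_mul_right (memAt_matY hy) hden (ev_zero a) (e := 1028) (by decide +kernel)

lemma memAt_zYXY (hx : xGL a ∈ H) (hy : yGL F ∈ H) (h1 : ev a 3 ≠ 0) (h3 : ev a 7 ≠ 0) :
    zYXY.MemAt a H := by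
  have hden : ev a 153 ≠ 0 :=
    ev_ne_zero_of_factors (l := [3, 3, 3, 3, 3, 7]) (by simp [h1, h3]) (by decide)
  have hD : commYXY.MemAt a H :=
    (memAt_matXYInvSq hx hy).mul (memAt_matXYSq hx hy) (ev_zero a) (e := 1) (by decide +kernel)
  have hR : rootYXY.MemAt a H :=
    hD.of_mul_self hden (ev_zero a) (e := 16705) (k := 15) (c := 14) (l := hornerYXY)
      (by decide +kernel)
      (ev_ne_zero_of_factors (l := [3, 3, 3]) (by simp [h1]) (by decide)) (by decide +kernel)
  have hh : matYXY.MemAt a H :=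
    (memAt_matY hy).mul (memAt_matXY hx hy) (ev_zero a) (e := 1) (by decide +kernel)
  exact hR.of_mul_right hh hden (ev_zero a) (e := 16705) (by decide +kernel)

lemma memAt_siegel (hx : xGL a ∈ H) (hy : yGL F ∈ H) (h0 : ev a 2 ≠ 0) (h1 : ev a 3 ≠ 0)
    (h3 : ev a 7 ≠ 0) (h5 : ev a 31 ≠ 0) :
    (RatMat.siegel pRow ((bRow₁.smul 33).add (bRow₂.smul 495)) 42).MemAt a H := by
  have hz := memAt_zY hx hy h0 h1
  have hD : zYSq.MemAt a H := hz.mul hz (ev_zero a) (e := 1) (by decide +kernel)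
  have hR : rootZ.MemAt a H :=
    hD.of_mul_self (ev_ne_zero_of_factors (l := [2, 3, 3, 3, 3, 7, 7]) (by simp [h0, h1, h3])
        (by decide))
      (ev_zero a) (e := 273) (k := 10250) (c := 1) (l := hornerZ) (by decide +kernel)
      (ev_ne_zero_of_factors (l := [2, 3, 3, 3, 3, 31, 31]) (by simp [h0, h1, h5]) (by decide))
      (by decide +kernel)
  have hu : uZ.MemAt a H :=
    hR.of_mul_left hz (ev_ne_zero_of_factors (l := [2, 7, 7]) (by simp [h0, h3]) (by decide))
      (ev_zero a) (e := 546) (by decide +kernel)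
  have hzu : zYXYMulU.MemAt a H :=
    (memAt_zYXY hx hy h1 h3).mul hu (ev_zero a) (e := 7) (by decide +kernel)
  have huz : uMulZYXY.MemAt a H :=
    hu.mul (memAt_zYXY hx hy h1 h3) (ev_zero a) (e := 1) (by decide +kernel)
  exact huz.of_mul_right hzu
    (ev_ne_zero_of_factors (l := [2, 7, 7, 2, 7, 7]) (by simp [h0, h3]) (by decide +kernel))
    (ev_zero a) (e := 7644) (by decide +kernel)

lemma hasSiegel_plane_generic (hH : H ≤ orthogonalGroupOf F (QPlus F)) (hx : xGL a ∈ H)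
    (hy : yGL F ∈ H) (haF : Subfield.closure {a} = ⊤) (h0 : ev a 2 ≠ 0) (h1 : ev a 3 ≠ 0)
    (h3 : ev a 7 ≠ 0) (h5 : ev a 31 ≠ 0) (s t : F) :
    HasSiegel H (pRow.eval a) (s • bRow₁.eval a + t • bRow₂.eval a) := by
  have hz := memAt_zY hx hy h0 h1
  have hw := memAt_zYXY hx hy h1 h3
  have hq : zQuot.MemAt a H :=
    hw.of_mul_right hz (ev_ne_zero_of_factors (l := [2, 3, 3, 3, 3, 3, 3, 3, 3, 3, 7])
      (by simp [h0, h1, h3]) (by decide)) (ev_zero a) (e := 16705) (by decide +kernel)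
  refine (memAt_siegel hx hy h0 h1 h3 h5).hasSiegel_plane hq hH (ev_zero a) (P := zQuotAction)
    (n := 23271632) (by decide +kernel) (by decide +kernel)
    (ev_ne_zero_of_factors (l := [2, 2, 2, 2, 3, 3, 3, 3, 3, 3, 7, 31, 31, 31])
      (by simp [h0, h1, h3, h5]) (by decide)) haF ?_ s t
  have t₁ := hz.trace_mem hH (ev_zero a) (P := zYAction) (t := clmul 7 31)
    (c := clmul 2 (clmul 15 3)) (by decide +kernel) (by decide +kernel)
    (by rw [show 15 = clmul 3 5 by decide, show 5 = clmul 3 3 by decide]; simp [ev_clmul, h0, h1])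
  have t₂ := hw.trace_mem hH (ev_zero a) (P := zYXYAction) (t := clmul 2 31)
    (c := 15) (by decide +kernel) (by decide +kernel)
    (by rw [show 15 = clmul 3 5 by decide, show 5 = clmul 3 3 by decide]; simp [ev_clmul, h1])
  have t₃ := hq.trace_mem hH (ev_zero a) (P := zQuotAction) (t := clmul 7 (clmul 31 31))
    (c := clmul 2 (clmul 15 (clmul 15 3))) (by decide +kernel) (by decide +kernel)
    (by rw [show 15 = clmul 3 5 by decide, show 5 = clmul 3 3 by decide]; simp [ev_clmul, h0, h1])
  convert div_mem (mul_mem t₁ t₂) t₃ using 1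
  have h15 : ev a 15 ≠ 0 :=
    ev_ne_zero_of_factors (l := [3, 3, 3]) (by simp [h1]) (by decide)
  simp only [ev_clmul]
  conv_lhs => rw [← ev_two a]
  field_simp

lemma hasSiegel_plane_of_cube_root (hH : H ≤ orthogonalGroupOf F (QPlus F)) (hx : xGL a ∈ H)
    (hy : yGL F ∈ H) (haF : Subfield.closure {a} = ⊤) (h0 : ev a 2 ≠ 0) (h1 : ev a 3 ≠ 0)
    (hm : ev a 7 = 0) (s t : F) :
    HasSiegel H (pRow.eval a) (s • bRow₁.eval a + t • bRow₂.eval a) := by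
  have hone : ev a 1 ≠ 0 := by simp [ev_one]
  have hz := memAt_zY hx hy h0 h1
  have hV : matXYPowThree.MemAt a H :=
    (memAt_matXYSq hx hy).mul (memAt_matXYSq hx hy) hm (e := 1) (by decide +kernel)
  have hW : matXYInvPowThree.MemAt a H :=
    (memAt_matXYInvSq hx hy).mul (memAt_matXYInvSq hx hy) hm (e := 1) (by decide +kernel)
  have hh : wordThree.MemAt a H := (memAt_matYInv hy).mul hV hm (e := 1) (by decide +kernel)
  have hl : leftThree.MemAt a H := hW.mul (memAt_matXY hx hy) hm (e := 1) (by decide +kernel)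
  have hr : rightThree.MemAt a H := (memAt_matXYInv hx hy).mul hV hm (e := 1) (by decide +kernel)
  have hD : commThree.MemAt a H := hl.mul hr hm (e := 1) (by decide +kernel)
  have hR : rootThree.MemAt a H :=
    hD.of_mul_self hone hm (e := 1) (k := 1) (c := 3) (l := hornerThree) (by decide +kernel) hone
      (by decide +kernel)
  have hw : zThree.MemAt a H := hR.of_mul_right hh hone hm (e := 1) (by decide +kernel)
  have hw2 : zThreePow2.MemAt a H := hw.mul hw hm (e := 1) (by decide +kernel)
  have hw4 : zThreePow4.MemAt a H := hw2.mul hw2 hm (e := 1) (by decide +kernel)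
  have hu : uThree.MemAt a H := hw4.mul hw hm (e := 1) (by decide +kernel)
  have hzu : zYMulUThree.MemAt a H := hz.mul hu hm (e := 1) (by decide +kernel)
  have huz : uMulZYThree.MemAt a H := hu.mul hz hm (e := 1) (by decide +kernel)
  have hE : (RatMat.siegel pRow ((bRow₁.smul 1).add (bRow₂.smul 0)) 1).MemAt a H :=
    huz.of_mul_right hzu hone hm (e := 1) (by decide +kernel)
  refine hE.hasSiegel_plane hw hH hm (P := zThreeAction) (n := 1) (by decide +kernel)
    (by decide +kernel) hone haF ?_ s t
  have ht := hw.trace_mem hH hm (P := zThreeAction) (t := 3) (c := 1) (by decide +kernel)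
    (by decide +kernel) hone
  rw [ev_one, div_one] at ht
  convert add_mem ht (one_mem _) using 1
  rw [← ev_one a, ← ev_xor]
  exact (ev_two a).symm

lemma hasSiegel_plane_of_fifth_root (hH : H ≤ orthogonalGroupOf F (QPlus F)) (hx : xGL a ∈ H)
    (hy : yGL F ∈ H) (haF : Subfield.closure {a} = ⊤) (h0 : ev a 2 ≠ 0) (h1 : ev a 3 ≠ 0)
    (h3 : ev a 7 ≠ 0) (hm : ev a 31 = 0) (s t : F) :
    HasSiegel H (pRow.eval a) (s • bRow₁.eval a + t • bRow₂.eval a) := by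
  have hone : ev a 1 ≠ 0 := by simp [ev_one]
  have hz := memAt_zY hx hy h0 h1
  have hV := memAt_matXYSq hx hy
  have hh : wordFive.MemAt a H := (memAt_matYInv hy).mul hV hm (e := 1) (by decide +kernel)
  have hl : leftFive.MemAt a H :=
    (memAt_matXYInvSq hx hy).mul (memAt_matXY hx hy) hm (e := 1) (by decide +kernel)
  have hr : rightFive.MemAt a H := (memAt_matXYInv hx hy).mul hV hm (e := 1) (by decide +kernel)
  have hD : commFive.MemAt a H := hl.mul hr hm (e := 1) (by decide +kernel)
  have hR : rootFive.MemAt a H :=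
    hD.of_mul_self hone hm (e := 1) (k := 1) (c := 4) (l := hornerFive) (by decide +kernel) hone
      (by decide +kernel)
  have hw : zFive.MemAt a H := hR.of_mul_right hh hone hm (e := 1) (by decide +kernel)
  have hw2 : zFivePow2.MemAt a H := hw.mul hw hm (e := 1) (by decide +kernel)
  have hw4 : zFivePow4.MemAt a H := hw2.mul hw2 hm (e := 1) (by decide +kernel)
  have hw8 : zFivePow8.MemAt a H := hw4.mul hw4 hm (e := 1) (by decide +kernel)
  have hw16 : zFivePow16.MemAt a H := hw8.mul hw8 hm (e := 1) (by decide +kernel)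
  have hu : uFive.MemAt a H := hw16.mul hw hm (e := 1) (by decide +kernel)
  have hzu : zYMulUFive.MemAt a H := hz.mul hu hm (e := 3) (by decide +kernel)
  have huz : uMulZYFive.MemAt a H := hu.mul hz hm (e := 3) (by decide +kernel)
  have hE : (RatMat.siegel pRow ((bRow₁.smul 8).add (bRow₂.smul 12)) 1).MemAt a H :=
    huz.of_mul_right hzu hone hm (e := 1) (by decide +kernel)
  refine hE.hasSiegel_plane hw hH hm (P := zFiveAction) (n := 14) (by decide +kernel)
    (by decide +kernel) (ev_ne_zero_of_factors (l := [2, 7]) (by simp [h0, h3]) (by decide))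
    haF ?_ s t
  have ht := hw.trace_mem hH hm (P := zFiveAction) (t := 7) (c := 1) (by decide +kernel)
    (by decide +kernel) hone
  rw [ev_one, div_one] at ht
  convert add_mem (mul_mem ht ht) (mul_mem ht (mul_mem ht ht)) using 1
  conv_lhs => rw [← ev_two a]
  simp only [← ev_clmul, ← ev_xor]
  exact ev_eq_of_eqMod hm (by decide +kernel)

/-- All Siegel transformations attached to the plane spanned by `bRow₁` and `bRow₂` lie in a
group containing `x` and `y`. -/
lemma hasSiegel_plane_of_generators (hH : H ≤ orthogonalGroupOf F (QPlus F)) (hx : xGL a ∈ H)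
    (hy : yGL F ∈ H) (haF : Subfield.closure {a} = ⊤) (h0 : ev a 2 ≠ 0) (h1 : ev a 3 ≠ 0)
    (s t : F) :
    HasSiegel H (pRow.eval a) (s • bRow₁.eval a + t • bRow₂.eval a) := by
  by_cases h3 : ev a 7 = 0
  · exact hasSiegel_plane_of_cube_root hH hx hy haF h0 h1 h3 s t
  by_cases h5 : ev a 31 = 0
  · exact hasSiegel_plane_of_fifth_root hH hx hy haF h0 h1 h3 h5 s t
  · exact hasSiegel_plane_generic hH hx hy haF h0 h1 h3 h5 s t

end Plane

section SpanData

/-- The image of `pRow` under `y x y`. -/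
def qRow : PolyRow := ⟨1, 15, 0, 8, 3, 5, 8, 6⟩

/-- The image of `bRow₁` under `y x y`. -/
def cRow₁ : PolyRow := ⟨0, 2, 1, 2, 1, 1, 2, 0⟩

/-- The image of `bRow₂` under `y x y`. -/
def cRow₂ : PolyRow := ⟨0, 0, 0, 5, 0, 2, 4, 0⟩

/-- The image of `pRow` under `y⁻¹`. -/
def qRow' : PolyRow := ⟨0, 1, 1, 0, 0, 3, 3, 3⟩

/-- The image of `bRow₁` under `y⁻¹`. -/
def cRow₁' : PolyRow := ⟨1, 1, 0, 1, 0, 0, 0, 0⟩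

/-- The image of `bRow₂` under `y⁻¹`. -/
def cRow₂' : PolyRow := ⟨0, 0, 0, 0, 1, 0, 0, 1⟩

/-- The first singular line orthogonal to `pRow`: first vector. -/
def rRow : PolyRow := ⟨6, 8, 0, 15, 3, 5, 8, 6⟩

/-- The first singular line orthogonal to `pRow`: second vector. -/
def sRow : PolyRow := ⟨126, 240, 85, 196, 73, 125, 150, 36⟩

/-- The second singular line orthogonal to `pRow`: first vector. -/
def rRow' : PolyRow := ⟨2, 61, 27, 52, 6, 51, 29, 53⟩

/-- The second singular line orthogonal to `pRow`: second vector. -/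
def sRow' : PolyRow := ⟨0, 3, 0, 2, 1, 2, 1, 3⟩

/-- The image of `bRow₁` under the second line, up to a scalar. -/
def nRow₁ : PolyRow := ⟨2, 13, 27, 20, 22, 19, 13, 5⟩

/-- The image of `bRow₂` under the second line, up to a scalar. -/
def nRow₂ : PolyRow := ⟨4, 41, 54, 10, 61, 4, 11, 57⟩

/-- The image of `nRow₁` under the first line, up to a scalar. -/
def mRow₁ : PolyRow := ⟨20, 104, 85, 37, 124, 34, 14, 78⟩

/-- The image of `nRow₂` under the first line, up to a scalar. -/
def mRow₂ : PolyRow := ⟨946, 2912, 4005, 1578, 2063, 1559, 422, 3336⟩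

/-- The matrix with rows spanning the vectors orthogonal to `pRow`. -/
def spanMat : PolyMat := ⟨pRow, bRow₁, bRow₂, nRow₁, nRow₂, mRow₁, mRow₂, ⟨0, 0, 0, 0, 0, 0, 0, 0⟩⟩

/-- A left inverse of `spanMat`, up to a scalar. -/
def spanInv : PolyMat :=
  ⟨⟨1628, 8964, 14896, 305, 993, 2352, 125, 0⟩, ⟨7048, 3936, 8568, 32, 488, 1304, 48, 0⟩,
  ⟨3628, 900, 16040, 147, 387, 360, 15, 0⟩, ⟨228, 14316, 32296, 1293, 1917, 3552, 89, 0⟩,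
  ⟨7048, 3936, 2384, 32, 488, 1304, 48, 0⟩, ⟨4220, 10732, 25704, 1513, 1057, 2112, 101, 0⟩,
  ⟨5664, 8896, 24152, 1240, 1984, 368, 24, 0⟩, ⟨0, 0, 0, 0, 0, 0, 0, 0⟩⟩

/-- A basis of the vectors orthogonal to `pRow`. -/
def perpMat : PolyMat :=
  ⟨⟨1, 0, 0, 0, 0, 0, 0, 0⟩, ⟨0, 1, 0, 0, 0, 0, 0, 0⟩, ⟨0, 0, 1, 0, 0, 0, 0, 1⟩,
  ⟨0, 0, 0, 1, 0, 0, 0, 3⟩, ⟨0, 0, 0, 0, 1, 0, 0, 0⟩, ⟨0, 0, 0, 0, 0, 1, 0, 3⟩,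
  ⟨0, 0, 0, 0, 0, 0, 1, 3⟩, ⟨0, 0, 0, 0, 0, 0, 0, 0⟩⟩

/-- The image of `x` under the linear map attached to two orthogonal singular vectors `r`, `s`. -/
def PolyRow.shift (r s x : PolyRow) : PolyRow :=
  (r.smul (s.swap.dot x)).add (s.smul (r.swap.dot x))

end SpanData

section SiegelSpace

variable {F : Type*} [Field F] [CharP F 2]

/-- The space of vectors all of whose multiples give Siegel transformations at `p` lying
in `H`. -/
def siegelSpace (H : Subgroup (GL (Fin 8) F)) (p : Fin 8 → F) (hp : QPlus F p = 0) :
    Submodule F (Fin 8 → F) where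
  carrier := {v | polar p v = 0 ∧ ∀ c : F, HasSiegel H p (c • v)}
  add_mem' := by
    rintro v w ⟨hv, hv'⟩ ⟨hw, hw'⟩
    refine ⟨by rw [polar_add_right, hv, hw, add_zero], fun c => ?_⟩
    rw [smul_add]
    exact (hv' c).add (by rw [polar_smul_right, hv, mul_zero])
      (by rw [polar_smul_right, hw, mul_zero]) (hw' c)
  zero_mem' := by
    refine ⟨by simp [polar], fun c => ?_⟩
    have := hasSiegel_smul_self H hp 0
    rwa [zero_smul, ← smul_zero c] at this
  smul_mem' := by
    rintro t v ⟨hv, hv'⟩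
    refine ⟨by rw [polar_smul_right, hv, mul_zero], fun c => ?_⟩
    rw [smul_smul]
    exact hv' _

variable {H : Subgroup (GL (Fin 8) F)} {p r s x : Fin 8 → F} {hp : QPlus F p = 0}

lemma shift_mem_siegelSpace (hH : H ≤ orthogonalGroupOf F (QPlus F)) (h : HasSiegel H r s)
    (hs : QPlus F s = 0) (hpr : polar p r = 0) (hps : polar p s = 0)
    (hx : x ∈ siegelSpace H p hp) : polar s x • r + polar r x • s ∈ siegelSpace H p hp := by
  obtain ⟨g, hg, hS⟩ := h
  have hgp : g.1 *ᵥ p = p := by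
    rw [hS, siegelFun, polar_comm s, polar_comm r, hpr, hps]
    simp
  have hgx : g.1 *ᵥ x = x + (polar s x • r + polar r x • s) := by
    rw [hS, siegelFun, hs]
    module
  have hmem : g.1 *ᵥ x ∈ siegelSpace H p hp := by
    refine ⟨?_, fun c => ?_⟩
    · conv_lhs => rw [← hgp]
      rw [polar_mulVec (hH hg), hx.1]
    · have := (hx.2 c).conj hg (hH hg)
      rwa [hgp, mulVec_smul] at this
  rw [hgx] at hmem
  exact (Submodule.add_mem_iff_right _ hx).mp hmem

end SiegelSpace

section Span

variable {F : Type*} [Field F] [CharP F 2] {H : Subgroup (GL (Fin 8) F)} {a : F}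

/-- `H` contains the Siegel transformations at `p` attached to the plane spanned by
`b₁` and `b₂`. -/
def PlaneAt (H : Subgroup (GL (Fin 8) F)) (a : F) (p b₁ b₂ : PolyRow) : Prop :=
  ∀ s t : F, HasSiegel H (p.eval a) (s • b₁.eval a + t • b₂.eval a)

lemma PlaneAt.hasSiegel_smul {p b₁ b₂ r s : PolyRow} (h : PlaneAt H a p b₁ b₂) {A : RatMat}
    (hA : A.MemAt a H) (hH : H ≤ orthogonalGroupOf F (QPlus F)) {k k' x y : ℕ} (hk : ev a k ≠ 0)
    (hk' : ev a k' ≠ 0) (hr : (r.smul k).eqv 0 (A.num.mulVec p))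
    (hs : (s.smul k').eqv 0 (A.num.mulVec ((b₁.smul x).add (b₂.smul y)))) (c : F) :
    HasSiegel H (r.eval a) (c • s.eval a) := by
  obtain ⟨hA0, g, hg, hgA⟩ := hA
  replace hr := PolyRow.eval_eq_of_eqv (ev_zero a) hr
  replace hs := PolyRow.eval_eq_of_eqv (ev_zero a) hs
  rw [PolyRow.eval_smul, PolyMat.eval_mulVec] at hr hs
  rw [PolyRow.eval_add, PolyRow.eval_smul, PolyRow.eval_smul] at hs
  set d := c * ev a A.den ^ 2 / (ev a k * ev a k') with hd
  have := (h (d * ev a x) (d * ev a y)).conj hg (hH hg)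
  rw [hgA, RatMat.val, smul_mulVec, smul_mulVec, ← hr, ← smul_smul, ← smul_smul, ← smul_add,
    mulVec_smul, ← hs, smul_smul, hasSiegel_smul_left, smul_smul, smul_smul, smul_smul] at this
  convert this using 2
  rw [hd]
  field_simp

lemma PlaneAt.map {p b₁ b₂ : PolyRow} (h : PlaneAt H a p b₁ b₂) {A : RatMat}
    (hA : A.MemAt a H) (hH : H ≤ orthogonalGroupOf F (QPlus F)) (hden : A.den = 1)
    {p' b₁' b₂' : PolyRow} (hp : p'.eqv 0 (A.num.mulVec p)) (h₁ : b₁'.eqv 0 (A.num.mulVec b₁))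
    (h₂ : b₂'.eqv 0 (A.num.mulVec b₂)) : PlaneAt H a p' b₁' b₂' := by
  intro s t
  obtain ⟨-, g, hg, hgA⟩ := hA
  have := (h s t).conj hg (hH hg)
  rw [hgA, RatMat.val, hden, ev_one, inv_one, one_smul, mulVec_add, mulVec_smul, mulVec_smul,
    ← PolyMat.eval_mulVec, ← PolyMat.eval_mulVec, ← PolyMat.eval_mulVec] at this
  rwa [PolyRow.eval_eq_of_eqv (ev_zero a) hp, PolyRow.eval_eq_of_eqv (ev_zero a) h₁,
    PolyRow.eval_eq_of_eqv (ev_zero a) h₂]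

lemma PlaneAt.memAt_siegel {p b₁ b₂ : PolyRow} (h : PlaneAt H a p b₁ b₂) (x y : ℕ) {c : ℕ}
    (hc : ev a c ≠ 0) : (RatMat.siegel p ((b₁.smul x).add (b₂.smul y)) c).MemAt a H := by
  rw [RatMat.memAt_siegel_iff hc, PolyRow.eval_add, PolyRow.eval_smul, PolyRow.eval_smul, smul_add,
    smul_smul, smul_smul]
  exact h _ _

/-- A certificate for `shift_mem_siegelSpace` at `pRow`. -/
def lineCheck (r s : PolyRow) : Bool :=
  s.quad == 0 && pRow.swap.dot r == 0 && pRow.swap.dot s == 0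

lemma shift_mem_of_lineCheck (hH : H ≤ orthogonalGroupOf F (QPlus F)) {r s x n : PolyRow}
    (h : HasSiegel H (r.eval a) (s.eval a)) (hl : lineCheck r s)
    (hx : x.eval a ∈ siegelSpace H (pRow.eval a) (QPlus_pRow a)) {k : ℕ} (hk : ev a k ≠ 0)
    (hn : (n.smul k).eqv 0 (r.shift s x)) :
    n.eval a ∈ siegelSpace H (pRow.eval a) (QPlus_pRow a) := by
  simp only [lineCheck, Bool.and_eq_true, beq_iff_eq] at hl
  obtain ⟨⟨hs, hpr⟩, hps⟩ := hl
  have := shift_mem_siegelSpace hH h (by rw [PolyRow.QPlus_eval, hs, ev_zero])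
    (by rw [PolyRow.polar_eval, hpr, ev_zero]) (by rw [PolyRow.polar_eval, hps, ev_zero]) hx
  replace hn := PolyRow.eval_eq_of_eqv (ev_zero a) hn
  rw [PolyRow.shift, PolyRow.eval_add, PolyRow.eval_smul, PolyRow.eval_smul, PolyRow.eval_smul,
    ← PolyRow.polar_eval, ← PolyRow.polar_eval] at hn
  rw [← hn] at this
  exact (Submodule.smul_mem_iff _ hk).mp this

lemma mem_of_polar_pRow {S : Submodule F (Fin 8 → F)} (h : ∀ i, perpMat.eval a i ∈ S)
    {v : Fin 8 → F} (hv : polar (pRow.eval a) v = 0) : v ∈ S := by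
  have key : v = ∑ i, v i • perpMat.eval a i := by
    have h7 : v 7 = v 2 + ev a 3 * v 3 + ev a 3 * v 5 + ev a 3 * v 6 := by
      rw [← CharTwo.add_eq_zero, ← hv]
      simp [polar, pRow, PolyRow.eval, ev_zero, ev_one]
      ring
    rw [Fin.sum_univ_eight]
    ext i
    fin_cases i <;>
      simp [perpMat, PolyMat.eval, PolyRow.eval, ev_zero, ev_one]
    rw [h7]
    ring
  rw [key]
  exact Submodule.sum_mem _ fun i _ => S.smul_mem _ (h i)

lemma rows_mul_mem {S : Submodule F (Fin 8 → F)} {L M : Matrix (Fin 8) (Fin 8) F}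
    (h : ∀ i, M i ∈ S) (i : Fin 8) : (L * M) i ∈ S := by
  rw [mul_apply_eq_vecMul, vecMul_eq_sum]
  exact Submodule.sum_mem _ fun j _ => S.smul_mem _ (h j)

/-- The Siegel transformations attached to the plane spanned by `bRow₁` and `bRow₂` and the
generators yield all Siegel transformations at `pRow`. -/
lemma hasAllSiegel_pRow (hH : H ≤ orthogonalGroupOf F (QPlus F)) (hx : xGL a ∈ H)
    (hy : yGL F ∈ H) (h0 : ev a 2 ≠ 0) (h1 : ev a 3 ≠ 0)
    (hplane : PlaneAt H a pRow bRow₁ bRow₂) : HasAllSiegel H (pRow.eval a) := by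
  have hone : ev a 1 ≠ 0 := by simp [ev_one]
  have hYXY : matYXY.MemAt a H :=
    (memAt_matY hy).mul (memAt_matXY hx hy) (ev_zero a) (e := 1) (by decide +kernel)
  have hq : PlaneAt H a qRow cRow₁ cRow₂ :=
    hplane.map hYXY hH rfl (by decide +kernel) (by decide +kernel) (by decide +kernel)
  have hq' : PlaneAt H a qRow' cRow₁' cRow₂' :=
    hplane.map (memAt_matYInv hy) hH rfl (by decide +kernel) (by decide +kernel)
      (by decide +kernel)
  have h4 : ev a 4 ≠ 0 := ev_ne_zero_of_factors (l := [2, 2]) (by simp [h0]) (by decide)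
  have h6 : ev a 6 ≠ 0 := ev_ne_zero_of_factors (l := [2, 3]) (by simp [h0, h1]) (by decide)
  have h16 : ev a 16 ≠ 0 := ev_ne_zero_of_factors (l := [4, 4]) (by simp [h4]) (by decide)
  have hline := hq.hasSiegel_smul (hq'.memAt_siegel 7 0 h4) hH (r := rRow) (s := sRow) (k := 16)
    (k' := 16) (x := 73) (y := 8) h16 h16 (by decide +kernel) (by decide +kernel) 1
  have hline' := hq.hasSiegel_smul (hq'.memAt_siegel 1 3 h6) hH (r := rRow') (s := sRow') (k := 6)
    (k' := 20) (x := 1) (y := 0) h6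
    (ev_ne_zero_of_factors (l := [6, 6]) (by simp [h6]) (by decide))
    (by decide +kernel) (by decide +kernel) 1
  rw [one_smul] at hline hline'
  set S := siegelSpace H (pRow.eval a) (QPlus_pRow a) with hSdef
  have hp : pRow.eval a ∈ S := ⟨polar_self _, hasSiegel_smul_self H (QPlus_pRow a)⟩
  have hb₁ : bRow₁.eval a ∈ S := ⟨polar_pRow_bRow₁ a, fun c => by simpa using hplane c 0⟩
  have hb₂ : bRow₂.eval a ∈ S := ⟨polar_pRow_bRow₂ a, fun c => by simpa using hplane 0 c⟩
  have hn₁ : nRow₁.eval a ∈ S :=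
    shift_mem_of_lineCheck hH hline' (by decide) hb₁ (k := 2) h0 (by decide +kernel)
  have hn₂ : nRow₂.eval a ∈ S :=
    shift_mem_of_lineCheck hH hline' (by decide) hb₂ (k := 1) hone (by decide +kernel)
  have hm₁ : mRow₁.eval a ∈ S :=
    shift_mem_of_lineCheck hH hline (by decide) hn₁ (k := 64)
      (ev_ne_zero_of_factors (l := [4, 16]) (by simp [h4, h16]) (by decide)) (by decide +kernel)
  have hm₂ : mRow₂.eval a ∈ S :=
    shift_mem_of_lineCheck hH hline (by decide) hn₂ (k := 4) h4 (by decide +kernel)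
  have hspan : ∀ i, spanMat.eval a i ∈ S := by
    intro i
    fin_cases i
    · exact hp
    · exact hb₁
    · exact hb₂
    · exact hn₁
    · exact hn₂
    · exact hm₁
    · exact hm₂
    · convert S.zero_mem
      ext i
      fin_cases i <;> exact ev_zero a
  have hperp : (perpMat.smul 10280).eval a = (spanInv.mul spanMat).eval a :=
    PolyMat.eval_eq_of_eqv (ev_zero a) (by decide +kernel)
  rw [PolyMat.eval_smul, PolyMat.eval_mul] at hperp
  have hD : ev a 10280 ≠ 0 :=
    ev_ne_zero_of_factors (l := [2, 2, 2, 3, 3, 3, 3, 3, 3, 3, 3, 3, 3]) (by simp [h0, h1])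
      (by decide)
  intro v hv
  have hvS : v ∈ S := mem_of_polar_pRow (fun i => by
    have := rows_mul_mem (L := spanInv.eval a) hspan i
    rw [← hperp] at this
    exact (Submodule.smul_mem_iff _ hD).mp this) hv
  simpa using hvS.2 1

end Span

section Generation

variable {F : Type*} [Field F] [CharP F 2] {a : F}

/-- A generator of a field of characteristic two with more than two elements is not fixed by
Frobenius. -/
lemma sq_ne_self_of_closure [Fintype F] (hq : 4 ≤ Fintype.card F)
    (ha : Subfield.closure {a} = ⊤) : a ^ 2 ≠ a := by
  classical
  intro hsq
  have hle : Subfield.closure {a} ≤ (frobenius F 2).eqLocusField (RingHom.id F) :=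
    Subfield.closure_le.2 (by rintro _ rfl; exact hsq)
  have hfix (x : F) : x ∈ ({0, 1} : Finset F) := by
    have hx : x ^ 2 = x := hle (ha ▸ Subfield.mem_top x)
    have : x * (x - 1) = 0 := by linear_combination hx
    rcases mul_eq_zero.1 this with h | h
    · simp [h]
    · simp [sub_eq_zero.1 h]
  have hcard : Fintype.card F ≤ ({0, 1} : Finset F).card :=
    Finset.card_le_card fun x _ => hfix x
  have := Finset.card_le_two (a := (0 : F)) (b := 1)
  omega

lemma polar_pRow_yGL (a : F) : polar (pRow.eval a) ((yGL F).1 *ᵥ pRow.eval a) = a := by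
  have h2 : (2 : F) = 0 := CharTwo.two_eq_zero
  have h3 : ev a 3 = 1 + a := by simp [ev_eq a 3, ev_one]
  rw [yGL_mulVec]
  simp [polar, pRow, PolyRow.eval, ev_zero, ev_one, h3]
  linear_combination (2 + 2 * a + a ^ 2) * h2

lemma closure_eq_derivedOrthogonal [Fintype F] (hq : 4 ≤ Fintype.card F)
    (ha : Subfield.closure {a} = ⊤) :
    Subgroup.closure {xGL a, yGL F} = derivedOrthogonal F := by
  have hsq := sq_ne_self_of_closure hq ha
  have h0 : ev a 2 ≠ 0 := by
    rw [ev_two]; rintro rfl; simp at hsq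
  have h1 : ev a 3 ≠ 0 := by
    have h3 : ev a 3 = 1 + a := by simp [ev_eq a 3, ev_one]
    rw [h3, ← CharTwo.sub_eq_add]
    intro h
    rw [← sub_eq_zero.1 h] at hsq; simp at hsq
  set H := Subgroup.closure {xGL a, yGL F} with hHdef
  have hx : xGL a ∈ H := Subgroup.subset_closure (by simp)
  have hy : yGL F ∈ H := Subgroup.subset_closure (by simp)
  have hH : H ≤ orthogonalGroupOf F (QPlus F) := by
    rw [hHdef, Subgroup.closure_le]
    rintro g (rfl | rfl)
    exacts [xGL_mem a, yGL_mem]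
  have hp : HasAllSiegel H (pRow.eval a) :=
    hasAllSiegel_pRow hH hx hy h0 h1 (hasSiegel_plane_of_generators hH hx hy ha h0 h1)
  refine le_antisymm ?_ (map_commutator_le_siegelGroup.trans ?_)
  · rw [hHdef, Subgroup.closure_le]
    rintro g (rfl | rfl)
    exacts [xGL_mem_derivedOrthogonal a, yGL_mem_derivedOrthogonal]
  · refine siegelGroup_le_of_hyperbolic_pair hH hp (hp.map hy yGL_mem) (QPlus_pRow a) ?_ ?_
    · rw [yGL_mem, QPlus_pRow]
    · rw [polar_pRow_yGL, ← ev_two a]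
      exact h0

end Generation

end OmegaEight

/-- For `q = 2^f ≥ 4` and `a` a generator of `𝔽_q`, the matrices `x(a)` and `y`
have orders 2 and 3 and generate `Ω₈⁺(q)`, the derived subgroup of the
orthogonal group of the plus-type quadratic form `Q⁺`. In particular `Ω₈⁺(q)`
is `(2,3)`-generated for all even `q ≥ 4`. -/
theorem xPlusEven_yPlus_generate_omega8plus
    (f : ℕ) (F : Type*) [Field F] [Fintype F]
    (hcard : Fintype.card F = 2 ^ f) (hq : 4 ≤ Fintype.card F)
    (a : F) (ha : Subfield.closure {a} = ⊤) :
    ∃ xu yu : GL (Fin 8) F,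
      (xu : Matrix (Fin 8) (Fin 8) F) = xPlusEven F a ∧
      (yu : Matrix (Fin 8) (Fin 8) F) = yPlus F ∧
      orderOf xu = 2 ∧ orderOf yu = 3 ∧
      Subgroup.closure {xu, yu} =
        Subgroup.map (orthogonalGroupOf F (QPlus F)).subtype
          (commutator ↥(orthogonalGroupOf F (QPlus F))) := by
  have : CharP F 2 := charP_of_card_eq_prime_pow hcard
  exact ⟨OmegaEight.xGL a, OmegaEight.yGL F, rfl, OmegaEight.yGL_val, OmegaEight.orderOf_xGL a,
    OmegaEight.orderOf_yGL, OmegaEight.closure_eq_derivedOrthogonal hq ha⟩
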